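/- Let d ≥ 2 and let w be a doubling weight on S^{d-1} normalized by w(S^{d-1}) = 1 that is in addition essentially bounded on S^{d-1}. Then there exist constants K_w > 0 (depending only on d and the doubling constant of w) and c_* > 0 (depending only on d, ‖w‖_∞ and the doubling constant of w) such that for every positive integer n and every integer N satisfying N ≥ K_w / w(B(x, 1/n)) for all x ∈ S^{d-1}, there exist N distinct points z_1, …, z_N ∈ S^{d-1} with ∫_{S^{d-1}} P(x) w(x) dσ_d(x) = (1/N) · Σ_{j=1}^N P(z_j) for every P ∈ Π_n^d, and which are well separated: min_{1≤i≠j≤N} dist(z_i, z_j) ≥ c_* · N^{-1/(d-1)}. -/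

import Mathlib

open MeasureTheory Real Set
open scoped InnerProductSpace

noncomputable section

variable {d : ℕ}

/-- The unit sphere `S^{d-1}` of `ℝ^d`. -/
def unitSphere (d : ℕ) : Set (EuclideanSpace ℝ (Fin d)) :=
  Metric.sphere (0 : EuclideanSpace ℝ (Fin d)) 1

/-- The geodesic distance `dist(x,y) = arccos (x ⬝ y)`. -/
def gdist (x y : EuclideanSpace ℝ (Fin d)) : ℝ := Real.arccos ⟪x, y⟫_ℝ

/-- The spherical cap with center `x` and radius `r`. -/
def cap (x : EuclideanSpace ℝ (Fin d)) (r : ℝ) : Set (EuclideanSpace ℝ (Fin d)) :=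
  {y ∈ unitSphere d | gdist x y ≤ r}

/-- The surface Lebesgue measure on the unit sphere, realized as the
`(d-1)`-dimensional Hausdorff measure restricted to the sphere. -/
def sphMeasure (d : ℕ) : Measure (EuclideanSpace ℝ (Fin d)) :=
  (Measure.hausdorffMeasure ((d : ℝ) - 1)).restrict (unitSphere d)

/-- `w(A) = ∫_A w dσ_d`. -/
def wMass (w : EuclideanSpace ℝ (Fin d) → ℝ) (A : Set (EuclideanSpace ℝ (Fin d))) : ℝ :=
  ∫ x in A, w x ∂(sphMeasure d)

/-- Evaluation of a `d`-variate real polynomial at a point of `ℝ^d`. -/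
def pEval (P : MvPolynomial (Fin d) ℝ) (x : EuclideanSpace ℝ (Fin d)) : ℝ :=
  MvPolynomial.eval (fun i => x i) P

/-- The geodesic arc joining `x` and `y`. -/
def arcSeg (x y : EuclideanSpace ℝ (Fin d)) : Set (EuclideanSpace ℝ (Fin d)) :=
  {z ∈ unitSphere d | ∃ t₁ t₂ : ℝ, 0 ≤ t₁ ∧ 0 ≤ t₂ ∧ z = t₁ • x + t₂ • y}

/-- Geodesic convexity of a subset of the sphere. -/
def GeoConvex (A : Set (EuclideanSpace ℝ (Fin d))) : Prop :=
  ∀ x ∈ A, ∀ y ∈ A, arcSeg x y ⊆ A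

/-- The interior of a subset of the sphere relative to the sphere. -/
def sphInterior (A : Set (EuclideanSpace ℝ (Fin d))) : Set (EuclideanSpace ℝ (Fin d)) :=
  {x ∈ A | ∃ ε : ℝ, 0 < ε ∧ Metric.ball x ε ∩ unitSphere d ⊆ A}

/-- The geodesic simplex spanned by `ξ 0, …, ξ (d-1)`. -/
def geodSimplex (ξ : Fin d → EuclideanSpace ℝ (Fin d)) :
    Set (EuclideanSpace ℝ (Fin d)) :=
  {z | ∃ t : Fin d → ℝ, (∀ j, 0 ≤ t j) ∧ (∑ j, t j) = 1 ∧
    z = ‖∑ j, t j • ξ j‖⁻¹ • ∑ j, t j • ξ j}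

/-- An admissible family `ξ 0, …, ξ (d-1)` of points of the sphere (the indices
`0, 1, …, d-1` correspond to `ξ_1, ξ_2, …, ξ_d` in the paper). -/
def Admissible (ξ : Fin d → EuclideanSpace ℝ (Fin d)) : Prop :=
  LinearIndependent ℝ ξ ∧ (∀ j, ξ j ∈ unitSphere d) ∧
  (∀ i j : Fin d, 1 ≤ (i : ℕ) → 1 ≤ (j : ℕ) → i ≠ j → ⟪ξ i, ξ j⟫_ℝ = 0) ∧
  (∀ i j : Fin d, (i : ℕ) = 0 → (j : ℕ) = 1 →
    Real.arccos ⟪ξ i, ξ j⟫_ℝ ∈ Set.Icc (π / 6) (π / 2)) ∧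
  (∀ i j : Fin d, (i : ℕ) = 0 → 2 ≤ (j : ℕ) → ⟪ξ i, ξ j⟫_ℝ = 0)

/-- A strongly `ε`-separated family of points of the sphere. -/
def StronglySep (ε : ℝ) (η : Fin d → EuclideanSpace ℝ (Fin d)) : Prop :=
  Function.Injective η ∧ (∀ j, η j ∈ unitSphere d) ∧
  ∀ j : Fin d, ∀ y ∈ Submodule.span ℝ (η '' {i | i ≠ j}), ε ≤ ‖η j - y‖

/-- The reflection negating the last coordinate. -/
def lastNeg (d : ℕ) (x : EuclideanSpace ℝ (Fin d)) : EuclideanSpace ℝ (Fin d) :=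
  (EuclideanSpace.equiv (Fin d) ℝ).symm fun i => if (i : ℕ) = d - 1 then -(x i) else x i

/-- The gradient of a `d`-variate polynomial, as a vector of `ℝ^d`. -/
def polyGrad (P : MvPolynomial (Fin d) ℝ) (x : EuclideanSpace ℝ (Fin d)) :
    EuclideanSpace ℝ (Fin d) :=
  (EuclideanSpace.equiv (Fin d) ℝ).symm fun i =>
    MvPolynomial.eval (fun j => x j) (MvPolynomial.pderiv i P)

/-- The tangential gradient `∇₀P(x) = ∇P(x) − (x⬝∇P(x))·x`. -/
def tGrad (P : MvPolynomial (Fin d) ℝ) (x : EuclideanSpace ℝ (Fin d)) :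
    EuclideanSpace ℝ (Fin d) :=
  polyGrad P x - ⟪x, polyGrad P x⟫_ℝ • x

/-- The affine hyperplane through the points `ξ j`. -/
def hplane (ξ : Fin d → EuclideanSpace ℝ (Fin d)) : Set (EuclideanSpace ℝ (Fin d)) :=
  (affineSpan ℝ (Set.range ξ) : Set (EuclideanSpace ℝ (Fin d)))

/-- The ball `B(x,r)_H = {y ∈ H : ‖x − y‖ ≤ r}` in a hyperplane `H`. -/
def ballH (H : Set (EuclideanSpace ℝ (Fin d))) (x : EuclideanSpace ℝ (Fin d)) (r : ℝ) :
    Set (EuclideanSpace ℝ (Fin d)) :=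
  {y ∈ H | ‖x - y‖ ≤ r}

/-- `w(A) = ∫_A w` with respect to `(d−1)`-dimensional Hausdorff (surface) measure. -/
def hMass (w : EuclideanSpace ℝ (Fin d) → ℝ) (A : Set (EuclideanSpace ℝ (Fin d))) : ℝ :=
  ∫ x in A, w x ∂(Measure.hausdorffMeasure ((d : ℝ) - 1))

/-- The interior of `A` relative to a hyperplane `H`. -/
def hInterior (H A : Set (EuclideanSpace ℝ (Fin d))) : Set (EuclideanSpace ℝ (Fin d)) :=
  {x ∈ A | ∃ ε : ℝ, 0 < ε ∧ Metric.ball x ε ∩ H ⊆ A}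

/-! ### Bernstein inequalities for complex polynomials on the unit circle -/

theorem Polynomial.norm_eval_le_of_norm_le_one {p : Polynomial ℂ} {M : ℝ}
    (h : ∀ z : ℂ, ‖z‖ = 1 → ‖p.eval z‖ ≤ M) {z : ℂ} (hz : ‖z‖ ≤ 1) : ‖p.eval z‖ ≤ M := by
  refine Complex.norm_le_of_forall_mem_frontier_norm_le (f := fun z => p.eval z)
    (U := Metric.ball (0 : ℂ) 1) Metric.isBounded_ball
    (p.differentiable.diffContOnCl) (fun w hw => h w ?_) ?_
  · rw [frontier_ball _ one_ne_zero] at hw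
    simpa using hw
  · rw [closure_ball _ one_ne_zero]
    simpa using hz

theorem Polynomial.norm_eval_reflect_mul_pow {p : Polynomial ℂ} {m : ℕ} (hp : p.natDegree ≤ m)
    {z : ℂ} (hz : z ≠ 0) : (p.reflect m).eval z⁻¹ * z ^ m = p.eval z := by
  let : Invertible z := invertibleOfNonzero hz
  have := Polynomial.eval₂_reflect_mul_pow (RingHom.id ℂ) z m p hp
  rwa [invOf_eq_inv] at this

theorem Polynomial.norm_eval_le_mul_pow {p : Polynomial ℂ} {M : ℝ} {m : ℕ}
    (hp : p.natDegree ≤ m) (h : ∀ z : ℂ, ‖z‖ = 1 → ‖p.eval z‖ ≤ M) {z : ℂ} (hz : 1 ≤ ‖z‖) :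
    ‖p.eval z‖ ≤ M * ‖z‖ ^ m := by
  have hz0 : z ≠ 0 := by
    rintro rfl
    simp at hz
    linarith
  have hq : ∀ w : ℂ, ‖w‖ = 1 → ‖(p.reflect m).eval w‖ ≤ M := by
    intro w hw
    have hw0 : w ≠ 0 := by
      rintro rfl
      simp at hw
    have h1 := Polynomial.norm_eval_reflect_mul_pow hp (inv_ne_zero hw0)
    have h2 := h w⁻¹ (by simp [hw])
    rw [← h1, inv_inv, norm_mul, norm_pow, norm_inv, hw] at h2
    simpa using h2
  have h3 := Polynomial.norm_eval_le_of_norm_le_one hq (z := z⁻¹)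
    (by rw [norm_inv]; exact inv_le_one_of_one_le₀ hz)
  rw [← Polynomial.norm_eval_reflect_mul_pow hp hz0, norm_mul, norm_pow]
  gcongr

/-- Bernstein's inequality on the unit circle, with a non-optimal constant. -/
theorem Polynomial.norm_derivative_eval_one_le {p : Polynomial ℂ} {M : ℝ} {m : ℕ} (hm : 0 < m)
    (hp : p.natDegree ≤ m) (h : ∀ z : ℂ, ‖z‖ = 1 → ‖p.eval z‖ ≤ M) :
    ‖p.derivative.eval 1‖ ≤ 3 * m * M := by
  have hM : 0 ≤ M := (norm_nonneg _).trans (h 1 (by simp))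
  have hm' : (0 : ℝ) < m := by exact_mod_cast hm
  have hexp : (1 + 1 / (m : ℝ)) ^ m ≤ 3 := by
    have h1 : (1 + 1 / (m : ℝ)) ≤ Real.exp (1 / m) := by
      have := Real.add_one_le_exp (1 / (m : ℝ))
      linarith
    calc (1 + 1 / (m : ℝ)) ^ m ≤ Real.exp (1 / m) ^ m := by gcongr
      _ = Real.exp 1 := by
        rw [← Real.exp_nat_mul]
        congr 1
        field_simp
      _ ≤ 3 := by
        have := Real.exp_one_lt_d9
        linarith
  have hb : ∀ z ∈ Metric.sphere (1 : ℂ) (1 / m), ‖p.eval z‖ ≤ 3 * M := by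
    intro z hz
    rw [mem_sphere_iff_norm] at hz
    rcases le_total ‖z‖ 1 with h1 | h1
    · have := Polynomial.norm_eval_le_of_norm_le_one h h1
      linarith
    · have h2 := Polynomial.norm_eval_le_mul_pow hp h h1
      have h3 : ‖z‖ ≤ 1 + 1 / m := by
        calc ‖z‖ = ‖1 + (z - 1)‖ := by ring_nf
          _ ≤ ‖(1 : ℂ)‖ + ‖z - 1‖ := norm_add_le _ _
          _ = 1 + 1 / m := by rw [hz]; simp
      calc ‖p.eval z‖ ≤ M * ‖z‖ ^ m := h2
        _ ≤ M * (1 + 1 / (m : ℝ)) ^ m := by gcongr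
        _ ≤ M * 3 := by gcongr
        _ = 3 * M := by ring
  have := Complex.norm_deriv_le_of_forall_mem_sphere_norm_le (f := fun z => p.eval z)
    (c := 1) (by positivity : (0 : ℝ) < 1 / m) p.differentiable.diffContOnCl hb
  rw [Polynomial.deriv] at this
  calc _ ≤ _ := this
    _ = 3 * m * M := by field_simp

/-- A Bernstein inequality at `1` for polynomials dominated by a weight growing away from `1`. -/
theorem Polynomial.exists_norm_derivative_eval_one_le (a : ℕ) : ∃ C : ℝ, 0 < C ∧
    ∀ (n : ℕ) (p : Polynomial ℂ) (M : ℝ), 0 < n → p.natDegree ≤ 4 * n →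
      (∀ z : ℂ, ‖z‖ = 1 → ‖p.eval z‖ ≤ M * (1 + n * ‖z - 1‖) ^ a) →
      ‖p.derivative.eval 1‖ ≤ C * n * M := by
  refine ⟨3 * (4 + a) * 3 ^ a + 3 * a, by positivity, ?_⟩
  intro n p M hn hp h
  have hn' : (0 : ℝ) < n := by exact_mod_cast hn
  have hp1 : ‖p.eval 1‖ ≤ M := by simpa using h 1 (by simp)
  have hM : 0 ≤ M := (norm_nonneg _).trans hp1
  let D : Polynomial ℂ := Polynomial.C ((n : ℂ)⁻¹) * ∑ j ∈ Finset.range n, Polynomial.X ^ j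
  have hDdeg : D.natDegree ≤ n := by
    refine (Polynomial.natDegree_C_mul_le _ _).trans ?_
    refine Polynomial.natDegree_sum_le_of_forall_le _ _ (fun j hj => ?_)
    simpa using (Finset.mem_range.1 hj).le
  have hDev : ∀ z, D.eval z = (n : ℂ)⁻¹ * ∑ j ∈ Finset.range n, z ^ j := by
    intro z
    simp [D, Polynomial.eval_finsetSum]
  have hD1 : ∀ z : ℂ, ‖z‖ = 1 → ‖D.eval z‖ ≤ 1 := by
    intro z hz
    rw [hDev, norm_mul, norm_inv, Complex.norm_natCast]
    have : ‖∑ j ∈ Finset.range n, z ^ j‖ ≤ n := by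
      refine (norm_sum_le _ _).trans ?_
      simp [hz]
    calc (n : ℝ)⁻¹ * _ ≤ (n : ℝ)⁻¹ * n := by gcongr
      _ = 1 := by field_simp
  have hD2 : ∀ z : ℂ, ‖z‖ = 1 → (1 + n * ‖z - 1‖) * ‖D.eval z‖ ≤ 3 := by
    intro z hz
    have h2 : n * ‖z - 1‖ * ‖D.eval z‖ ≤ 2 := by
      have : (n : ℂ) * (z - 1) * D.eval z = z ^ n - 1 := by
        have hnC : (n : ℂ) ≠ 0 := by exact_mod_cast hn.ne'
        rw [hDev, ← mul_geom_sum]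
        field_simp
      calc n * ‖z - 1‖ * ‖D.eval z‖ = ‖(n : ℂ) * (z - 1) * D.eval z‖ := by simp
        _ = ‖z ^ n - 1‖ := by rw [this]
        _ ≤ ‖z ^ n‖ + ‖(1 : ℂ)‖ := norm_sub_le _ _
        _ = 2 := by simp [hz]; norm_num
    have := hD1 z hz
    linarith
  have hDeval1 : D.eval 1 = 1 := by
    have : (n : ℂ) ≠ 0 := by exact_mod_cast hn.ne'
    rw [hDev]
    simp [this]
  have hD' : ‖D.derivative.eval 1‖ ≤ 3 * n := by
    simpa using Polynomial.norm_derivative_eval_one_le hn hDdeg hD1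
  have hprod : ‖(p * D ^ a).derivative.eval 1‖ ≤ 3 * ((4 + a) * n : ℕ) * (3 ^ a * M) := by
    refine Polynomial.norm_derivative_eval_one_le (by positivity) ?_ ?_
    · refine Polynomial.natDegree_mul_le.trans ?_
      have := Polynomial.natDegree_pow_le (p := D) (n := a)
      nlinarith
    · intro z hz
      rw [Polynomial.eval_mul, Polynomial.eval_pow, norm_mul, norm_pow]
      calc _ ≤ M * (1 + n * ‖z - 1‖) ^ a * ‖D.eval z‖ ^ a := by gcongr; exact h z hz
        _ = M * ((1 + n * ‖z - 1‖) * ‖D.eval z‖) ^ a := by rw [mul_pow]; ring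
        _ ≤ M * 3 ^ a := by gcongr; exact hD2 z hz
        _ = _ := by ring
  have hexpand : (p * D ^ a).derivative.eval 1
      = p.derivative.eval 1 + p.eval 1 * (a * D.derivative.eval 1) := by
    rw [Polynomial.derivative_mul, Polynomial.derivative_pow]
    simp [hDeval1]
  have hfin : p.derivative.eval 1
      = (p * D ^ a).derivative.eval 1 - p.eval 1 * (a * D.derivative.eval 1) := by
    rw [hexpand]; ring
  rw [hfin]
  refine (norm_sub_le _ _).trans ?_
  have h4 : ‖p.eval 1 * (a * D.derivative.eval 1)‖ ≤ M * (a * (3 * n)) := by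
    rw [norm_mul, norm_mul, Complex.norm_natCast]
    gcongr
  push_cast at hprod
  nlinarith [hprod, h4]

/-! ### Polynomials along great circles -/

/-- `f` is a trigonometric polynomial of degree at most `k`. -/
def IsTrigPoly (k : ℕ) (f : ℝ → ℝ) : Prop :=
  ∃ p : Polynomial ℂ, p.natDegree ≤ 2 * k ∧
    ∀ t : ℝ, p.eval (Complex.exp (t * Complex.I)) = Complex.exp (t * Complex.I) ^ k * (f t : ℂ)

theorem isTrigPoly_const (c : ℝ) : IsTrigPoly 0 (fun _ => c) :=
  ⟨Polynomial.C (c : ℂ), by simp, by simp⟩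

theorem IsTrigPoly.mul {k l : ℕ} {f g : ℝ → ℝ} (hf : IsTrigPoly k f) (hg : IsTrigPoly l g) :
    IsTrigPoly (k + l) (fun t => f t * g t) := by
  obtain ⟨p, hp, hp'⟩ := hf
  obtain ⟨q, hq, hq'⟩ := hg
  refine ⟨p * q, Polynomial.natDegree_mul_le.trans (by omega), fun t => ?_⟩
  rw [Polynomial.eval_mul, hp', hq']
  push_cast
  ring

theorem IsTrigPoly.mono {k l : ℕ} {f : ℝ → ℝ} (hf : IsTrigPoly k f) (h : k ≤ l) :
    IsTrigPoly l f := by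
  obtain ⟨p, hp, hp'⟩ := hf
  refine ⟨p * Polynomial.X ^ (l - k), Polynomial.natDegree_mul_le.trans ?_, fun t => ?_⟩
  · simp only [Polynomial.natDegree_X_pow]
    omega
  · rw [Polynomial.eval_mul, hp', Polynomial.eval_pow, Polynomial.eval_X]
    rw [← Nat.add_sub_cancel' h, pow_add, Nat.add_sub_cancel' h]
    ring

theorem IsTrigPoly.add {k : ℕ} {f g : ℝ → ℝ} (hf : IsTrigPoly k f) (hg : IsTrigPoly k g) :
    IsTrigPoly k (fun t => f t + g t) := by
  obtain ⟨p, hp, hp'⟩ := hf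
  obtain ⟨q, hq, hq'⟩ := hg
  refine ⟨p + q, (Polynomial.natDegree_add_le _ _).trans (by omega), fun t => ?_⟩
  rw [Polynomial.eval_add, hp', hq']
  push_cast
  ring

theorem isTrigPoly_sum {ι : Type*} {k : ℕ} (s : Finset ι) (f : ι → ℝ → ℝ)
    (h : ∀ i ∈ s, IsTrigPoly k (f i)) : IsTrigPoly k (fun t => ∑ i ∈ s, f i t) := by
  classical
  induction s using Finset.induction_on with
  | empty => simpa using (isTrigPoly_const 0).mono (Nat.zero_le k)
  | insert a s ha ih =>
    simp only [Finset.sum_insert ha]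
    exact (h a (by simp)).add (ih fun i hi => h i (by simp [hi]))

theorem IsTrigPoly.pow {k : ℕ} {f : ℝ → ℝ} (hf : IsTrigPoly k f) (m : ℕ) :
    IsTrigPoly (m * k) (fun t => f t ^ m) := by
  induction m with
  | zero => simpa using isTrigPoly_const 1
  | succ m ih =>
    simp only [pow_succ, add_mul, one_mul]
    exact ih.mul hf

theorem isTrigPoly_prod {ι : Type*} (s : Finset ι) (k : ι → ℕ) (f : ι → ℝ → ℝ)
    (h : ∀ i ∈ s, IsTrigPoly (k i) (f i)) :
    IsTrigPoly (∑ i ∈ s, k i) (fun t => ∏ i ∈ s, f i t) := by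
  classical
  induction s using Finset.induction_on with
  | empty => simpa using isTrigPoly_const 1
  | insert a s ha ih =>
    simp only [Finset.sum_insert ha, Finset.prod_insert ha]
    exact (h a (by simp)).mul (ih fun i hi => h i (by simp [hi]))

theorem isTrigPoly_cos_add_sin (a b : ℝ) :
    IsTrigPoly 1 (fun t => Real.cos t * a + Real.sin t * b) := by
  refine ⟨Polynomial.C ((a + b * Complex.I) / 2) + Polynomial.C ((a - b * Complex.I) / 2) *
    Polynomial.X ^ 2, ?_, fun t => ?_⟩
  · compute_degree
  · have h1 := Complex.cos_sq_add_sin_sq t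
    simp only [Polynomial.eval_add, Polynomial.eval_C, Polynomial.eval_mul, Polynomial.eval_pow,
      Polynomial.eval_X, Complex.exp_mul_I]
    push_cast
    linear_combination (-(a + b * Complex.I) / 2) * h1 +
      (-(a + b * Complex.I) / 2 * Complex.sin t ^ 2 + a * Complex.sin t ^ 2 -
        b * Complex.cos t * Complex.sin t) * Complex.I_sq

theorem isTrigPoly_pEval {m : ℕ} {Q : MvPolynomial (Fin d) ℝ} (hQ : Q.totalDegree ≤ m)
    (x ξ : EuclideanSpace ℝ (Fin d)) :
    IsTrigPoly m (fun t => pEval Q (Real.cos t • x + Real.sin t • ξ)) := by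
  simp only [pEval, MvPolynomial.eval_eq]
  refine isTrigPoly_sum _ _ fun s hs => ?_
  have h1 : ∑ i ∈ s.support, s i ≤ m := (MvPolynomial.le_totalDegree hs).trans hQ
  have h2 := isTrigPoly_prod s.support (fun i => s i * 1)
    (fun i t => ((Real.cos t • x + Real.sin t • ξ) i) ^ s i)
    (fun i _ => IsTrigPoly.pow (by simpa using isTrigPoly_cos_add_sin (x i) (ξ i)) (s i))
  simp only [mul_one] at h2
  exact ((isTrigPoly_const (Q.coeff s)).mul h2).mono (by omega)

theorem IsTrigPoly.exists_abs_deriv_zero_le (a : ℕ) : ∃ C : ℝ, 0 < C ∧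
    ∀ (n : ℕ) (f : ℝ → ℝ) (M f' : ℝ), 0 < n → IsTrigPoly (2 * n) f → HasDerivAt f f' 0 →
      (∀ t : ℝ, |f t| ≤ M * (1 + n * ‖Complex.exp (t * Complex.I) - 1‖) ^ a) →
      |f'| ≤ C * n * M := by
  obtain ⟨C, hC, hb⟩ := Polynomial.exists_norm_derivative_eval_one_le a
  refine ⟨C + 2, by positivity, ?_⟩
  rintro n f M f' hn ⟨p, hp, hpf⟩ hf hM
  have hpM : ∀ t : ℝ, ‖p.eval (Complex.exp (t * Complex.I))‖ = |f t| := by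
    intro t
    rw [hpf, norm_mul, norm_pow, Complex.norm_exp_ofReal_mul_I]
    simp
  have h1 := hb n p M hn (by omega) (fun z hz => by
    have hz' : Complex.exp (z.arg * Complex.I) = z := by
      have := Complex.norm_mul_exp_arg_mul_I z
      rwa [hz, Complex.ofReal_one, one_mul] at this
    have := hM z.arg
    rwa [← hpM, hz'] at this)
  have hf0 : |f 0| ≤ M := by simpa using hM 0
  have hexp : HasDerivAt (fun t : ℝ => Complex.exp (t * Complex.I)) Complex.I 0 := by
    have h2 : HasDerivAt (fun t : ℝ => (t : ℂ) * Complex.I) (1 * Complex.I) 0 :=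
      (Complex.ofRealCLM.hasDerivAt (x := (0 : ℝ))).mul_const Complex.I
    simpa using h2.cexp
  have hL : HasDerivAt (fun t : ℝ => p.eval (Complex.exp (t * Complex.I)))
      (p.derivative.eval 1 * Complex.I) 0 := by
    have h2 : HasDerivAt (fun z => p.eval z) (p.derivative.eval 1)
      (Complex.exp (((0 : ℝ) : ℂ) * Complex.I)) := by
      simpa using p.hasDerivAt 1
    exact h2.comp (0 : ℝ) hexp
  have hR : HasDerivAt (fun t : ℝ => Complex.exp (t * Complex.I) ^ (2 * n) * (f t : ℂ))
      ((2 * n : ℕ) * Complex.I * f 0 + f') 0 := by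
    have := (hexp.fun_pow (2 * n)).fun_mul hf.ofReal_comp
    simpa using this
  have heq : p.derivative.eval 1 * Complex.I = (2 * n : ℕ) * Complex.I * f 0 + f' := by
    rw [funext hpf] at hL
    exact hL.unique hR
  have heq' : (f' : ℂ) = p.derivative.eval 1 * Complex.I - (2 * n : ℕ) * Complex.I * f 0 := by
    rw [heq]; ring
  have : ‖(f' : ℂ)‖ ≤ ‖p.derivative.eval 1‖ + 2 * n * |f 0| := by
    rw [heq']
    refine (norm_sub_le _ _).trans ?_
    simp
  rw [Complex.norm_real, Real.norm_eq_abs] at this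
  have h3 : 2 * (n : ℝ) * |f 0| ≤ 2 * n * M := by gcongr
  linarith

theorem hasDerivAt_pEval (P : MvPolynomial (Fin d) ℝ) {γ : ℝ → EuclideanSpace ℝ (Fin d)}
    {γ' : EuclideanSpace ℝ (Fin d)} {t : ℝ} (hγ : HasDerivAt γ γ' t) :
    HasDerivAt (fun s => pEval P (γ s)) ⟪polyGrad P (γ t), γ'⟫_ℝ t := by
  have hγi : ∀ i, HasDerivAt (fun s => γ s i) (γ' i) t := fun i =>
    ((EuclideanSpace.proj i : EuclideanSpace ℝ (Fin d) →L[ℝ] ℝ).hasFDerivAt.comp_hasDerivAt t hγ)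
  have hin : ∀ P : MvPolynomial (Fin d) ℝ, ⟪polyGrad P (γ t), γ'⟫_ℝ =
      ∑ i, γ' i * MvPolynomial.eval (fun j => γ t j) (MvPolynomial.pderiv i P) := by
    intro P
    simp [PiLp.inner_apply, polyGrad, EuclideanSpace.equiv]
  rw [hin]
  induction P using MvPolynomial.induction_on with
  | C a => simpa [pEval] using hasDerivAt_const t a
  | add p q hp hq =>
    simpa [pEval, mul_add, Finset.sum_add_distrib] using hp.fun_add hq
  | mul_X p i hp =>
    have := hp.fun_mul (hγi i)
    have he : ∀ s, pEval (p * MvPolynomial.X i) (γ s) = pEval p (γ s) * γ s i := by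
      intro s
      simp [pEval]
    simp only [he]
    refine this.congr_deriv ?_
    simp only [Derivation.leibniz, MvPolynomial.pderiv_X, smul_eq_mul, map_add, map_mul,
      MvPolynomial.eval_X]
    simp only [mul_add, Finset.sum_add_distrib, Finset.sum_mul]
    rw [add_comm]
    congr 1
    · rw [Finset.sum_eq_single i]
      · simp [pEval]; ring
      · intro j _ hj
        simp [hj.symm]
      · simp
    · exact Finset.sum_congr rfl fun j _ => by ring

/-! ### Local Bernstein inequalities on the sphere -/

theorem mem_unitSphere {x : EuclideanSpace ℝ (Fin d)} : x ∈ unitSphere d ↔ ‖x‖ = 1 := by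
  simp [unitSphere]

/-- The great circle through `x` with velocity `ξ` at time `0`. -/
def greatCircle (x ξ : EuclideanSpace ℝ (Fin d)) (t : ℝ) : EuclideanSpace ℝ (Fin d) :=
  Real.cos t • x + Real.sin t • ξ

theorem hasDerivAt_greatCircle (x ξ : EuclideanSpace ℝ (Fin d)) (t : ℝ) :
    HasDerivAt (greatCircle x ξ) (Real.cos t • ξ - Real.sin t • x) t := by
  have := ((Real.hasDerivAt_cos t).smul_const x).fun_add ((Real.hasDerivAt_sin t).smul_const ξ)
  refine this.congr_deriv ?_
  rw [neg_smul]
  abel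

theorem norm_sq_smul_add_smul {x ξ : EuclideanSpace ℝ (Fin d)} (hx : ‖x‖ = 1) (hξ : ‖ξ‖ = 1)
    (h : ⟪x, ξ⟫_ℝ = 0) (a b : ℝ) : ‖a • x + b • ξ‖ ^ 2 = a ^ 2 + b ^ 2 := by
  rw [norm_add_sq_real, norm_smul, norm_smul, real_inner_smul_left, real_inner_smul_right, h, hx,
    hξ]
  simp

theorem norm_greatCircle {x ξ : EuclideanSpace ℝ (Fin d)} (hx : ‖x‖ = 1) (hξ : ‖ξ‖ = 1)
    (h : ⟪x, ξ⟫_ℝ = 0) (t : ℝ) : ‖greatCircle x ξ t‖ = 1 := by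
  have := norm_sq_smul_add_smul hx hξ h (Real.cos t) (Real.sin t)
  rw [Real.cos_sq_add_sin_sq] at this
  exact (pow_eq_one_iff_of_nonneg (norm_nonneg _) two_ne_zero).1 this

theorem norm_greatCircle_deriv {x ξ : EuclideanSpace ℝ (Fin d)} (hx : ‖x‖ = 1) (hξ : ‖ξ‖ = 1)
    (h : ⟪x, ξ⟫_ℝ = 0) (t : ℝ) : ‖Real.cos t • ξ - Real.sin t • x‖ = 1 := by
  have := norm_sq_smul_add_smul hx hξ h (-Real.sin t) (Real.cos t)
  rw [neg_sq, Real.sin_sq_add_cos_sq, neg_smul, neg_add_eq_sub] at this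
  exact (pow_eq_one_iff_of_nonneg (norm_nonneg _) two_ne_zero).1 this

theorem inner_greatCircle_deriv {x ξ : EuclideanSpace ℝ (Fin d)} (hx : ‖x‖ = 1) (hξ : ‖ξ‖ = 1)
    (h : ⟪x, ξ⟫_ℝ = 0) (t : ℝ) :
    ⟪greatCircle x ξ t, Real.cos t • ξ - Real.sin t • x⟫_ℝ = 0 := by
  simp only [greatCircle, inner_add_left, inner_sub_right, real_inner_smul_left,
    real_inner_smul_right, real_inner_comm x ξ, h, real_inner_self_eq_norm_sq, hx, hξ]
  ring

theorem norm_greatCircle_sub_sq {x ξ : EuclideanSpace ℝ (Fin d)} (hx : ‖x‖ = 1) (hξ : ‖ξ‖ = 1)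
    (h : ⟪x, ξ⟫_ℝ = 0) (t : ℝ) : ‖greatCircle x ξ t - x‖ ^ 2 = 2 - 2 * Real.cos t := by
  have : greatCircle x ξ t - x = (Real.cos t - 1) • x + Real.sin t • ξ := by
    simp only [greatCircle]
    module
  rw [this, norm_sq_smul_add_smul hx hξ h]
  nlinarith [Real.sin_sq_add_cos_sq t]

theorem norm_greatCircle_sub_le {x ξ : EuclideanSpace ℝ (Fin d)} (hx : ‖x‖ = 1) (hξ : ‖ξ‖ = 1)
    (h : ⟪x, ξ⟫_ℝ = 0) {t : ℝ} (ht : 0 ≤ t) : ‖greatCircle x ξ t - x‖ ≤ t := by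
  refine abs_le_of_sq_le_sq' ?_ ht |>.2
  rw [norm_greatCircle_sub_sq hx hξ h]
  have := Real.one_sub_sq_div_two_le_cos (x := t)
  linarith

theorem norm_exp_sub_one_eq {x ξ : EuclideanSpace ℝ (Fin d)} (hx : ‖x‖ = 1) (hξ : ‖ξ‖ = 1)
    (h : ⟪x, ξ⟫_ℝ = 0) (t : ℝ) :
    ‖Complex.exp (t * Complex.I) - 1‖ = ‖greatCircle x ξ t - x‖ := by
  rw [← sq_eq_sq₀ (norm_nonneg _) (norm_nonneg _), norm_greatCircle_sub_sq hx hξ h,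
    Complex.sq_norm, Complex.normSq_apply]
  simp only [Complex.sub_re, Complex.exp_ofReal_mul_I_re, Complex.one_re, Complex.sub_im,
    Complex.exp_ofReal_mul_I_im, Complex.one_im]
  nlinarith [Real.sin_sq_add_cos_sq t]

theorem exists_greatCircle {y y' : EuclideanSpace ℝ (Fin d)} (hy : ‖y‖ = 1) (hy' : ‖y'‖ = 1)
    (hne : y ≠ y') (hd : ‖y - y'‖ ≤ 1) : ∃ (ξ : EuclideanSpace ℝ (Fin d)) (θ : ℝ),
      ‖ξ‖ = 1 ∧ ⟪y, ξ⟫_ℝ = 0 ∧ 0 ≤ θ ∧ θ ≤ 2 * ‖y - y'‖ ∧ greatCircle y ξ θ = y' := by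
  set c := ⟪y, y'⟫_ℝ with hc
  have h1 : ‖y - y'‖ ^ 2 = 2 - 2 * c := by
    rw [norm_sub_sq_real, hy, hy']
    ring
  have hpos : 0 < ‖y - y'‖ := norm_pos_iff.2 (sub_ne_zero.2 hne)
  have hc1 : c < 1 := by nlinarith
  have hc0 : 0 < c := by nlinarith
  set θ := Real.arccos c with hθ
  have hcos : Real.cos θ = c := Real.cos_arccos (by linarith) hc1.le
  have hθ0 : 0 ≤ θ := Real.arccos_nonneg c
  have hθpi : θ ≤ π := Real.arccos_le_pi c
  have hsin : 0 < Real.sin θ := by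
    rw [hθ, Real.sin_arccos]
    exact Real.sqrt_pos.2 (by nlinarith)
  have hsc := Real.sin_sq_add_cos_sq θ
  refine ⟨(Real.sin θ)⁻¹ • (y' - c • y), θ, ?_, ?_, hθ0, ?_, ?_⟩
  · have h2 : ‖y' - c • y‖ ^ 2 = Real.sin θ ^ 2 := by
      rw [norm_sub_sq_real, norm_smul, real_inner_smul_right, real_inner_comm, ← hc, hy, hy',
        Real.norm_eq_abs]
      rw [hcos] at hsc
      nlinarith [sq_abs c]
    have h3 : ‖y' - c • y‖ = Real.sin θ := by
      rwa [sq_eq_sq₀ (norm_nonneg _) hsin.le] at h2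
    rw [norm_smul, h3, norm_inv, Real.norm_of_nonneg hsin.le]
    field_simp
  · rw [real_inner_smul_right, inner_sub_right, real_inner_smul_right, real_inner_self_eq_norm_sq,
      hy, ← hc]
    ring
  · have h2 : ‖y - y'‖ ^ 2 = (2 * Real.sin (θ / 2)) ^ 2 := by
      rw [h1, ← hcos]
      have h3 := Real.cos_sq' (θ / 2)
      have h4 := Real.cos_two_mul (θ / 2)
      rw [mul_div_cancel₀ _ (two_ne_zero)] at h4
      nlinarith
    have hs0 : 0 ≤ Real.sin (θ / 2) :=
      Real.sin_nonneg_of_nonneg_of_le_pi (by linarith) (by linarith [Real.pi_pos])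
    have h3 : ‖y - y'‖ = 2 * Real.sin (θ / 2) := by
      rwa [sq_eq_sq₀ (norm_nonneg _) (by positivity)] at h2
    have h4 := Real.mul_le_sin (x := θ / 2) (by linarith) (by linarith)
    have h5 : θ / 2 ≤ 2 / π * (θ / 2) * 2 := by
      have : 1 ≤ 2 / π * 2 := by
        rw [div_mul_eq_mul_div, le_div_iff₀ Real.pi_pos]
        linarith [Real.pi_le_four]
      nlinarith
    linarith
  · simp only [greatCircle, smul_smul, hcos]
    rw [mul_inv_cancel₀ hsin.ne', one_smul]
    abel

theorem exists_abs_inner_polyGrad_le (A : ℕ) : ∃ C : ℝ, 0 < C ∧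
    ∀ (d n : ℕ) (Q : MvPolynomial (Fin d) ℝ) (x ξ : EuclideanSpace ℝ (Fin d)) (M : ℝ), 0 < n →
      Q.totalDegree ≤ 2 * n → ‖x‖ = 1 → ‖ξ‖ = 1 → ⟪x, ξ⟫_ℝ = 0 →
      (∀ y ∈ unitSphere d, |pEval Q y| ≤ M * (1 + n * ‖y - x‖) ^ A) →
      |⟪polyGrad Q x, ξ⟫_ℝ| ≤ C * n * M := by
  obtain ⟨C, hC, hb⟩ := IsTrigPoly.exists_abs_deriv_zero_le A
  refine ⟨C, hC, fun d n Q x ξ M hn hQ hx hξ h hM => ?_⟩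
  refine hb n (fun t => pEval Q (greatCircle x ξ t)) M _ hn (isTrigPoly_pEval hQ x ξ) ?_ ?_
  · have := hasDerivAt_pEval Q (hasDerivAt_greatCircle x ξ 0)
    simpa [greatCircle] using this
  · intro t
    rw [norm_exp_sub_one_eq hx hξ h]
    exact hM _ (mem_unitSphere.2 (norm_greatCircle hx hξ h t))

theorem MvPolynomial.totalDegree_pderiv_le {σ : Type*} (i : σ) (P : MvPolynomial σ ℝ) :
    (MvPolynomial.pderiv i P).totalDegree ≤ P.totalDegree - 1 := by
  classical
  conv_lhs => rw [P.as_sum, map_sum]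
  refine MvPolynomial.totalDegree_finsetSum_le fun s hs => ?_
  rw [MvPolynomial.pderiv_monomial]
  have hs' := MvPolynomial.le_totalDegree hs
  rcases Nat.eq_zero_or_pos (s i) with h | h
  · simp [h]
  · refine (MvPolynomial.totalDegree_monomial_le _ _).trans ?_
    have h1 : (s - Finsupp.single i 1) + Finsupp.single i 1 = s :=
      tsub_add_cancel_of_le (by simpa using Nat.succ_le_of_lt h)
    have h2 : (s - Finsupp.single i 1).degree + 1 = s.degree := by
      conv_rhs => rw [← h1]
      simp
    have h3 : s.degree = s.sum fun _ e => e := rfl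
    have h4 : (s - Finsupp.single i 1).degree = (s - Finsupp.single i 1).sum fun _ => id := rfl
    omega

/-- A vector field all of whose scalar components are polynomials of degree at most `2 * n`. -/
def IsPolyField (n : ℕ) (g : EuclideanSpace ℝ (Fin d) → EuclideanSpace ℝ (Fin d)) : Prop :=
  ∀ u, ∃ Q : MvPolynomial (Fin d) ℝ, Q.totalDegree ≤ 2 * n ∧ ∀ x, ⟪u, g x⟫_ℝ = pEval Q x

theorem isPolyField_tGrad {n : ℕ} (hn : 0 < n) {P : MvPolynomial (Fin d) ℝ}
    (hP : P.totalDegree ≤ n) : IsPolyField n (tGrad P) := by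
  intro u
  have hpd : ∀ i, (MvPolynomial.pderiv i P).totalDegree ≤ n - 1 := fun i =>
    (MvPolynomial.totalDegree_pderiv_le i P).trans (by omega)
  have hX : ∀ i : Fin d, (MvPolynomial.X i : MvPolynomial (Fin d) ℝ).totalDegree ≤ 1 :=
    fun i => (MvPolynomial.totalDegree_X i).le
  refine ⟨(∑ i, MvPolynomial.C (u i) * MvPolynomial.pderiv i P)
    - (∑ i, MvPolynomial.X i * MvPolynomial.pderiv i P)
      * (∑ i, MvPolynomial.C (u i) * MvPolynomial.X i), ?_, fun x => ?_⟩
  · refine (MvPolynomial.totalDegree_sub _ _).trans (max_le ?_ ?_)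
    · refine (MvPolynomial.totalDegree_finsetSum_le fun i _ => ?_).trans
        (by omega : n - 1 ≤ 2 * n)
      refine (MvPolynomial.totalDegree_mul _ _).trans ?_
      have := hpd i
      simpa using this
    · refine (MvPolynomial.totalDegree_mul _ _).trans ?_
      have h1 : (∑ i, MvPolynomial.X i * MvPolynomial.pderiv i P).totalDegree ≤ n := by
        refine MvPolynomial.totalDegree_finsetSum_le fun i _ => ?_
        refine (MvPolynomial.totalDegree_mul _ _).trans ?_
        have := hpd i
        have := hX i
        omega
      have h2 : (∑ i, MvPolynomial.C (u i) * MvPolynomial.X i).totalDegree ≤ 1 := by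
        refine MvPolynomial.totalDegree_finsetSum_le fun i _ => ?_
        refine (MvPolynomial.totalDegree_mul _ _).trans ?_
        simp
      omega
  · simp only [tGrad, inner_sub_right, inner_smul_right, pEval, map_sub, map_mul, map_sum,
      MvPolynomial.eval_C, MvPolynomial.eval_X, PiLp.inner_apply, polyGrad, EuclideanSpace.equiv]
    simp [mul_comm]

/-- The field `g` is bounded on the sphere by `M * (1 + n * ‖y - x‖) ^ A`. -/
def GrowthBound (n A : ℕ) (g : EuclideanSpace ℝ (Fin d) → EuclideanSpace ℝ (Fin d))
    (x : EuclideanSpace ℝ (Fin d)) (M : ℝ) : Prop :=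
  ∀ y ∈ unitSphere d, ‖g y‖ ≤ M * (1 + n * ‖y - x‖) ^ A

theorem one_add_mul_norm_sub_le (n : ℕ) (x y z : EuclideanSpace ℝ (Fin d)) :
    1 + n * ‖z - x‖ ≤ (1 + n * ‖y - x‖) * (1 + n * ‖z - y‖) := by
  have h : ‖z - x‖ ≤ ‖z - y‖ + ‖y - x‖ := norm_sub_le_norm_sub_add_norm_sub z y x
  have hn : (0 : ℝ) ≤ n := n.cast_nonneg
  have h1 : 0 ≤ (n * ‖y - x‖) * (n * ‖z - y‖) := by positivity
  nlinarith

theorem GrowthBound.nonneg {n A : ℕ} {g : EuclideanSpace ℝ (Fin d) → EuclideanSpace ℝ (Fin d)}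
    {x : EuclideanSpace ℝ (Fin d)} {M : ℝ} (h : GrowthBound n A g x M) (hx : ‖x‖ = 1) :
    0 ≤ M := by
  have := (norm_nonneg _).trans (h x (mem_unitSphere.2 hx))
  simpa using this

theorem GrowthBound.shift {n A : ℕ} {g : EuclideanSpace ℝ (Fin d) → EuclideanSpace ℝ (Fin d)}
    {x : EuclideanSpace ℝ (Fin d)} {M : ℝ} (h : GrowthBound n A g x M) (hM : 0 ≤ M)
    (y : EuclideanSpace ℝ (Fin d)) : GrowthBound n A g y (M * (1 + n * ‖y - x‖) ^ A) := by
  intro z hz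
  refine (h z hz).trans ?_
  rw [mul_assoc, ← mul_pow]
  gcongr
  exact one_add_mul_norm_sub_le n x y z

/-- Local Lipschitz bound for polynomial fields. -/
theorem exists_norm_sub_le_of_growthBound (A : ℕ) : ∃ C : ℝ, 0 < C ∧
    ∀ (d n : ℕ) (g : EuclideanSpace ℝ (Fin d) → EuclideanSpace ℝ (Fin d))
      (x : EuclideanSpace ℝ (Fin d)) (M : ℝ), 0 < n → IsPolyField n g → ‖x‖ = 1 →
      GrowthBound n A g x M → ∀ y y', ‖y‖ = 1 → ‖y'‖ = 1 → n * ‖y - x‖ ≤ 1 / 2 →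
      n * ‖y' - x‖ ≤ 1 / 2 → ‖g y' - g y‖ ≤ C * n * ‖y - y'‖ * M := by
  obtain ⟨C, hC, hb⟩ := exists_abs_inner_polyGrad_le A
  refine ⟨2 * C * 4 ^ A, by positivity, fun d n g x M hn hg hx hM y y' hy hy' h h' => ?_⟩
  have hM0 := hM.nonneg hx
  have hn1 : (1 : ℝ) ≤ n := by exact_mod_cast hn
  rcases eq_or_ne y y' with rfl | hne
  · simp
  have hyy : n * ‖y - y'‖ ≤ 1 := by
    have := norm_sub_le_norm_sub_add_norm_sub y x y'
    rw [norm_sub_rev x y'] at this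
    nlinarith
  obtain ⟨ξ, θ, hξ, hyξ, hθ0, hθ, rfl⟩ := exists_greatCircle hy hy' hne
    (by nlinarith [norm_nonneg (y - y')])
  set y' := greatCircle y ξ θ with hy'def
  set u := g y' - g y with hu
  obtain ⟨Q, hQdeg, hQ⟩ := hg u
  have hder : ∀ t ∈ Set.Icc 0 θ, HasDerivWithinAt (fun t => pEval Q (greatCircle y ξ t))
      ⟪polyGrad Q (greatCircle y ξ t), Real.cos t • ξ - Real.sin t • y⟫_ℝ (Set.Icc 0 θ) t :=
    fun t _ => (hasDerivAt_pEval Q (hasDerivAt_greatCircle y ξ t)).hasDerivWithinAt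
  have hbd : ∀ t ∈ Set.Ico 0 θ,
      ‖⟪polyGrad Q (greatCircle y ξ t), Real.cos t • ξ - Real.sin t • y⟫_ℝ‖
        ≤ C * n * (‖u‖ * (M * 4 ^ A)) := by
    intro t ht
    have ht1 := norm_greatCircle hy hξ hyξ t
    refine hb d n Q _ _ _ hn hQdeg ht1 (norm_greatCircle_deriv hy hξ hyξ t)
      (inner_greatCircle_deriv hy hξ hyξ t) fun z hz => ?_
    rw [← hQ z]
    refine (abs_real_inner_le_norm _ _).trans ?_
    rw [mul_assoc]
    refine mul_le_mul_of_nonneg_left ?_ (norm_nonneg _)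
    refine (hM.shift hM0 (greatCircle y ξ t) z hz).trans ?_
    gcongr
    have h3 := norm_greatCircle_sub_le hy hξ hyξ ht.1
    have h4 := norm_sub_le_norm_sub_add_norm_sub (greatCircle y ξ t) y x
    have : t ≤ 2 * ‖y - y'‖ := ht.2.le.trans hθ
    nlinarith
  have hmv := norm_image_sub_le_of_norm_deriv_le_segment' hder hbd θ ⟨hθ0, le_rfl⟩
  have h0 : greatCircle y ξ 0 = y := by simp [greatCircle]
  rw [← hQ, ← hQ, h0, ← inner_sub_right, ← hy'def, ← hu, real_inner_self_eq_norm_sq,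
    Real.norm_of_nonneg (by positivity), sub_zero] at hmv
  rcases (norm_nonneg u).eq_or_lt with h5 | h5
  · rw [← h5]
    positivity
  · have h6 : C * n * (‖u‖ * (M * 4 ^ A)) * θ ≤ ‖u‖ * (2 * C * 4 ^ A * n * ‖y - y'‖ * M) := by
      calc C * n * (‖u‖ * (M * 4 ^ A)) * θ ≤ C * n * (‖u‖ * (M * 4 ^ A)) * (2 * ‖y - y'‖) := by
            gcongr
        _ = _ := by ring
    have h7 := hmv.trans h6
    rw [sq] at h7
    exact le_of_mul_le_mul_left h7 h5

theorem inner_tGrad_eq {P : MvPolynomial (Fin d) ℝ} {x ξ : EuclideanSpace ℝ (Fin d)}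
    (h : ⟪x, ξ⟫_ℝ = 0) : ⟪tGrad P x, ξ⟫_ℝ = ⟪polyGrad P x, ξ⟫_ℝ := by
  rw [tGrad, inner_sub_left, real_inner_smul_left, h]
  simp

/-- First order Taylor expansion of a polynomial on the sphere with a localized remainder. -/
theorem exists_abs_taylor_le (A : ℕ) : ∃ C : ℝ, 0 < C ∧
    ∀ (d n : ℕ) (P : MvPolynomial (Fin d) ℝ)
      (x : EuclideanSpace ℝ (Fin d)) (M : ℝ), 0 < n → P.totalDegree ≤ n → ‖x‖ = 1 →
      GrowthBound n A (tGrad P) x M → ∀ y y', ‖y‖ = 1 → ‖y'‖ = 1 → n * ‖y - x‖ ≤ 1 / 10 →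
      n * ‖y' - x‖ ≤ 1 / 10 →
      |pEval P y' - pEval P y - ⟪tGrad P y, y' - y⟫_ℝ| ≤ C * n * ‖y - y'‖ ^ 2 * M := by
  obtain ⟨C, hC, hb⟩ := exists_norm_sub_le_of_growthBound A
  refine ⟨4 * C, by positivity, fun d n P x M hn hP hx hM y y' hy hy' h h' => ?_⟩
  have hM0 := hM.nonneg hx
  have hn1 : (1 : ℝ) ≤ n := by exact_mod_cast hn
  rcases eq_or_ne y y' with rfl | hne
  · simp
  have hyy : n * ‖y - y'‖ ≤ 1 / 5 := by
    have := norm_sub_le_norm_sub_add_norm_sub y x y'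
    rw [norm_sub_rev x y'] at this
    nlinarith
  obtain ⟨ξ, θ, hξ, hyξ, hθ0, hθ, rfl⟩ := exists_greatCircle hy hy' hne
    (by nlinarith [norm_nonneg (y - y')])
  set y' := greatCircle y ξ θ with hy'def
  have hder : ∀ t ∈ Set.Icc 0 θ, HasDerivWithinAt
      (fun t => pEval P (greatCircle y ξ t) - ⟪tGrad P y, greatCircle y ξ t⟫_ℝ)
      ⟪tGrad P (greatCircle y ξ t) - tGrad P y, Real.cos t • ξ - Real.sin t • y⟫_ℝ
      (Set.Icc 0 θ) t := by
    intro t _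
    have h1 := hasDerivAt_greatCircle y ξ t
    have h2 := (hasDerivAt_const t (tGrad P y)).inner ℝ h1
    refine ((hasDerivAt_pEval P h1).fun_sub h2).hasDerivWithinAt.congr_deriv ?_
    rw [inner_sub_left, inner_tGrad_eq (inner_greatCircle_deriv hy hξ hyξ t)]
    simp
  have hbd : ∀ t ∈ Set.Ico 0 θ,
      ‖⟪tGrad P (greatCircle y ξ t) - tGrad P y, Real.cos t • ξ - Real.sin t • y⟫_ℝ‖
        ≤ C * n * θ * M := by
    intro t ht
    refine (norm_inner_le_norm _ _).trans ?_
    rw [norm_greatCircle_deriv hy hξ hyξ, mul_one]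
    have h3 := norm_greatCircle_sub_le hy hξ hyξ ht.1
    have h4 := norm_sub_le_norm_sub_add_norm_sub (greatCircle y ξ t) y x
    have h5 : t ≤ 2 * ‖y - y'‖ := ht.2.le.trans hθ
    refine (hb d n (tGrad P) x M hn (isPolyField_tGrad hn hP) hx hM y _ hy
      (norm_greatCircle hy hξ hyξ t) (by linarith) (by nlinarith)).trans ?_
    rw [norm_sub_rev] at h3
    have := ht.2.le
    gcongr
    linarith
  have hmv := norm_image_sub_le_of_norm_deriv_le_segment' hder hbd θ ⟨hθ0, le_rfl⟩
  have h0 : greatCircle y ξ 0 = y := by simp [greatCircle]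
  rw [h0, ← hy'def, sub_zero, Real.norm_eq_abs] at hmv
  calc |pEval P y' - pEval P y - ⟪tGrad P y, y' - y⟫_ℝ|
      = |pEval P y' - ⟪tGrad P y, y'⟫_ℝ - (pEval P y - ⟪tGrad P y, y⟫_ℝ)| := by
        rw [inner_sub_right]
        congr 1
        ring
    _ ≤ C * n * θ * M * θ := hmv
    _ ≤ C * n * (2 * ‖y - y'‖) * M * (2 * ‖y - y'‖) := by gcongr
    _ = _ := by ring

theorem exists_abs_pEval_sub_le (A : ℕ) : ∃ C : ℝ, 0 < C ∧
    ∀ (d n : ℕ) (P : MvPolynomial (Fin d) ℝ)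
      (x : EuclideanSpace ℝ (Fin d)) (M : ℝ), 0 < n → P.totalDegree ≤ n → ‖x‖ = 1 →
      GrowthBound n A (tGrad P) x M → ∀ y y', ‖y‖ = 1 → ‖y'‖ = 1 → n * ‖y - x‖ ≤ 1 / 10 →
      n * ‖y' - x‖ ≤ 1 / 10 → |pEval P y' - pEval P y| ≤ C * ‖y - y'‖ * M := by
  obtain ⟨C, hC, hb⟩ := exists_abs_taylor_le A
  refine ⟨C + 2 ^ A, by positivity, fun d n P x M hn hP hx hM y y' hy hy' h h' => ?_⟩
  have hM0 := hM.nonneg hx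
  have h1 := hb d n P x M hn hP hx hM y y' hy hy' h h'
  have hyy : n * ‖y - y'‖ ≤ 1 := by
    have := norm_sub_le_norm_sub_add_norm_sub y x y'
    rw [norm_sub_rev x y'] at this
    have hn1 : (1 : ℝ) ≤ n := by exact_mod_cast hn
    nlinarith
  have h2 : |⟪tGrad P y, y' - y⟫_ℝ| ≤ M * 2 ^ A * ‖y - y'‖ := by
    refine (abs_real_inner_le_norm _ _).trans ?_
    rw [norm_sub_rev y' y]
    gcongr
    refine (hM y (mem_unitSphere.2 hy)).trans ?_
    gcongr
    linarith
  have h3 : C * n * ‖y - y'‖ ^ 2 * M ≤ C * ‖y - y'‖ * M := by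
    calc C * n * ‖y - y'‖ ^ 2 * M = C * ‖y - y'‖ * M * (n * ‖y - y'‖) := by ring
      _ ≤ C * ‖y - y'‖ * M * 1 := by gcongr
      _ = _ := mul_one _
  calc |pEval P y' - pEval P y|
      = |(pEval P y' - pEval P y - ⟪tGrad P y, y' - y⟫_ℝ) + ⟪tGrad P y, y' - y⟫_ℝ| := by
        congr 1
        ring
    _ ≤ C * ‖y - y'‖ * M + M * 2 ^ A * ‖y - y'‖ :=
        (abs_add_le _ _).trans (add_le_add (h1.trans h3) h2)
    _ = _ := by ring

/-! ### A Marcinkiewicz-Zygmund inequality for polynomial fields -/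

/-- The smallest `M` with `GrowthBound n A g x M`. -/
def locMax (n A : ℕ) (g : EuclideanSpace ℝ (Fin d) → EuclideanSpace ℝ (Fin d))
    (x : EuclideanSpace ℝ (Fin d)) : ℝ :=
  sSup ((fun y => ‖g y‖ / (1 + n * ‖y - x‖) ^ A) '' unitSphere d)

theorem exists_locMax_eq {n A : ℕ} {g : EuclideanSpace ℝ (Fin d) → EuclideanSpace ℝ (Fin d)}
    (hg : Continuous g) {x : EuclideanSpace ℝ (Fin d)} (hx : ‖x‖ = 1) :
    ∃ y, ‖y‖ = 1 ∧ locMax n A g x = ‖g y‖ / (1 + n * ‖y - x‖) ^ A ∧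
      GrowthBound n A g x (locMax n A g x) := by
  have hcont : ContinuousOn (fun y => ‖g y‖ / (1 + n * ‖y - x‖) ^ A) (unitSphere d) := by
    refine (Continuous.div (by fun_prop) (by fun_prop) fun y => ?_).continuousOn
    positivity
  obtain ⟨y, hy, hs, hmax⟩ := (isCompact_sphere (0 : EuclideanSpace ℝ (Fin d)) 1).exists_sSup_image_eq_and_ge
    ⟨x, mem_unitSphere.2 hx⟩ hcont
  refine ⟨y, mem_unitSphere.1 hy, hs, fun z hz => ?_⟩
  have h1 := hmax z hz
  rw [locMax, unitSphere, hs]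
  rwa [div_le_iff₀ (by positivity)] at h1

theorem GrowthBound.locMax_le {n A : ℕ} {g : EuclideanSpace ℝ (Fin d) → EuclideanSpace ℝ (Fin d)}
    {x : EuclideanSpace ℝ (Fin d)} {M : ℝ} (h : GrowthBound n A g x M) (hx : ‖x‖ = 1) :
    locMax n A g x ≤ M := by
  refine csSup_le (Set.Nonempty.image _ ⟨x, mem_unitSphere.2 hx⟩) ?_
  rintro _ ⟨y, hy, rfl⟩
  rw [div_le_iff₀ (by positivity)]
  exact h y hy

theorem growthBound_locMax {n A : ℕ} {g : EuclideanSpace ℝ (Fin d) → EuclideanSpace ℝ (Fin d)}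
    (hg : Continuous g) {x : EuclideanSpace ℝ (Fin d)} (hx : ‖x‖ = 1) :
    GrowthBound n A g x (locMax n A g x) :=
  (exists_locMax_eq hg hx).choose_spec.2.2

theorem locMax_nonneg {n A : ℕ} {g : EuclideanSpace ℝ (Fin d) → EuclideanSpace ℝ (Fin d)}
    (x : EuclideanSpace ℝ (Fin d)) : 0 ≤ locMax n A g x := by
  refine Real.sSup_nonneg ?_
  rintro _ ⟨y, _, rfl⟩
  positivity

theorem norm_le_locMax {n A : ℕ} {g : EuclideanSpace ℝ (Fin d) → EuclideanSpace ℝ (Fin d)}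
    (hg : Continuous g) {x : EuclideanSpace ℝ (Fin d)} (hx : ‖x‖ = 1) :
    ‖g x‖ ≤ locMax n A g x := by
  have := growthBound_locMax (n := n) (A := A) hg hx x (mem_unitSphere.2 hx)
  simpa using this

theorem locMax_le_mul {n A : ℕ} {g : EuclideanSpace ℝ (Fin d) → EuclideanSpace ℝ (Fin d)}
    (hg : Continuous g) {x y : EuclideanSpace ℝ (Fin d)} (hx : ‖x‖ = 1) (hy : ‖y‖ = 1) :
    locMax n A g y ≤ locMax n A g x * (1 + n * ‖y - x‖) ^ A :=
  ((growthBound_locMax hg hx).shift (locMax_nonneg x) y).locMax_le hy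

theorem continuous_tGrad (P : MvPolynomial (Fin d) ℝ) : Continuous (tGrad P) := by
  have h : Continuous (polyGrad P) := by
    refine (EuclideanSpace.equiv (Fin d) ℝ).symm.continuous.comp (continuous_pi fun i => ?_)
    exact (MvPolynomial.continuous_eval _).comp (EuclideanSpace.equiv (Fin d) ℝ).continuous
  unfold tGrad
  fun_prop

/-- The number of points of a finite family in a closed ball. -/
def ballCount {ι : Type*} [Fintype ι] (X : ι → EuclideanSpace ℝ (Fin d))
    (y : EuclideanSpace ℝ (Fin d)) (ρ : ℝ) : ℕ :=
  (Finset.univ.filter fun i => ‖X i - y‖ ≤ ρ).card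

theorem ballCount_le_ballCount {ι : Type*} [Fintype ι] (X : ι → EuclideanSpace ℝ (Fin d))
    {y z : EuclideanSpace ℝ (Fin d)} {ρ ρ' : ℝ} (h : ‖y - z‖ + ρ ≤ ρ') :
    ballCount X y ρ ≤ ballCount X z ρ' := by
  refine Finset.card_le_card fun i hi => ?_
  simp only [Finset.mem_filter, Finset.mem_univ, true_and] at hi ⊢
  linarith [norm_sub_le_norm_sub_add_norm_sub (X i) y z]

/-- Doubling property, at scales larger than `1 / n`, of the counting measure of a family. -/
def CountDoubling {ι : Type*} [Fintype ι] (X : ι → EuclideanSpace ℝ (Fin d)) (n s : ℕ)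
    (c D : ℝ) : Prop :=
  ∀ y, ‖y‖ = 1 → ∀ R : ℝ, 0 ≤ R →
    (ballCount X y (R + 1 / n) : ℝ) ≤ D * (1 + n * R) ^ s * ballCount X y (c / n)

theorem sum_range_one_div_sq_le (k : ℕ) :
    ∑ l ∈ Finset.range k, 1 / (1 + (l : ℝ)) ^ 2 ≤ 2 - 1 / (k : ℝ) := by
  induction k with
  | zero => simp
  | succ k ih =>
    rw [Finset.sum_range_succ]
    rcases Nat.eq_zero_or_pos k with rfl | hk
    · norm_num
    · have hk' : (0 : ℝ) < k := by exact_mod_cast hk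
      have : 1 / (1 + (k : ℝ)) ^ 2 ≤ 1 / k - 1 / ((k + 1 : ℕ) : ℝ) := by
        push_cast
        rw [div_sub_div _ _ hk'.ne' (by positivity), div_le_div_iff₀ (by positivity)
          (by positivity)]
        nlinarith
      linarith

theorem sum_one_div_pow_le {ι : Type*} [Fintype ι] {X : ι → EuclideanSpace ℝ (Fin d)} {n s : ℕ}
    {c D : ℝ} (hn : 0 < n) (hc : c ≤ 1) (hD : 0 < D) (hX : ∀ i, ‖X i‖ = 1)
    (h : CountDoubling X n s c D) (j : ι) :
    ∑ i, 1 / (1 + n * ‖X i - X j‖) ^ (s + 2) ≤ 2 * D * ballCount X (X j) (1 / n) := by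
  classical
  have hn0 : (0 : ℝ) < n := by exact_mod_cast hn
  set b := (ballCount X (X j) (1 / n) : ℝ) with hb
  have hmaps : ∀ i ∈ (Finset.univ : Finset ι), ⌊n * ‖X i - X j‖⌋₊ ∈ Finset.range (2 * n + 1) := by
    intro i _
    rw [Finset.mem_range, Nat.floor_lt (by positivity)]
    have : ‖X i - X j‖ ≤ 2 := (norm_sub_le _ _).trans (by rw [hX, hX]; norm_num)
    push_cast
    nlinarith
  rw [← Finset.sum_fiberwise_of_maps_to hmaps]
  have hfib : ∀ l ∈ Finset.range (2 * n + 1),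
      ∑ i with ⌊n * ‖X i - X j‖⌋₊ = l, 1 / (1 + n * ‖X i - X j‖) ^ (s + 2)
        ≤ D * b * (1 / (1 + (l : ℝ)) ^ 2) := by
    intro l _
    have h1 : ∀ i ∈ Finset.univ.filter (fun i => ⌊n * ‖X i - X j‖⌋₊ = l),
        1 / (1 + n * ‖X i - X j‖) ^ (s + 2) ≤ 1 / (1 + (l : ℝ)) ^ (s + 2) := by
      intro i hi
      simp only [Finset.mem_filter, Finset.mem_univ, true_and] at hi
      have := Nat.floor_le (show 0 ≤ n * ‖X i - X j‖ by positivity)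
      rw [hi] at this
      gcongr
    have h2 : ((Finset.univ.filter (fun i => ⌊n * ‖X i - X j‖⌋₊ = l)).card : ℝ)
        ≤ D * (1 + (l : ℝ)) ^ s * b := by
      have h3 : (Finset.univ.filter (fun i => ⌊n * ‖X i - X j‖⌋₊ = l)).card
          ≤ ballCount X (X j) (l / n + 1 / n) := by
        refine Finset.card_le_card fun i hi => ?_
        simp only [Finset.mem_filter, Finset.mem_univ, true_and] at hi ⊢
        rw [← add_div, le_div_iff₀ hn0, mul_comm]
        have := Nat.lt_floor_add_one (n * ‖X i - X j‖)
        rw [hi] at this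
        exact this.le
      have h4 := h (X j) (hX j) (l / n) (by positivity)
      rw [mul_div_cancel₀ _ hn0.ne'] at h4
      have h5 : (ballCount X (X j) (c / n) : ℝ) ≤ b := by
        rw [hb]
        exact_mod_cast ballCount_le_ballCount X (by rw [sub_self, norm_zero, zero_add]; gcongr)
      calc ((Finset.univ.filter (fun i => ⌊n * ‖X i - X j‖⌋₊ = l)).card : ℝ)
          ≤ ballCount X (X j) (l / n + 1 / n) := by exact_mod_cast h3
        _ ≤ D * (1 + (l : ℝ)) ^ s * ballCount X (X j) (c / n) := h4
        _ ≤ _ := by gcongr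
    calc _ ≤ ∑ i with ⌊n * ‖X i - X j‖⌋₊ = l, 1 / (1 + (l : ℝ)) ^ (s + 2) :=
          Finset.sum_le_sum h1
      _ = ((Finset.univ.filter (fun i => ⌊n * ‖X i - X j‖⌋₊ = l)).card : ℝ)
          * (1 / (1 + (l : ℝ)) ^ (s + 2)) := by rw [Finset.sum_const, nsmul_eq_mul]
      _ ≤ D * (1 + (l : ℝ)) ^ s * b * (1 / (1 + (l : ℝ)) ^ (s + 2)) := by gcongr
      _ = _ := by
        rw [pow_add]
        field_simp
  refine (Finset.sum_le_sum hfib).trans ?_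
  rw [← Finset.mul_sum]
  have h6 : ∑ l ∈ Finset.range (2 * n + 1), 1 / (1 + (l : ℝ)) ^ 2 ≤ 2 :=
    (sum_range_one_div_sq_le _).trans (sub_le_self _ (by positivity))
  calc D * b * _ ≤ D * b * 2 := by gcongr
    _ = _ := by ring

/-- The Marcinkiewicz-Zygmund inequality: for families whose counting measure is doubling, the
local maxima of a polynomial field are controlled by its values on the family. -/
theorem exists_sum_locMax_le (s : ℕ) : ∃ c : ℝ, 0 < c ∧ c ≤ 1 / 2 ∧ ∀ D : ℝ, 0 < D →
    ∃ C : ℝ, 0 < C ∧ ∀ (d n N : ℕ) (X : Fin N → EuclideanSpace ℝ (Fin d))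
      (g : EuclideanSpace ℝ (Fin d) → EuclideanSpace ℝ (Fin d)), 0 < n → IsPolyField n g →
      Continuous g → (∀ i, ‖X i‖ = 1) → CountDoubling X n s c D →
      ∑ i, locMax n (3 * s + 2) g (X i) ≤ C * ∑ i, ‖g (X i)‖ := by
  obtain ⟨K, hK, hb⟩ := exists_norm_sub_le_of_growthBound (3 * s + 2)
  refine ⟨min (1 / 2) (1 / (2 * K)), by positivity, min_le_left _ _, fun D hD =>
    ⟨2 * D * 2 ^ (2 * s + 2) * (2 * D * D), by positivity,
      fun d n N X g hn hg hgc hX hdbl => ?_⟩⟩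
  set c := min (1 / 2) (1 / (2 * K)) with hc
  have hc0 : 0 < c := by positivity
  have hc1 : c ≤ 1 / 2 := min_le_left _ _
  have hcK : K * c ≤ 1 / 2 := by
    calc K * c ≤ K * (1 / (2 * K)) := by gcongr; exact min_le_right _ _
      _ = 1 / 2 := by field_simp
  have hn0 : (0 : ℝ) < n := by exact_mod_cast hn
  have hbpos : ∀ i, (0 : ℝ) < ballCount X (X i) (1 / n) := by
    intro i
    have : 0 < ballCount X (X i) (1 / n) := Finset.card_pos.2 ⟨i, by simp⟩
    exact_mod_cast this
  have key : ∀ i, locMax n (3 * s + 2) g (X i) ≤ ∑ j, 2 * D * 2 ^ (2 * s + 2) * D * ‖g (X j)‖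
      / ballCount X (X j) (1 / n) * (1 / (1 + n * ‖X i - X j‖) ^ (s + 2)) := by
    intro i
    obtain ⟨y, hy, hMy, hgb⟩ := exists_locMax_eq (n := n) (A := 3 * s + 2) hgc (hX i)
    set M := locMax n (3 * s + 2) g (X i) with hM
    set ρ := ‖y - X i‖ with hρ
    have hM0 : 0 ≤ M := locMax_nonneg _
    have hρ0 : 0 ≤ ρ := norm_nonneg _
    have hρ1 : 0 < 1 + n * ρ := by positivity
    have hgy : M * (1 + n * ρ) ^ (3 * s + 2) = ‖g y‖ := by
      rw [hMy]
      field_simp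
    have hgby := hgb.shift hM0 y
    rw [← hρ, hgy] at hgby
    have hhalf : ∀ j, ‖X j - y‖ ≤ c / n → ‖g y‖ ≤ 2 * ‖g (X j)‖ := by
      intro j hj
      have hnj : n * ‖X j - y‖ ≤ c := by
        rwa [le_div_iff₀ hn0, mul_comm] at hj
      have h1 := hb d n g y ‖g y‖ hn hg hy hgby y (X j) hy (hX j) (by simp) (hnj.trans hc1)
      rw [norm_sub_rev y] at h1
      have h2 : K * n * ‖X j - y‖ * ‖g y‖ ≤ 1 / 2 * ‖g y‖ := by
        refine mul_le_mul_of_nonneg_right ?_ (norm_nonneg _)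
        calc K * n * ‖X j - y‖ = K * (n * ‖X j - y‖) := by ring
          _ ≤ K * c := by gcongr
          _ ≤ 1 / 2 := hcK
      have h3 := norm_sub_norm_le (g y) (g (X j))
      rw [norm_sub_rev] at h3
      linarith
    have hterm : ∀ j, ‖X j - y‖ ≤ c / n → M * (D * (1 + n * ρ) ^ s) * (1 / ballCount X (X i) (1 / n))
        ≤ 2 * D * 2 ^ (2 * s + 2) * D * ‖g (X j)‖
          / ballCount X (X j) (1 / n) * (1 / (1 + n * ‖X i - X j‖) ^ (s + 2)) := by
      intro j hj
      set dij := ‖X i - X j‖ with hdij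
      have hnj : n * ‖X j - y‖ ≤ c := by
        rwa [le_div_iff₀ hn0, mul_comm] at hj
      have hdij1 : 0 < 1 + n * dij := by positivity
      have h1 : 1 + n * dij ≤ 2 * (1 + n * ρ) := by
        have h2 := norm_sub_le_norm_sub_add_norm_sub (X i) y (X j)
        rw [norm_sub_rev (X i) y, norm_sub_rev y (X j)] at h2
        nlinarith
      have h3 : (ballCount X (X j) (1 / n) : ℝ)
          ≤ D * (1 + n * dij) ^ s * ballCount X (X i) (1 / n) := by
        calc (ballCount X (X j) (1 / n) : ℝ) ≤ ballCount X (X i) (dij + 1 / n) := by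
              exact_mod_cast ballCount_le_ballCount X (by rw [norm_sub_rev])
          _ ≤ D * (1 + n * dij) ^ s * ballCount X (X i) (c / n) :=
              hdbl (X i) (hX i) dij (norm_nonneg _)
          _ ≤ _ := by
            gcongr
            exact ballCount_le_ballCount X (by rw [sub_self, norm_zero, zero_add]; gcongr; linarith)
      have h4 : 1 / (ballCount X (X i) (1 / n) : ℝ)
          ≤ D * (1 + n * dij) ^ s / ballCount X (X j) (1 / n) := by
        rw [div_le_div_iff₀ (hbpos i) (hbpos j), one_mul]
        exact h3
      have h5 : M * (1 + n * ρ) ^ s * (1 + n * dij) ^ (2 * s + 2)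
          ≤ 2 ^ (2 * s + 2) * (2 * ‖g (X j)‖) := by
        calc M * (1 + n * ρ) ^ s * (1 + n * dij) ^ (2 * s + 2)
            ≤ M * (1 + n * ρ) ^ s * (2 * (1 + n * ρ)) ^ (2 * s + 2) := by gcongr
          _ = 2 ^ (2 * s + 2) * (M * (1 + n * ρ) ^ (3 * s + 2)) := by
            rw [mul_pow, show 3 * s + 2 = s + (2 * s + 2) by ring, pow_add _ s (2 * s + 2)]
            ring
          _ ≤ _ := by
            rw [hgy]
            gcongr
            exact hhalf j hj
      have hbj := hbpos j
      have h6 : (1 + n * dij) ^ (2 * s + 2) = (1 + n * dij) ^ s * (1 + n * dij) ^ (s + 2) := by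
        rw [← pow_add]
        congr 1
        ring
      calc M * (D * (1 + n * ρ) ^ s) * (1 / ballCount X (X i) (1 / n))
          ≤ M * (D * (1 + n * ρ) ^ s) * (D * (1 + n * dij) ^ s / ballCount X (X j) (1 / n)) := by
            gcongr
        _ = (M * (1 + n * ρ) ^ s * (1 + n * dij) ^ (2 * s + 2))
            * (D * D / ballCount X (X j) (1 / n) * (1 / (1 + n * dij) ^ (s + 2))) := by
            rw [h6]
            field_simp
        _ ≤ (2 ^ (2 * s + 2) * (2 * ‖g (X j)‖))
            * (D * D / ballCount X (X j) (1 / n) * (1 / (1 + n * dij) ^ (s + 2))) := by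
            gcongr
        _ = _ := by ring
    have hcount : (ballCount X (X i) (1 / n) : ℝ)
        ≤ D * (1 + n * ρ) ^ s * ballCount X y (c / n) := by
      refine le_trans ?_ (hdbl y hy ρ (norm_nonneg _))
      exact_mod_cast ballCount_le_ballCount X (by rw [norm_sub_rev])
    have hbi := hbpos i
    calc M = M * ballCount X (X i) (1 / n) * (1 / ballCount X (X i) (1 / n)) := by field_simp
      _ ≤ M * (D * (1 + n * ρ) ^ s * ballCount X y (c / n))
          * (1 / ballCount X (X i) (1 / n)) := by gcongr
      _ = ∑ j with ‖X j - y‖ ≤ c / n,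
          M * (D * (1 + n * ρ) ^ s) * (1 / ballCount X (X i) (1 / n)) := by
        rw [Finset.sum_const, nsmul_eq_mul, ballCount]
        ring
      _ ≤ ∑ j with ‖X j - y‖ ≤ c / n, 2 * D * 2 ^ (2 * s + 2) * D * ‖g (X j)‖
          / ballCount X (X j) (1 / n) * (1 / (1 + n * ‖X i - X j‖) ^ (s + 2)) :=
        Finset.sum_le_sum fun j hj => hterm j (by simpa using hj)
      _ ≤ _ := Finset.sum_le_sum_of_subset_of_nonneg (Finset.filter_subset _ _)
        fun j _ _ => by positivity
  refine (Finset.sum_le_sum fun i _ => key i).trans ?_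
  rw [Finset.sum_comm, Finset.mul_sum]
  refine Finset.sum_le_sum fun j _ => ?_
  rw [← Finset.mul_sum]
  have hbj := hbpos j
  calc _ ≤ 2 * D * 2 ^ (2 * s + 2) * D * ‖g (X j)‖ / ballCount X (X j) (1 / n)
        * (2 * D * ballCount X (X j) (1 / n)) := by
        gcongr
        exact sum_one_div_pow_le hn (by linarith) hD hX hdbl j
    _ = _ := by
      field_simp

/-! ### Solving the linearized equation by convex duality -/

/-- If for every `w` some `v` in a compact convex set satisfies `e w ≤ B w v`, then a single `v`
represents `e`. -/
theorem exists_mem_forall_eq_of_forall_exists_le {V W : Type*} [NormedAddCommGroup V]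
    [NormedSpace ℝ V] [FiniteDimensional ℝ V] [AddCommGroup W] [Module ℝ W]
    [FiniteDimensional ℝ W] {S : Set V} (hS : IsCompact S) (hconv : Convex ℝ S)
    (B : W →ₗ[ℝ] V →ₗ[ℝ] ℝ) (e : W →ₗ[ℝ] ℝ) (h : ∀ w, ∃ v ∈ S, e w ≤ B w v) :
    ∃ v ∈ S, ∀ w, e w = B w v := by
  classical
  let b := Module.finBasis ℝ W
  let T : V →ₗ[ℝ] (Fin (Module.finrank ℝ W) → ℝ) := LinearMap.pi fun j => B (b j)
  have hT : Continuous T := T.continuous_of_finiteDimensional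
  by_cases hmem : (fun j => e (b j)) ∈ T '' S
  · obtain ⟨v, hv, hvT⟩ := hmem
    refine ⟨v, hv, fun w => ?_⟩
    have : e = B.flip v := b.ext fun j => (congrFun hvT j).symm
    rw [this, LinearMap.flip_apply]
  · obtain ⟨f, u, hf1, hf2⟩ := geometric_hahn_banach_closed_point (hconv.linear_image T)
      (hS.image hT).isClosed hmem
    obtain ⟨v, hv, hle⟩ := h (∑ j, f (Pi.single j 1) • b j)
    have hfe : ∀ x : Fin (Module.finrank ℝ W) → ℝ, f x = ∑ j, f (Pi.single j 1) * x j := by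
      intro x
      conv_lhs => rw [pi_eq_sum_univ' x, map_sum]
      refine Finset.sum_congr rfl fun j _ => ?_
      rw [map_smul, smul_eq_mul, mul_comm]
    have h1 := hf1 _ ⟨v, hv, rfl⟩
    rw [hfe] at h1 hf2
    simp only [map_sum, map_smul, LinearMap.sum_apply, LinearMap.smul_apply, smul_eq_mul] at hle
    have h2 : ∑ j, f (Pi.single j 1) * T v j = ∑ j, f (Pi.single j 1) * B (b j) v := rfl
    linarith

theorem tGrad_add (P Q : MvPolynomial (Fin d) ℝ) (x : EuclideanSpace ℝ (Fin d)) :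
    tGrad (P + Q) x = tGrad P x + tGrad Q x := by
  have h : polyGrad (P + Q) x = polyGrad P x + polyGrad Q x := by
    ext i
    simp [polyGrad, EuclideanSpace.equiv]
  simp only [tGrad, h, inner_add_right]
  module

theorem tGrad_smul (c : ℝ) (P : MvPolynomial (Fin d) ℝ) (x : EuclideanSpace ℝ (Fin d)) :
    tGrad (c • P) x = c • tGrad P x := by
  have h : polyGrad (c • P) x = c • polyGrad P x := by
    ext i
    simp [polyGrad, EuclideanSpace.equiv, MvPolynomial.smul_eval]
  simp only [tGrad, h, real_inner_smul_right]
  module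

theorem inner_tGrad_self (P : MvPolynomial (Fin d) ℝ) {x : EuclideanSpace ℝ (Fin d)}
    (hx : ‖x‖ = 1) : ⟪tGrad P x, x⟫_ℝ = 0 := by
  rw [tGrad, inner_sub_left, real_inner_smul_left, real_inner_self_eq_norm_sq, hx,
    real_inner_comm]
  ring

/-- Tangent displacement fields along a family which are bounded by `τ` and Lipschitz with
constant `τ * l`. -/
def displacements {N : ℕ} (X : Fin N → EuclideanSpace ℝ (Fin d)) (l τ : ℝ) :
    Set (Fin N → EuclideanSpace ℝ (Fin d)) :=
  {V | (∀ i, ‖V i‖ ≤ τ) ∧ (∀ i j, ‖V i - V j‖ ≤ τ * (l * ‖X i - X j‖)) ∧ ∀ i, ⟪V i, X i⟫_ℝ = 0}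

theorem isCompact_displacements {N : ℕ} (X : Fin N → EuclideanSpace ℝ (Fin d)) (l τ : ℝ) :
    IsCompact (displacements X l τ) := by
  refine Metric.isCompact_of_isClosed_isBounded ?_ ?_
  · simp only [displacements, Set.ofPred_and, Set.ofPred_forall]
    refine IsClosed.inter (isClosed_iInter fun i => isClosed_le (by fun_prop) (by fun_prop))
      (IsClosed.inter (isClosed_iInter fun i => isClosed_iInter fun j =>
        isClosed_le (by fun_prop) (by fun_prop)) (isClosed_iInter fun i =>
          isClosed_eq (by fun_prop) (by fun_prop)))
  · refine (Metric.isBounded_closedBall (x := (0 : Fin N → EuclideanSpace ℝ (Fin d)))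
      (r := max τ 0)).subset fun V hV => ?_
    rw [mem_closedBall_zero_iff, pi_norm_le_iff_of_nonneg (le_max_right _ _)]
    exact fun i => (hV.1 i).trans (le_max_left _ _)

theorem convex_displacements {N : ℕ} (X : Fin N → EuclideanSpace ℝ (Fin d)) (l τ : ℝ) :
    Convex ℝ (displacements X l τ) := by
  intro V hV W hW a b ha hb hab
  have hcomb : ∀ (x y : EuclideanSpace ℝ (Fin d)) (r : ℝ), ‖x‖ ≤ r → ‖y‖ ≤ r →
      ‖a • x + b • y‖ ≤ r := by
    intro x y r hx hy
    have := (convex_closedBall (0 : EuclideanSpace ℝ (Fin d)) r)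
      (mem_closedBall_zero_iff.2 hx) (mem_closedBall_zero_iff.2 hy) ha hb hab
    exact mem_closedBall_zero_iff.1 this
  refine ⟨fun i => hcomb _ _ _ (hV.1 i) (hW.1 i), fun i j => ?_, fun i => ?_⟩
  · have := hcomb _ _ _ (hV.2.1 i j) (hW.2.1 i j)
    refine le_of_eq_of_le (congrArg _ ?_) this
    simp only [Pi.add_apply, Pi.smul_apply]
    module
  · simp [inner_add_left, real_inner_smul_left, hV.2.2 i, hW.2.2 i]

theorem one_add_pow_le {r : ℝ} (h0 : 0 ≤ r) (h1 : r ≤ 1) (A : ℕ) :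
    (1 + r) ^ A ≤ 1 + (2 ^ A - 1) * r := by
  induction A with
  | zero => simp
  | succ A ih =>
    have : (1 : ℝ) ≤ 2 ^ A := one_le_pow₀ one_le_two
    calc (1 + r) ^ (A + 1) ≤ (1 + (2 ^ A - 1) * r) * (1 + r) := by
          rw [pow_succ]
          gcongr
      _ ≤ _ := by
        rw [pow_succ]
        nlinarith [mul_nonneg (mul_nonneg (sub_nonneg.2 this) h0) (sub_nonneg.2 h1)]

theorem abs_locMax_sub_le {n A : ℕ} {g : EuclideanSpace ℝ (Fin d) → EuclideanSpace ℝ (Fin d)}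
    (hg : Continuous g) {x y : EuclideanSpace ℝ (Fin d)} (hx : ‖x‖ = 1) (hy : ‖y‖ = 1)
    (h : n * ‖x - y‖ ≤ 1) :
    |locMax n A g y - locMax n A g x| ≤ locMax n A g x * (2 ^ A * (n * ‖x - y‖)) := by
  set r := n * ‖x - y‖ with hr
  have hr0 : 0 ≤ r := by positivity
  have h1 := locMax_le_mul (n := n) (A := A) hg hx hy
  have h2 := locMax_le_mul (n := n) (A := A) hg hy hx
  rw [norm_sub_rev y x, ← hr] at h1
  rw [← hr] at h2
  have h3 := one_add_pow_le hr0 h A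
  have hMx := locMax_nonneg (n := n) (A := A) (g := g) x
  have hMy := locMax_nonneg (n := n) (A := A) (g := g) y
  set Mx := locMax n A g x
  set My := locMax n A g y
  have h4 := mul_le_mul_of_nonneg_left h3 hMx
  have h5 := mul_le_mul_of_nonneg_left h3 hMy
  have hA : (1 : ℝ) ≤ 2 ^ A := one_le_pow₀ one_le_two
  have h6 : 0 ≤ (2 ^ A - 1) * r := mul_nonneg (by linarith) hr0
  rw [abs_le]
  constructor
  · rcases le_total Mx My with h7 | h7
    · have : 0 ≤ Mx * (2 ^ A * r) := by positivity
      linarith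
    · nlinarith [mul_le_mul_of_nonneg_right h7 h6, mul_nonneg hMx hr0]
  · nlinarith [mul_nonneg hMx hr0]

/-- Normalizing a polynomial field by its local maxima gives a Lipschitz displacement field. -/
theorem exists_div_locMax_mem_displacements (A : ℕ) : ∃ l : ℝ, 1 ≤ l ∧
    ∀ (d n N : ℕ) (X : Fin N → EuclideanSpace ℝ (Fin d)) (P : MvPolynomial (Fin d) ℝ), 0 < n →
      P.totalDegree ≤ n → (∀ i, ‖X i‖ = 1) → (∀ i, 0 < locMax n A (tGrad P) (X i)) →
      (fun i => (locMax n A (tGrad P) (X i))⁻¹ • tGrad P (X i)) ∈ displacements X (l * n) 1 := by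
  obtain ⟨K, hK, hb⟩ := exists_norm_sub_le_of_growthBound A
  refine ⟨K + 2 ^ A + 4, by nlinarith [pow_pos (two_pos (α := ℝ)) A],
    fun d n N X P hn hP hX hM => ⟨fun i => ?_, fun i j => ?_, fun i => ?_⟩⟩
  · rw [norm_smul, norm_inv, Real.norm_of_nonneg (hM i).le, inv_mul_le_iff₀ (hM i), mul_one]
    exact norm_le_locMax (continuous_tGrad P) (hX i)
  · set g := tGrad P with hgdef
    have hg : Continuous g := continuous_tGrad P
    set r := n * ‖X i - X j‖ with hr
    have hr0 : 0 ≤ r := by positivity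
    have hpow : (0 : ℝ) < 2 ^ A := by positivity
    have hunit : ∀ k, ‖(locMax n A g (X k))⁻¹ • g (X k)‖ ≤ 1 := by
      intro k
      rw [norm_smul, norm_inv, Real.norm_of_nonneg (hM k).le, inv_mul_le_iff₀ (hM k), mul_one]
      exact norm_le_locMax hg (hX k)
    rw [one_mul, mul_assoc, ← hr]
    rcases le_or_gt r (1 / 2) with h | h
    · have hMi := hM i
      have hMj := hM j
      have hgj := norm_le_locMax (n := n) (A := A) hg (hX j)
      have hdiff := abs_locMax_sub_le (A := A) hg (hX i) (hX j) (by rw [← hr]; linarith)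
      have hlip := hb d n g (X i) _ hn (isPolyField_tGrad hn hP) (hX i)
        (growthBound_locMax (n := n) (A := A) hg (hX i)) (X i) (X j) (hX i) (hX j) (by simp)
        (by rw [norm_sub_rev, ← hr]; exact h)
      set Mi := locMax n A g (X i)
      set Mj := locMax n A g (X j)
      rw [← hr] at hdiff
      have heq : Mi⁻¹ • g (X i) - Mj⁻¹ • g (X j)
          = Mi⁻¹ • (g (X i) - g (X j)) + (Mi⁻¹ * Mj⁻¹ * (Mj - Mi)) • g (X j) := by
        have : Mi⁻¹ * Mj⁻¹ * (Mj - Mi) = Mi⁻¹ - Mj⁻¹ := by field_simp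
        rw [this]
        module
      have h1 : ‖Mi⁻¹ • (g (X i) - g (X j))‖ ≤ K * r := by
        rw [norm_smul, norm_inv, Real.norm_of_nonneg hMi.le, inv_mul_le_iff₀ hMi, norm_sub_rev]
        refine hlip.trans (le_of_eq ?_)
        rw [hr]
        ring
      have h2 : ‖(Mi⁻¹ * Mj⁻¹ * (Mj - Mi)) • g (X j)‖ ≤ 2 ^ A * r := by
        rw [norm_smul, norm_mul, norm_mul, norm_inv, norm_inv, Real.norm_of_nonneg hMi.le,
          Real.norm_of_nonneg hMj.le, Real.norm_eq_abs]
        calc Mi⁻¹ * Mj⁻¹ * |Mj - Mi| * ‖g (X j)‖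
            ≤ Mi⁻¹ * Mj⁻¹ * (Mi * (2 ^ A * r)) * Mj := by gcongr
          _ = _ := by field_simp
      rw [heq]
      refine (norm_add_le _ _).trans ((add_le_add h1 h2).trans ?_)
      nlinarith
    · refine (norm_sub_le _ _).trans ((add_le_add (hunit i) (hunit j)).trans ?_)
      nlinarith
  · rw [real_inner_smul_left, inner_tGrad_self P (hX i), mul_zero]

/-- The linearized equation has a small and Lipschitz solution. -/
theorem exists_displacement (A : ℕ) : ∃ l : ℝ, 1 ≤ l ∧
    ∀ (d n N : ℕ) (X : Fin N → EuclideanSpace ℝ (Fin d)) (C δ : ℝ)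
      (e : MvPolynomial (Fin d) ℝ →ₗ[ℝ] ℝ), 0 < n → 0 < C → 0 ≤ δ → (∀ i, ‖X i‖ = 1) →
      (∀ P : MvPolynomial (Fin d) ℝ, P.totalDegree ≤ n →
        ∑ i, locMax n A (tGrad P) (X i) ≤ C * ∑ i, ‖tGrad P (X i)‖) →
      (∀ P : MvPolynomial (Fin d) ℝ, P.totalDegree ≤ n → |e P| ≤ δ * ∑ i, ‖tGrad P (X i)‖) →
      ∃ V ∈ displacements X (l * n) (C * δ), ∀ P : MvPolynomial (Fin d) ℝ, P.totalDegree ≤ n →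
        e P = ∑ i, ⟪tGrad P (X i), V i⟫_ℝ := by
  obtain ⟨l, hl, hdisp⟩ := exists_div_locMax_mem_displacements A
  refine ⟨l, hl, fun d n N X C δ e hn hC hδ hX hMZ he => ?_⟩
  let B : MvPolynomial (Fin d) ℝ →ₗ[ℝ] (Fin N → EuclideanSpace ℝ (Fin d)) →ₗ[ℝ] ℝ :=
    LinearMap.mk₂ ℝ (fun P V => ∑ i, ⟪tGrad P (X i), V i⟫_ℝ)
      (fun P Q V => by simp only [tGrad_add, inner_add_left, Finset.sum_add_distrib])
      (fun c P V => by
        simp only [tGrad_smul, real_inner_smul_left, smul_eq_mul, Finset.mul_sum])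
      (fun P V W => by simp only [Pi.add_apply, inner_add_right, Finset.sum_add_distrib])
      (fun c P V => by
        simp only [Pi.smul_apply, real_inner_smul_right, smul_eq_mul, Finset.mul_sum])
  let W := MvPolynomial.restrictTotalDegree (Fin d) ℝ n
  have key : ∀ P : W, ∃ V ∈ displacements X (l * n) (C * δ),
      (e.comp W.subtype) P ≤ (B.comp W.subtype) P V := by
    rintro ⟨P, hPmem⟩
    have hP := (MvPolynomial.mem_restrictTotalDegree _ _ _).1 hPmem
    change ∃ V ∈ displacements X (l * n) (C * δ), e P ≤ ∑ i, ⟪tGrad P (X i), V i⟫_ℝ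
    have hCδ : 0 ≤ C * δ := by positivity
    have hg := continuous_tGrad P
    by_cases hM : ∀ i, 0 < locMax n A (tGrad P) (X i)
    · have hmem := hdisp d n N X P hn hP hX hM
      refine ⟨fun i => (C * δ) • ((locMax n A (tGrad P) (X i))⁻¹ • tGrad P (X i)),
        ⟨fun i => ?_, fun i j => ?_, fun i => ?_⟩, ?_⟩
      · rw [norm_smul, Real.norm_of_nonneg hCδ]
        exact mul_le_of_le_one_right hCδ (hmem.1 i)
      · rw [← smul_sub, norm_smul, Real.norm_of_nonneg hCδ]
        refine mul_le_mul_of_nonneg_left ?_ hCδ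
        simpa using hmem.2.1 i j
      · rw [real_inner_smul_left, hmem.2.2 i, mul_zero]
      · refine (le_abs_self _).trans ((he P hP).trans ?_)
        simp only [real_inner_smul_right, real_inner_self_eq_norm_sq]
        rw [← Finset.mul_sum]
        have hsq := Finset.sq_sum_div_le_sum_sq_div Finset.univ (fun i => ‖tGrad P (X i)‖)
          (g := fun i => locMax n A (tGrad P) (X i)) fun i _ => hM i
        have hMZP := hMZ P hP
        set G := ∑ i, ‖tGrad P (X i)‖ with hG
        set T := ∑ i, locMax n A (tGrad P) (X i) with hT
        have hG0 : 0 ≤ G := Finset.sum_nonneg fun i _ => norm_nonneg _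
        rcases hG0.eq_or_lt with h0 | h0
        · rw [← h0, mul_zero]
          exact mul_nonneg hCδ (Finset.sum_nonneg fun i _ =>
            mul_nonneg (inv_nonneg.2 (hM i).le) (sq_nonneg _))
        · have hT0 : 0 < T := h0.trans_le (Finset.sum_le_sum fun i _ => norm_le_locMax hg (hX i))
          have h1 : G ≤ C * (G ^ 2 / T) := by
            rw [mul_div_assoc', le_div_iff₀ hT0]
            nlinarith
          have h2 : G ^ 2 / T ≤ ∑ i, (locMax n A (tGrad P) (X i))⁻¹ * ‖tGrad P (X i)‖ ^ 2 := by
            refine hsq.trans (le_of_eq (Finset.sum_congr rfl fun i _ => ?_))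
            rw [div_eq_inv_mul]
          calc δ * G ≤ δ * (C * (G ^ 2 / T)) := by gcongr
            _ ≤ δ * (C * ∑ i, (locMax n A (tGrad P) (X i))⁻¹ * ‖tGrad P (X i)‖ ^ 2) := by
              gcongr
            _ = _ := by ring
    · push Not at hM
      obtain ⟨k, hk⟩ := hM
      have hzero : ∀ i, tGrad P (X i) = 0 := by
        intro i
        have h1 := growthBound_locMax (n := n) (A := A) hg (hX k) (X i) (mem_unitSphere.2 (hX i))
        have h2 : locMax n A (tGrad P) (X k) = 0 := le_antisymm hk (locMax_nonneg _)
        rw [h2, zero_mul] at h1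
        exact norm_le_zero_iff.1 h1
      refine ⟨0, ⟨fun i => by simpa using hCδ, fun i j => ?_, fun i => by simp⟩, ?_⟩
      · simp only [Pi.zero_apply, sub_zero, norm_zero]
        have : 0 ≤ l := by linarith
        positivity
      · have := he P hP
        simp only [hzero, norm_zero, Finset.sum_const_zero, mul_zero] at this
        simpa using (le_abs_self _).trans this
  obtain ⟨V, hV, hVe⟩ := exists_mem_forall_eq_of_forall_exists_le
    (isCompact_displacements X (l * n) (C * δ)) (convex_displacements X (l * n) (C * δ))
    (B.comp W.subtype) (e.comp W.subtype) key
  exact ⟨V, hV, fun P hP => hVe ⟨P, (MvPolynomial.mem_restrictTotalDegree _ _ _).2 hP⟩⟩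

/-! ### One step of the Newton iteration -/

/-- Radial projection to the unit sphere. -/
def radialProj (x : EuclideanSpace ℝ (Fin d)) : EuclideanSpace ℝ (Fin d) := ‖x‖⁻¹ • x

theorem norm_add_sq_of_tangent {x V : EuclideanSpace ℝ (Fin d)} (hx : ‖x‖ = 1)
    (hV : ⟪V, x⟫_ℝ = 0) : ‖x + V‖ ^ 2 = 1 + ‖V‖ ^ 2 := by
  rw [norm_add_sq_real, real_inner_comm, hV, hx]
  ring

theorem one_le_norm_add_of_tangent {x V : EuclideanSpace ℝ (Fin d)} (hx : ‖x‖ = 1)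
    (hV : ⟪V, x⟫_ℝ = 0) : 1 ≤ ‖x + V‖ := by
  have := norm_add_sq_of_tangent hx hV
  nlinarith [norm_nonneg (x + V), sq_nonneg ‖V‖]

theorem norm_add_le_of_tangent {x V : EuclideanSpace ℝ (Fin d)} (hx : ‖x‖ = 1)
    (hV : ⟪V, x⟫_ℝ = 0) : ‖x + V‖ ≤ 1 + ‖V‖ ^ 2 := by
  have := norm_add_sq_of_tangent hx hV
  nlinarith [norm_nonneg (x + V), sq_nonneg ‖V‖]

theorem norm_radialProj_add {x V : EuclideanSpace ℝ (Fin d)} (hx : ‖x‖ = 1)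
    (hV : ⟪V, x⟫_ℝ = 0) : ‖radialProj (x + V)‖ = 1 := by
  have := one_le_norm_add_of_tangent hx hV
  rw [radialProj, norm_smul, norm_inv, norm_norm, inv_mul_cancel₀ (by linarith)]

theorem norm_radialProj_add_sub_sub_le {x V : EuclideanSpace ℝ (Fin d)} (hx : ‖x‖ = 1)
    (hV : ⟪V, x⟫_ℝ = 0) : ‖radialProj (x + V) - x - V‖ ≤ ‖V‖ ^ 2 := by
  have h1 := one_le_norm_add_of_tangent hx hV
  have h2 := norm_add_le_of_tangent hx hV
  set q := ‖x + V‖ with hq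
  have h3 : radialProj (x + V) - x - V = (q⁻¹ - 1) • (x + V) := by
    rw [radialProj, ← hq]
    module
  have h4 : q⁻¹ ≤ 1 := inv_le_one_of_one_le₀ h1
  rw [h3, norm_smul, ← hq, Real.norm_eq_abs, abs_of_nonpos (by linarith)]
  have : q⁻¹ * q = 1 := inv_mul_cancel₀ (by linarith)
  nlinarith

theorem norm_radialProj_add_sub_le {x V : EuclideanSpace ℝ (Fin d)} {v : ℝ} (hx : ‖x‖ = 1)
    (hV : ⟪V, x⟫_ℝ = 0) (hv : ‖V‖ ≤ v) (hv1 : v ≤ 1) : ‖radialProj (x + V) - x‖ ≤ 2 * v := by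
  have h1 := norm_radialProj_add_sub_sub_le hx hV
  have h2 : ‖radialProj (x + V) - x‖ ≤ ‖radialProj (x + V) - x - V‖ + ‖V‖ := by
    simpa using norm_add_le (radialProj (x + V) - x - V) V
  nlinarith [norm_nonneg V]

/-- Radial projection of a Lipschitz displacement almost preserves mutual distances. -/
theorem le_norm_radialProj_sub {x y V W : EuclideanSpace ℝ (Fin d)} {v l : ℝ} (hx : ‖x‖ = 1)
    (hy : ‖y‖ = 1) (hV : ⟪V, x⟫_ℝ = 0) (hW : ⟪W, y⟫_ℝ = 0) (hv : ‖V‖ ≤ v) (hw : ‖W‖ ≤ v)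
    (hv1 : v ≤ 1) (hl : 1 ≤ l) (hVW : ‖V - W‖ ≤ v * (l * ‖x - y‖)) :
    (1 - 3 * l * v) * ‖x - y‖ ≤ ‖radialProj (x + V) - radialProj (y + W)‖ := by
  have hv0 : 0 ≤ v := (norm_nonneg V).trans hv
  have hx1 := one_le_norm_add_of_tangent hx hV
  have hx2 := norm_add_le_of_tangent hx hV
  have hy1 := one_le_norm_add_of_tangent hy hW
  have hxs := norm_add_sq_of_tangent hx hV
  have hys := norm_add_sq_of_tangent hy hW
  set z := x + V with hz
  set w := y + W with hw'
  set D := ‖x - y‖ with hD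
  have hD0 : 0 ≤ D := norm_nonneg _
  have h1 : (1 - v * l) * D ≤ ‖z - w‖ := by
    have h2 : x - y = (z - w) - (V - W) := by
      rw [hz, hw']
      abel
    have h3 : D ≤ ‖z - w‖ + ‖V - W‖ := by
      rw [hD, h2]
      exact norm_sub_le _ _
    nlinarith
  have h4 : |‖z‖ - ‖w‖| ≤ v * (v * (l * D)) := by
    have h5 : (‖z‖ - ‖w‖) * (‖z‖ + ‖w‖) = (‖V‖ - ‖W‖) * (‖V‖ + ‖W‖) := by nlinarith
    have h6 : |‖V‖ - ‖W‖| ≤ v * (l * D) := (abs_norm_sub_norm_le V W).trans hVW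
    have h7 : |‖z‖ - ‖w‖| * 2 ≤ |(‖z‖ - ‖w‖) * (‖z‖ + ‖w‖)| := by
      rw [abs_mul, abs_of_nonneg (by linarith : 0 ≤ ‖z‖ + ‖w‖)]
      gcongr
      linarith
    have h8 : |(‖V‖ - ‖W‖) * (‖V‖ + ‖W‖)| ≤ v * (l * D) * (2 * v) := by
      rw [abs_mul, abs_of_nonneg (by positivity : 0 ≤ ‖V‖ + ‖W‖)]
      gcongr
      linarith
    rw [h5] at h7
    linarith
  have h9 : ‖z - w‖ ≤ ‖z‖ * ‖radialProj z - radialProj w‖ + |‖z‖ - ‖w‖| := by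
    have h10 : z - w = ‖z‖ • (radialProj z - radialProj w) + (‖z‖ - ‖w‖) • radialProj w := by
      simp only [radialProj, smul_sub, smul_smul, sub_mul, sub_smul]
      rw [mul_inv_cancel₀ (by linarith), mul_inv_cancel₀ (by linarith)]
      module
    have h11 : ‖radialProj w‖ = 1 := norm_radialProj_add hy hW
    calc ‖z - w‖ = ‖‖z‖ • (radialProj z - radialProj w) + (‖z‖ - ‖w‖) • radialProj w‖ := by
          rw [← h10]
      _ ≤ _ := norm_add_le _ _
      _ = _ := by rw [norm_smul, norm_smul, norm_norm, h11, Real.norm_eq_abs, mul_one]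
  set R := ‖radialProj z - radialProj w‖ with hR
  have hR0 : 0 ≤ R := norm_nonneg _
  have h12 : (1 - 2 * v * l) * D ≤ (1 + v) * R := by
    have h13 : v * (v * (l * D)) ≤ v * (l * D) :=
      mul_le_of_le_one_left (by positivity) hv1
    have h14 : ‖z‖ ≤ 1 + v := by nlinarith [norm_nonneg V]
    have h15 : ‖z‖ * R ≤ (1 + v) * R := by gcongr
    linarith
  rcases le_total (1 - 3 * l * v) 0 with h | h
  · exact (mul_nonpos_of_nonpos_of_nonneg h hD0).trans hR0
  · have hvl : v ≤ v * l := le_mul_of_one_le_right hv0 hl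
    have h16 : (1 - 3 * l * v) * (1 + v) ≤ 1 - 2 * v * l := by
      have : 0 ≤ l * v * v := by positivity
      nlinarith
    have h17 := mul_le_mul_of_nonneg_right h16 hD0
    have h18 : (1 + v) * ((1 - 3 * l * v) * D) ≤ (1 + v) * R := by linarith
    exact le_of_mul_le_mul_left h18 (by linarith)

/-- The defect of the cubature formula with nodes `X` for the functional `I`. -/
def defect {N : ℕ} (I : MvPolynomial (Fin d) ℝ →ₗ[ℝ] ℝ) (X : Fin N → EuclideanSpace ℝ (Fin d)) :
    MvPolynomial (Fin d) ℝ →ₗ[ℝ] ℝ where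
  toFun P := I P - ∑ i, pEval P (X i)
  map_add' P Q := by
    simp only [pEval, map_add, Finset.sum_add_distrib]
    ring
  map_smul' c P := by
    simp only [pEval, map_smul, MvPolynomial.smul_eval, smul_eq_mul, ← Finset.mul_sum,
      RingHom.id_apply]
    ring

theorem defect_apply {N : ℕ} (I : MvPolynomial (Fin d) ℝ →ₗ[ℝ] ℝ)
    (X : Fin N → EuclideanSpace ℝ (Fin d)) (P : MvPolynomial (Fin d) ℝ) :
    defect I X P = I P - ∑ i, pEval P (X i) := rfl

/-- A quantitative Newton step. -/
theorem exists_newton_step (A : ℕ) {C : ℝ} (hC : 0 < C) : ∃ κ : ℝ, 0 < κ ∧ ∃ Γ : ℝ, 0 < Γ ∧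
    ∀ (d n N : ℕ) (X : Fin N → EuclideanSpace ℝ (Fin d)) (δ : ℝ)
      (I : MvPolynomial (Fin d) ℝ →ₗ[ℝ] ℝ), 0 < n → 0 ≤ δ → n * δ ≤ κ → (∀ i, ‖X i‖ = 1) →
      (∀ P : MvPolynomial (Fin d) ℝ, P.totalDegree ≤ n →
        ∑ i, locMax n A (tGrad P) (X i) ≤ C * ∑ i, ‖tGrad P (X i)‖) →
      (∀ P : MvPolynomial (Fin d) ℝ, P.totalDegree ≤ n →
        |defect I X P| ≤ δ * ∑ i, ‖tGrad P (X i)‖) →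
      ∃ Y : Fin N → EuclideanSpace ℝ (Fin d), (∀ i, ‖Y i‖ = 1) ∧ (∀ i, ‖Y i - X i‖ ≤ Γ * δ) ∧
        (∀ i j, (1 - Γ * (n * δ)) * ‖X i - X j‖ ≤ ‖Y i - Y j‖) ∧
        ∀ P : MvPolynomial (Fin d) ℝ, P.totalDegree ≤ n →
          |defect I Y P| ≤ δ / 2 * ∑ i, ‖tGrad P (Y i)‖ := by
  obtain ⟨l, hl, hdisp⟩ := exists_displacement A
  obtain ⟨K₁, hK₁, hlip⟩ := exists_norm_sub_le_of_growthBound A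
  obtain ⟨K₂, hK₂, htay⟩ := exists_abs_taylor_le A
  refine ⟨min (1 / (20 * C)) (min (1 / (4 * K₁ * C ^ 2)) (1 / (4 * (4 * K₂ + 1) * C ^ 3))),
    by positivity, 3 * l * C + 2 * C, by positivity,
    fun d n N X δ I hn hδ hnδ hX hMZ he => ?_⟩
  rw [le_min_iff, le_min_iff] at hnδ
  obtain ⟨hκ1, hκ2, hκ3⟩ := hnδ
  rw [le_div_iff₀ (by positivity)] at hκ1 hκ2 hκ3
  have hn1 : (1 : ℝ) ≤ n := by exact_mod_cast hn
  obtain ⟨V, ⟨hV1, hV2, hV3⟩, hVe⟩ := hdisp d n N X C δ (defect I X) hn hC hδ hX hMZ he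
  set v := C * δ with hv
  have hv0 : 0 ≤ v := by positivity
  have hnv : n * v ≤ 1 / 20 := by nlinarith
  have hv1 : v ≤ 1 := by nlinarith
  set Y : Fin N → EuclideanSpace ℝ (Fin d) := fun i => radialProj (X i + V i) with hY
  have hY1 : ∀ i, ‖Y i‖ = 1 := fun i => norm_radialProj_add (hX i) (hV3 i)
  have hYX : ∀ i, ‖Y i - X i‖ ≤ 2 * v := fun i =>
    norm_radialProj_add_sub_le (hX i) (hV3 i) (hV1 i) hv1
  refine ⟨Y, hY1, fun i => (hYX i).trans ?_, fun i j => ?_, fun P hP => ?_⟩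
  · rw [hv]
    nlinarith [mul_nonneg (mul_nonneg (by linarith : 0 ≤ l) hC.le) hδ]
  · refine le_trans ?_ (le_norm_radialProj_sub (l := l * n) (hX i) (hX j) (hV3 i) (hV3 j)
      (hV1 i) (hV1 j) hv1 (by nlinarith) (hV2 i j))
    refine mul_le_mul_of_nonneg_right ?_ (norm_nonneg _)
    have : 0 ≤ 2 * C * (n * δ) := by positivity
    rw [hv]
    nlinarith
  · have hg := continuous_tGrad P
    set M := fun i => locMax n A (tGrad P) (X i) with hM
    have hgb : ∀ i, GrowthBound n A (tGrad P) (X i) (M i) := fun i => growthBound_locMax hg (hX i)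
    have hM0 : ∀ i, 0 ≤ M i := fun i => locMax_nonneg _
    have hnYX : ∀ i, n * ‖Y i - X i‖ ≤ 1 / 10 := by
      intro i
      calc n * ‖Y i - X i‖ ≤ n * (2 * v) := by gcongr; exact hYX i
        _ ≤ 1 / 10 := by linarith
    set G := ∑ i, ‖tGrad P (X i)‖ with hG
    set G' := ∑ i, ‖tGrad P (Y i)‖ with hG'
    have hMG : ∑ i, M i ≤ C * G := hMZ P hP
    have hG0 : 0 ≤ G := Finset.sum_nonneg fun i _ => norm_nonneg _
    have hGG' : G ≤ 2 * G' := by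
      have h1 : ∀ i, ‖tGrad P (X i)‖ ≤ ‖tGrad P (Y i)‖ + 2 * K₁ * (n * v) * M i := by
        intro i
        have h2 := hlip d n (tGrad P) (X i) (M i) hn (isPolyField_tGrad hn hP) (hX i) (hgb i)
          (X i) (Y i) (hX i) (hY1 i) (by simp) ((hnYX i).trans (by norm_num))
        have h3 := norm_sub_norm_le (tGrad P (X i)) (tGrad P (Y i))
        rw [norm_sub_rev] at h3
        have h4 : K₁ * n * ‖X i - Y i‖ * M i ≤ K₁ * n * (2 * v) * M i := by
          rw [norm_sub_rev]
          have := hYX i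
          have := hM0 i
          gcongr
        linarith
      have h5 := Finset.sum_le_sum fun i (_ : i ∈ Finset.univ) => h1 i
      rw [Finset.sum_add_distrib, ← Finset.mul_sum, ← hG, ← hG'] at h5
      have h6 : 2 * K₁ * (n * v) * ∑ i, M i ≤ 2 * K₁ * (n * v) * (C * G) := by gcongr
      have h7 : 2 * K₁ * (n * v) * (C * G) = (n * δ * (4 * K₁ * C ^ 2)) * G / 2 := by
        rw [hv]
        ring
      have h8 := mul_le_mul_of_nonneg_right hκ2 hG0
      linarith
    have hterm : ∀ i, |⟪tGrad P (X i), V i⟫_ℝ - (pEval P (Y i) - pEval P (X i))|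
        ≤ (4 * K₂ + 1) * n * v ^ 2 * M i := by
      intro i
      have h1 := htay d n P (X i) (M i) hn hP (hX i) (hgb i) (X i) (Y i) (hX i) (hY1 i) (by simp)
        (hnYX i)
      have h2 : |⟪tGrad P (X i), Y i - X i - V i⟫_ℝ| ≤ M i * v ^ 2 := by
        refine (abs_real_inner_le_norm _ _).trans ?_
        have h3 := norm_radialProj_add_sub_sub_le (hX i) (hV3 i)
        refine mul_le_mul (norm_le_locMax hg (hX i)) (h3.trans ?_) (norm_nonneg _) (hM0 i)
        have := hV1 i
        gcongr
      have h4 : K₂ * n * ‖X i - Y i‖ ^ 2 * M i ≤ K₂ * n * (2 * v) ^ 2 * M i := by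
        rw [norm_sub_rev]
        have := hYX i
        have := hM0 i
        gcongr
      have h5 : M i * v ^ 2 ≤ n * v ^ 2 * M i := by
        have : 0 ≤ M i * v ^ 2 := mul_nonneg (hM0 i) (sq_nonneg v)
        nlinarith
      have h6 : ⟪tGrad P (X i), V i⟫_ℝ - (pEval P (Y i) - pEval P (X i))
          = -(pEval P (Y i) - pEval P (X i) - ⟪tGrad P (X i), Y i - X i⟫_ℝ)
            - ⟪tGrad P (X i), Y i - X i - V i⟫_ℝ := by
        simp only [inner_sub_right]
        ring
      rw [h6]
      refine (abs_sub _ _).trans ?_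
      rw [abs_neg]
      calc _ ≤ K₂ * n * (2 * v) ^ 2 * M i + n * v ^ 2 * M i :=
            add_le_add (h1.trans h4) (h2.trans h5)
        _ = _ := by ring
    have hdef : defect I Y P
        = ∑ i, (⟪tGrad P (X i), V i⟫_ℝ - (pEval P (Y i) - pEval P (X i))) := by
      have := hVe P hP
      rw [defect_apply] at this ⊢
      simp only [Finset.sum_sub_distrib]
      linarith
    rw [hdef]
    calc _ ≤ ∑ i, (4 * K₂ + 1) * n * v ^ 2 * M i :=
          (Finset.abs_sum_le_sum_abs _ _).trans (Finset.sum_le_sum fun i _ => hterm i)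
      _ = (4 * K₂ + 1) * n * v ^ 2 * ∑ i, M i := by rw [Finset.mul_sum]
      _ ≤ (4 * K₂ + 1) * n * v ^ 2 * (C * (2 * G')) := by
        gcongr
        exact hMG.trans (by gcongr)
      _ = (n * δ * (4 * (4 * K₂ + 1) * C ^ 3)) * (δ / 2 * G') := by
        rw [hv]
        ring
      _ ≤ 1 * (δ / 2 * G') := by
        gcongr
      _ = _ := one_mul _

/-! ### Convergence of the Newton iteration -/

theorem continuous_pEval (P : MvPolynomial (Fin d) ℝ) : Continuous (pEval P) :=
  (MvPolynomial.continuous_eval P).comp (EuclideanSpace.equiv (Fin d) ℝ).continuous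

/-- A limit point of nodes whose defects tend to zero yields an exact formula. -/
theorem exists_nodes_of_forall_exists {n N : ℕ} {X : Fin N → EuclideanSpace ℝ (Fin d)} {δ : ℝ}
    {I : MvPolynomial (Fin d) ℝ →ₗ[ℝ] ℝ}
    (h : ∀ k : ℕ, ∃ Y : Fin N → EuclideanSpace ℝ (Fin d), (∀ i, ‖Y i‖ = 1) ∧
      (∀ i j, 1 / 2 * ‖X i - X j‖ ≤ ‖Y i - Y j‖) ∧
      ∀ P : MvPolynomial (Fin d) ℝ, P.totalDegree ≤ n →
        |defect I Y P| ≤ δ * (1 / 2) ^ k * ∑ i, ‖tGrad P (Y i)‖) :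
    ∃ Y : Fin N → EuclideanSpace ℝ (Fin d), (∀ i, ‖Y i‖ = 1) ∧
      (∀ i j, 1 / 2 * ‖X i - X j‖ ≤ ‖Y i - Y j‖) ∧
      ∀ P : MvPolynomial (Fin d) ℝ, P.totalDegree ≤ n → defect I Y P = 0 := by
  choose Y hY1 hY2 hY3 using h
  have hcomp : IsCompact (Set.univ.pi fun _ : Fin N => unitSphere d) :=
    isCompact_univ_pi fun _ => isCompact_sphere _ _
  obtain ⟨Z, hZ, φ, hφ, hlim⟩ := hcomp.tendsto_subseq
    fun k => (Set.mem_univ_pi.2 fun i => mem_unitSphere.2 (hY1 k i))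
  have hi : ∀ i, Filter.Tendsto (fun k => Y (φ k) i) Filter.atTop (nhds (Z i)) := fun i =>
    (tendsto_pi_nhds.1 hlim) i
  refine ⟨Z, fun i => mem_unitSphere.1 (Set.mem_univ_pi.1 hZ i), fun i j => ?_, fun P hP => ?_⟩
  · exact ge_of_tendsto' (((hi i).sub (hi j)).norm) fun k => hY2 _ i j
  · have h1 : Filter.Tendsto (fun k => |defect I (Y (φ k)) P|) Filter.atTop
        (nhds |defect I Z P|) := by
      simp only [defect_apply]
      refine (Filter.Tendsto.sub tendsto_const_nhds (tendsto_finsetSum _ fun i _ => ?_)).abs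
      exact ((continuous_pEval P).tendsto _).comp (hi i)
    have h2 : Filter.Tendsto (fun k => δ * (1 / 2 : ℝ) ^ φ k * ∑ i, ‖tGrad P (Y (φ k) i)‖)
        Filter.atTop (nhds (δ * 0 * ∑ i, ‖tGrad P (Z i)‖)) := by
      refine Filter.Tendsto.mul (Filter.Tendsto.mul tendsto_const_nhds ?_)
        (tendsto_finsetSum _ fun i _ => ?_)
      · exact (tendsto_pow_atTop_nhds_zero_of_lt_one (by norm_num) (by norm_num)).comp
          hφ.tendsto_atTop
      · exact (((continuous_tGrad P).tendsto _).comp (hi i)).norm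
    have h3 := le_of_tendsto_of_tendsto' h1 h2 fun k => hY3 _ P hP
    rw [mul_zero, zero_mul] at h3
    exact abs_nonpos_iff.1 h3

/-- If the defect of a family of nodes is small, and all small perturbations of the family have a
doubling counting measure, then the nodes can be moved slightly to give an exact formula. -/
theorem exists_exact_of_small_defect (s : ℕ) : ∃ c : ℝ, 0 < c ∧ c ≤ 1 / 2 ∧ ∀ D : ℝ, 0 < D →
    ∃ κ : ℝ, 0 < κ ∧ ∀ (d n N : ℕ) (X : Fin N → EuclideanSpace ℝ (Fin d)) (δ : ℝ)
      (I : MvPolynomial (Fin d) ℝ →ₗ[ℝ] ℝ), 0 < n → 0 ≤ δ → n * δ ≤ κ → (∀ i, ‖X i‖ = 1) →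
      (∀ Y : Fin N → EuclideanSpace ℝ (Fin d), (∀ i, ‖Y i‖ = 1) →
        (∀ i, ‖Y i - X i‖ ≤ c / 4 / n) → CountDoubling Y n s c D) →
      (∀ P : MvPolynomial (Fin d) ℝ, P.totalDegree ≤ n →
        |defect I X P| ≤ δ * ∑ i, locMax n (3 * s + 2) (tGrad P) (X i)) →
      ∃ Y : Fin N → EuclideanSpace ℝ (Fin d), (∀ i, ‖Y i‖ = 1) ∧
        (∀ i j, 1 / 2 * ‖X i - X j‖ ≤ ‖Y i - Y j‖) ∧
        ∀ P : MvPolynomial (Fin d) ℝ, P.totalDegree ≤ n → defect I Y P = 0 := by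
  obtain ⟨c, hc0, hc1, hMZ⟩ := exists_sum_locMax_le s
  refine ⟨c, hc0, hc1, fun D hD => ?_⟩
  obtain ⟨C, hC, hMZ⟩ := hMZ D hD
  obtain ⟨κ, hκ, Γ, hΓ, hstep⟩ := exists_newton_step (3 * s + 2) hC
  refine ⟨min κ (min (1 / (4 * Γ)) (c / (8 * Γ))) / C, by positivity,
    fun d n N X δ₀ I hn hδ₀ hnδ₀ hX hdbl hdef => ?_⟩
  have hn0 : (0 : ℝ) < n := by exact_mod_cast hn
  set δ := δ₀ * C with hδdef
  have hδ : 0 ≤ δ := by positivity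
  have hnδ : n * δ ≤ min κ (min (1 / (4 * Γ)) (c / (8 * Γ))) := by
    rw [le_div_iff₀ hC] at hnδ₀
    rwa [hδdef, ← mul_assoc]
  rw [le_min_iff, le_min_iff] at hnδ
  obtain ⟨h1, h2, h3⟩ := hnδ
  rw [le_div_iff₀ (by positivity)] at h2 h3
  have hiter : ∀ k : ℕ, ∃ Y : Fin N → EuclideanSpace ℝ (Fin d), (∀ i, ‖Y i‖ = 1) ∧
      (∀ i, ‖Y i - X i‖ ≤ 2 * Γ * δ * (1 - (1 / 2) ^ k)) ∧
      (∀ i j, (1 / 2 + 1 / 2 * (1 / 2) ^ k) * ‖X i - X j‖ ≤ ‖Y i - Y j‖) ∧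
      ∀ P : MvPolynomial (Fin d) ℝ, P.totalDegree ≤ n →
        |defect I Y P| ≤ δ * (1 / 2) ^ k * ∑ i, ‖tGrad P (Y i)‖ := by
    intro k
    induction k with
    | zero =>
      refine ⟨X, hX, fun i => by simp, fun i j => by norm_num, fun P hP => ?_⟩
      refine (hdef P hP).trans ?_
      rw [pow_zero, mul_one, hδdef, mul_assoc]
      refine mul_le_mul_of_nonneg_left ?_ hδ₀
      exact hMZ d n N X (tGrad P) hn (isPolyField_tGrad hn hP) (continuous_tGrad P) hX
        (hdbl X hX fun i => by rw [sub_self, norm_zero]; positivity)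
    | succ k ih =>
      obtain ⟨Y, hY1, hYX, hYsep, hYdef⟩ := ih
      set q : ℝ := (1 / 2) ^ k with hq
      have hq0 : 0 < q := by positivity
      have hq1 : q ≤ 1 := pow_le_one₀ (by norm_num) (by norm_num)
      have hYd := hdbl Y hY1 fun i => (hYX i).trans (by
        rw [le_div_iff₀ hn0]
        have : 2 * Γ * δ * (1 - q) ≤ 2 * Γ * δ * 1 := by
          gcongr
          linarith
        nlinarith)
      obtain ⟨Z, hZ1, hZY, hZsep, hZdef⟩ := hstep d n N Y (δ * q) I hn (by positivity)
        (by nlinarith [mul_nonneg hn0.le hδ]) hY1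
        (fun P hP => hMZ d n N Y (tGrad P) hn (isPolyField_tGrad hn hP) (continuous_tGrad P)
          hY1 hYd) hYdef
      have hqs : (1 / 2 : ℝ) ^ (k + 1) = q / 2 := by
        rw [pow_succ, hq]
        ring
      rw [hqs]
      refine ⟨Z, hZ1, fun i => ?_, fun i j => ?_, fun P hP => ?_⟩
      · refine (norm_sub_le_norm_sub_add_norm_sub _ (Y i) _).trans
          ((add_le_add (hZY i) (hYX i)).trans (le_of_eq ?_))
        ring
      · have h4 : Γ * (n * (δ * q)) ≤ 1 / 4 * q := by nlinarith
        have h5 : 1 / 2 + 1 / 2 * (q / 2) ≤ (1 - Γ * (n * (δ * q))) * (1 / 2 + 1 / 2 * q) := by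
          nlinarith
        calc (1 / 2 + 1 / 2 * (q / 2)) * ‖X i - X j‖
            ≤ (1 - Γ * (n * (δ * q))) * (1 / 2 + 1 / 2 * q) * ‖X i - X j‖ := by gcongr
          _ = (1 - Γ * (n * (δ * q))) * ((1 / 2 + 1 / 2 * q) * ‖X i - X j‖) := by ring
          _ ≤ (1 - Γ * (n * (δ * q))) * ‖Y i - Y j‖ :=
            mul_le_mul_of_nonneg_left (hYsep i j) (by linarith)
          _ ≤ _ := hZsep i j
      · refine (hZdef P hP).trans (le_of_eq ?_)
        ring
  refine exists_nodes_of_forall_exists (δ := δ) fun k => ?_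
  obtain ⟨Y, hY1, -, hYsep, hYdef⟩ := hiter k
  refine ⟨Y, hY1, fun i j => le_trans ?_ (hYsep i j), hYdef⟩
  gcongr
  have : (0 : ℝ) < (1 / 2) ^ k := by positivity
  linarith

/-! ### Rounding weights on a connected graph -/

/-- In a connected graph, nonnegative weights with integer total can be rounded to integers by
transporting at most a unit mass out of every vertex along edges. The statement is proved for a
growing sequence of connected vertex sets `T`. -/
theorem exists_rounding_on {V : Type*} [Fintype V] [DecidableEq V] [Nonempty V] (R : V → V → Prop)
    (hR : ∀ A : Finset V, A.Nonempty → A ≠ Finset.univ → ∃ v ∈ A, ∃ u ∉ A, R u v) (k : ℕ)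
    (hk : k + 1 ≤ Fintype.card V) :
    ∃ T : Finset V, T.card = k + 1 ∧ ∀ b : V → ℝ, (∀ v, 0 ≤ b v) →
      (∃ m : ℕ, ∑ v ∈ T, b v = m) → ∃ (N : V → ℕ) (θ : V → V → ℝ), (∀ x y, 0 ≤ θ x y) ∧
        (∀ x y, θ x y ≠ 0 → R x y ∧ x ∈ T ∧ y ∈ T) ∧ (∀ x, ∑ y, θ x y ≤ 1) ∧
        ∀ v ∈ T, (N v : ℝ) = b v + ∑ u, θ u v - ∑ u, θ v u := by
  induction k with
  | zero =>
    obtain ⟨v₀⟩ := ‹Nonempty V›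
    refine ⟨{v₀}, by simp, fun b _ hm => ?_⟩
    obtain ⟨m, hm⟩ := hm
    refine ⟨fun _ => m, fun _ _ => 0, by simp, by simp, by simp, fun v hv => ?_⟩
    rw [Finset.mem_singleton] at hv
    rw [Finset.sum_singleton] at hm
    simp [hv, hm]
  | succ k ih =>
    obtain ⟨T, hTc, hT⟩ := ih (by omega)
    obtain ⟨v₀, hv₀, u, hu, hRu⟩ := hR T (Finset.card_pos.1 (by omega))
      (fun h => by rw [h, Finset.card_univ] at hTc; omega)
    have hne : u ≠ v₀ := fun h => hu (h ▸ hv₀)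
    refine ⟨insert u T, by rw [Finset.card_insert_of_notMem hu, hTc], fun b hb hm => ?_⟩
    obtain ⟨m, hm⟩ := hm
    set r : ℝ := b u - ⌊b u⌋₊ with hr
    have hr0 : 0 ≤ r := sub_nonneg.2 (Nat.floor_le (hb u))
    have hr1 : r ≤ 1 := by have := Nat.lt_floor_add_one (b u); linarith
    rw [Finset.sum_insert hu] at hm
    have hle : ⌊b u⌋₊ ≤ m := by
      have h1 : 0 ≤ ∑ v ∈ T, b v := Finset.sum_nonneg fun v _ => hb v
      have : (⌊b u⌋₊ : ℝ) ≤ m := by linarith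
      exact_mod_cast this
    obtain ⟨N', θ', hθ0, hθR, hθ1, hN'⟩ := hT (fun v => b v + if v = v₀ then r else 0)
      (fun v => add_nonneg (hb v) (by split_ifs <;> simp [hr0])) ⟨m - ⌊b u⌋₊, by
        rw [Finset.sum_add_distrib, Finset.sum_ite_eq', if_pos hv₀, Nat.cast_sub hle]
        linarith⟩
    have hz1 : ∀ y, θ' u y = 0 := fun y => by
      by_contra h; exact hu (hθR _ _ h).2.1
    have hz2 : ∀ x, θ' x u = 0 := fun x => by
      by_contra h; exact hu (hθR _ _ h).2.2
    refine ⟨Function.update N' u ⌊b u⌋₊,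
      fun x y => θ' x y + if x = u ∧ y = v₀ then r else 0, fun x y => ?_, fun x y h => ?_,
      fun x => ?_, fun v hv => ?_⟩
    · exact add_nonneg (hθ0 x y) (by split_ifs <;> simp [hr0])
    · by_cases hxy : x = u ∧ y = v₀
      · rw [hxy.1, hxy.2]
        exact ⟨hRu, Finset.mem_insert_self _ _, Finset.mem_insert_of_mem hv₀⟩
      · simp only [if_neg hxy, add_zero] at h
        have := hθR _ _ h
        exact ⟨this.1, Finset.mem_insert_of_mem this.2.1, Finset.mem_insert_of_mem this.2.2⟩
    · by_cases hx : x = u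
      · subst hx
        simpa [hz1] using hr1
      · simpa [hx] using hθ1 x
    · by_cases hv' : v = u
      · subst hv'
        simp [hz1, hz2, hne, hr]
      · have hvT : v ∈ T := (Finset.mem_insert.1 hv).resolve_left hv'
        rw [Function.update_of_ne hv', hN' v hvT]
        simp only [hv', false_and, if_false, add_zero, Finset.sum_add_distrib]
        by_cases hvv : v = v₀
        · simp [hvv]; ring
        · simp [hvv]

/-- In a connected graph, nonnegative weights with integer total can be rounded to integers by
transporting at most a unit mass out of every vertex along edges. -/
theorem exists_rounding {V : Type*} [Fintype V] [Nonempty V] (R : V → V → Prop)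
    (hR : ∀ A : Finset V, A.Nonempty → A ≠ Finset.univ → ∃ v ∈ A, ∃ u ∉ A, R u v)
    {b : V → ℝ} (hb : ∀ v, 0 ≤ b v) {m : ℕ} (hm : ∑ v, b v = m) :
    ∃ (N : V → ℕ) (θ : V → V → ℝ), (∀ x y, 0 ≤ θ x y) ∧
        (∀ x y, θ x y ≠ 0 → R x y) ∧ (∀ x, ∑ y, θ x y ≤ 1) ∧
        ∀ v, (N v : ℝ) = b v + ∑ u, θ u v - ∑ u, θ v u := by
  classical
  have hpos : 0 < Fintype.card V := Fintype.card_pos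
  obtain ⟨T, hTc, hT⟩ := exists_rounding_on R hR (Fintype.card V - 1) (by omega)
  have hTu : T = Finset.univ := Finset.eq_univ_of_card T (by omega)
  subst hTu
  obtain ⟨N, θ, h1, h2, h3, h4⟩ := hT b hb ⟨m, hm⟩
  exact ⟨N, θ, h1, fun x y h => (h2 x y h).1, h3, fun v => h4 v (Finset.mem_univ v)⟩

/-! ### Separated nets and packings -/

/-- A compact set contains a finite `h`-separated set which is also an `h`-net. -/
theorem exists_separated_net {α : Type*} [MetricSpace α] {K : Set α} (hK : IsCompact K) {h : ℝ}
    (hh : 0 < h) : ∃ T : Finset α, (↑T : Set α) ⊆ K ∧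
      (∀ x ∈ T, ∀ y ∈ T, x ≠ y → h < dist x y) ∧ ∀ x ∈ K, ∃ y ∈ T, dist x y ≤ h := by
  set ε : NNReal := (h / 2).toNNReal with hε
  have hε0 : ε ≠ 0 := (Real.toNNReal_pos.2 (half_pos hh)).ne'
  have h2 : ((2 * ε : NNReal) : ℝ) = h := by
    push_cast
    rw [hε, Real.coe_toNNReal _ (half_pos hh).le]
    ring
  have hfin : Metric.packingNumber (2 * ε) K ≠ ⊤ := by
    obtain ⟨N, -, hNf, hNc⟩ := Metric.exists_finite_isCover_of_isCompact hε0 hK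
    refine ((Metric.packingNumber_two_mul_le_externalCoveringNumber ε K).trans_lt
      (hNc.externalCoveringNumber_le_encard.trans_lt ?_)).ne
    exact hNf.encard_lt_top
  have hTfin : (Metric.maximalSeparatedSet (2 * ε) K).Finite := by
    rw [← Set.encard_ne_top_iff, Metric.encard_maximalSeparatedSet hfin]
    exact hfin
  refine ⟨hTfin.toFinset, ?_, fun x hx y hy hxy => ?_, fun x hx => ?_⟩
  · rw [Set.Finite.coe_toFinset]
    exact Metric.maximalSeparatedSet_subset
  · have : ((2 * ε : NNReal) : ENNReal) < edist x y :=
      Metric.isSeparated_maximalSeparatedSet (hTfin.mem_toFinset.1 hx)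
      (hTfin.mem_toFinset.1 hy) hxy
    rw [edist_nndist, ENNReal.coe_lt_coe, ← NNReal.coe_lt_coe, h2] at this
    simpa using this
  · have := Metric.isCover_iff_subset_iUnion_closedBall.1
      (Metric.isCover_maximalSeparatedSet hfin) hx
    simp only [Set.mem_iUnion, Metric.mem_closedBall, h2, exists_prop] at this
    obtain ⟨y, hy, hxy⟩ := this
    exact ⟨y, hTfin.mem_toFinset.2 hy, hxy⟩

/-- A measurable choice of a nearest point in a finite set. -/
theorem exists_measurable_nearest {α : Type*} [MetricSpace α] [MeasurableSpace α]
    [OpensMeasurableSpace α] {T : Finset α} (hT : T.Nonempty) :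
    ∃ c : α → α, (∀ y, MeasurableSet (c ⁻¹' {y})) ∧ (∀ x, c x ∈ T) ∧
      ∀ x, ∀ y ∈ T, dist x (c x) ≤ dist x y := by
  obtain ⟨a, ha⟩ := hT
  set e : ℕ → α := fun k => if hk : k < T.card then T.equivFin.symm ⟨k, hk⟩ else a with he
  have heT : ∀ k, e k ∈ T := fun k => by
    simp only [he]
    split_ifs
    · exact Finset.coe_mem _
    · exact ha
  refine ⟨SimpleFunc.nearestPt e T.card, fun y => SimpleFunc.measurableSet_fiber _ _, fun x => ?_,
    fun x y hy => ?_⟩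
  · exact heT _
  · have hk : e (T.equivFin ⟨y, hy⟩) = y := by simp [he]
    have := SimpleFunc.edist_nearestPt_le e x (k := T.equivFin ⟨y, hy⟩) (N := T.card)
      (T.equivFin ⟨y, hy⟩).2.le
    rw [hk, edist_dist, edist_dist, ENNReal.ofReal_le_ofReal_iff dist_nonneg] at this
    rwa [dist_comm x, dist_comm x]

/-- A set of large measure contains many separated points. -/
theorem exists_separated_finset {α : Type*} [MetricSpace α] [MeasurableSpace α]
    [OpensMeasurableSpace α] {μ : Measure α} [IsFiniteMeasure μ] {B : Set α} {s β : ℝ} (hs : 0 ≤ s)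
    (hβ : 0 < β) (hball : ∀ t ∈ B, μ.real (Metric.closedBall t s) ≤ β) (m : ℕ)
    (hm : m * β ≤ μ.real B) :
    ∃ F : Finset α, F.card = m ∧ (↑F : Set α) ⊆ B ∧ ∀ x ∈ F, ∀ y ∈ F, x ≠ y → s < dist x y := by
  classical
  induction m with
  | zero => exact ⟨∅, by simp⟩
  | succ m ih =>
    push_cast at hm
    obtain ⟨F, hFc, hFB, hF⟩ := ih (by linarith)
    have hex : ∃ t ∈ B, t ∉ ⋃ x ∈ F, Metric.closedBall x s := by
      by_contra! hcon
      have h1 : μ.real B ≤ μ.real (⋃ x ∈ F, Metric.closedBall x s) := measureReal_mono hcon (measure_ne_top _ _)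
      have h2 := measureReal_biUnion_finset_le (μ := μ) F fun x => Metric.closedBall x s
      have h3 : ∑ x ∈ F, μ.real (Metric.closedBall x s) ≤ ∑ _x ∈ F, β :=
        Finset.sum_le_sum fun x hx => hball x (hFB hx)
      rw [Finset.sum_const, hFc, nsmul_eq_mul] at h3
      linarith
    obtain ⟨t, htB, ht⟩ := hex
    have ht' : ∀ x ∈ F, s < dist t x := fun x hx => by
      by_contra! hcon
      exact ht (Set.mem_iUnion₂.2 ⟨x, hx, Metric.mem_closedBall.2 hcon⟩)
    have htF : t ∉ F := fun h => by
      have := ht' t h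
      rw [dist_self] at this
      linarith
    refine ⟨insert t F, by rw [Finset.card_insert_of_notMem htF, hFc], ?_, fun x hx y hy hxy => ?_⟩
    · rw [Finset.coe_insert]
      exact Set.insert_subset htB hFB
    · rcases Finset.mem_insert.1 hx with hx | hx <;> rcases Finset.mem_insert.1 hy with hy | hy
      · exact absurd (hx.trans hy.symm) hxy
      · exact hx ▸ ht' y hy
      · rw [hy, dist_comm]; exact ht' x hx
      · exact hF x hx y hy hxy

/-- The adjacency graph of a net of a preconnected compact set is connected. -/
theorem exists_adjacent_of_net {α : Type*} [MetricSpace α] {K : Set α} (hK : IsPreconnected K)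
    {h : ℝ} {T : Finset α} (hTK : (↑T : Set α) ⊆ K) (hh : 0 ≤ h)
    (hnet : ∀ x ∈ K, ∃ y ∈ T, dist x y ≤ h)
    (A : Finset T) (hA : A.Nonempty) (hA' : A ≠ Finset.univ) :
    ∃ v ∈ A, ∃ u ∉ A, dist (u : α) v ≤ 2 * h := by
  classical
  have hclosed : ∀ A : Finset T, IsClosed (⋃ v ∈ A, Metric.closedBall (v : α) h) := fun A =>
    A.finite_toSet.isClosed_biUnion fun v _ => Metric.isClosed_closedBall
  have hne : ∀ A : Finset T, A.Nonempty →
      (K ∩ ⋃ v ∈ A, Metric.closedBall (v : α) h).Nonempty := fun A ⟨v, hv⟩ =>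
    ⟨v, hTK v.2, Set.mem_iUnion₂.2 ⟨v, hv, Metric.mem_closedBall_self hh⟩⟩
  have hAc : Aᶜ.Nonempty := by
    rwa [Finset.nonempty_iff_ne_empty, Ne, Finset.compl_eq_empty_iff]
  obtain ⟨x, -, hx1, hx2⟩ := isPreconnected_closed_iff.1 hK _ _ (hclosed A) (hclosed Aᶜ)
    (fun x hx => by
      obtain ⟨y, hy, hxy⟩ := hnet x hx
      by_cases hyA : (⟨y, hy⟩ : T) ∈ A
      · exact Or.inl (Set.mem_iUnion₂.2 ⟨_, hyA, hxy⟩)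
      · exact Or.inr (Set.mem_iUnion₂.2 ⟨⟨y, hy⟩, Finset.mem_compl.2 hyA, hxy⟩))
    (hne A hA) (hne _ hAc)
  obtain ⟨v, hv, hxv⟩ := Set.mem_iUnion₂.1 hx1
  obtain ⟨u, hu, hxu⟩ := Set.mem_iUnion₂.1 hx2
  refine ⟨v, hv, u, Finset.mem_compl.1 hu, ?_⟩
  have := dist_triangle_left (u : α) v x
  rw [Metric.mem_closedBall] at hxv hxu
  linarith

/-! ### Quantization of a measure -/

/-- A partition of `K` into cells around the points of a finite set `T`, together with a
rounding of the `ω`-masses (times `N`) of the cells to integers, realized by finite sets of nodes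
near the centers of the cells. The rounding transports the mass `θ u v` from the cell of `u` to
that of `v`. -/
structure CellPartition {α : Type*} [MetricSpace α] [MeasurableSpace α] (K : Set α) (ω : Measure α)
    (h : ℝ) (N : ℕ) (T : Finset α) where
  /-- The cells. -/
  cell : T → Set α
  /-- The nodes associated with a cell. -/
  nodes : T → Finset α
  /-- The mass transported between cells. -/
  θ : T → T → ℝ
  center_mem : (↑T : Set α) ⊆ K
  lt_dist : ∀ u v : T, u ≠ v → h < dist (u : α) v
  measurableSet_cell : ∀ v, MeasurableSet (cell v)
  disjoint_cell : Pairwise fun u v => Disjoint (cell u) (cell v)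
  iUnion_cell : ⋃ v, cell v = K
  dist_le_of_mem_cell : ∀ v, ∀ x ∈ cell v, dist x v ≤ h
  θ_nonneg : ∀ u v, 0 ≤ θ u v
  dist_le_of_θ : ∀ u v, θ u v ≠ 0 → dist (u : α) v ≤ 2 * h
  sum_θ_le : ∀ u, ∑ v, θ u v ≤ 1
  two_le : ∀ v, 2 ≤ N * ω.real (cell v)
  card_nodes : ∀ v, ((nodes v).card : ℝ) = N * ω.real (cell v) + ∑ u, θ u v - ∑ u, θ v u
  node_mem : ∀ v, ∀ x ∈ nodes v, x ∈ K
  dist_node_le : ∀ v, ∀ x ∈ nodes v, dist x v ≤ h / 4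

namespace CellPartition

variable {α : Type*} [MetricSpace α] [MeasurableSpace α] {K : Set α} {ω : Measure α} {h : ℝ}
  {N : ℕ} {T : Finset α}

/-- All nodes of a cell partition. -/
def allNodes (C : CellPartition K ω h N T) : Finset α := by
  classical
  exact Finset.univ.biUnion C.nodes

theorem mem_allNodes (C : CellPartition K ω h N T) {x : α} :
    x ∈ C.allNodes ↔ ∃ v, x ∈ C.nodes v := by
  simp [allNodes]

theorem lt_dist_of_ne (C : CellPartition K ω h N T) {u v : T} (huv : u ≠ v) {x y : α}
    (hx : x ∈ C.nodes u) (hy : y ∈ C.nodes v) : h / 2 < dist x y := by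
  have h1 := C.lt_dist u v huv
  have h2 := C.dist_node_le u x hx
  have h3 := C.dist_node_le v y hy
  have h4 := dist_triangle4 (u : α) x y v
  rw [dist_comm (u : α) x] at h4
  linarith

theorem sum_allNodes (C : CellPartition K ω h N T) (hh : 0 < h) (f : α → ℝ) :
    ∑ x ∈ C.allNodes, f x = ∑ v, ∑ x ∈ C.nodes v, f x := by
  classical
  unfold allNodes
  rw [Finset.sum_biUnion]
  intro u _ v _ huv
  refine Finset.disjoint_left.2 fun x hx hy => ?_
  have := C.lt_dist_of_ne huv hx hy
  rw [dist_self] at this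
  linarith

theorem card_le (C : CellPartition K ω h N T) (A B : Finset T) (hAB : A ⊆ B)
    (hB : ∀ v ∈ A, ∀ u : T, dist (u : α) v ≤ 2 * h → u ∈ B) :
    ∑ v ∈ A, ((C.nodes v).card : ℝ) ≤ 3 / 2 * ∑ u ∈ B, (N * ω.real (C.cell u)) := by
  have h1 : ∑ v ∈ A, ∑ u, C.θ u v ≤ ∑ u ∈ B, (1 : ℝ) := by
    rw [Finset.sum_comm]
    rw [← Finset.sum_subset (Finset.subset_univ B)]
    · exact Finset.sum_le_sum fun u _ => (Finset.sum_le_sum_of_subset_of_nonneg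
        (Finset.subset_univ A) fun v _ _ => C.θ_nonneg u v).trans (C.sum_θ_le u)
    · intro u _ hu
      refine Finset.sum_eq_zero fun v hv => ?_
      by_contra hne
      exact hu (hB v hv u (C.dist_le_of_θ u v hne))
  have h2 : ∑ u ∈ B, (1 : ℝ) ≤ 1 / 2 * ∑ u ∈ B, (N * ω.real (C.cell u)) := by
    rw [Finset.mul_sum]
    exact Finset.sum_le_sum fun u _ => by linarith [C.two_le u]
  have h3 : ∑ v ∈ A, (N * ω.real (C.cell v)) ≤ ∑ u ∈ B, (N * ω.real (C.cell u)) :=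
    Finset.sum_le_sum_of_subset_of_nonneg hAB fun u _ _ => by positivity
  calc ∑ v ∈ A, ((C.nodes v).card : ℝ)
      ≤ ∑ v ∈ A, (N * ω.real (C.cell v) + ∑ u, C.θ u v) := Finset.sum_le_sum fun v _ => by
        have : 0 ≤ ∑ u, C.θ v u := Finset.sum_nonneg fun u _ => C.θ_nonneg v u
        rw [C.card_nodes v]
        linarith
    _ ≤ _ := by
        rw [Finset.sum_add_distrib]
        linarith

theorem card_ge (C : CellPartition K ω h N T) (v : T) :
    N * ω.real (C.cell v) ≤ 2 * (C.nodes v).card ∧ (1 : ℝ) ≤ (C.nodes v).card := by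
  have h1 := C.card_nodes v
  have h2 := C.sum_θ_le v
  have h3 := C.two_le v
  have h4 : 0 ≤ ∑ u, C.θ u v := Finset.sum_nonneg fun u _ => C.θ_nonneg u v
  constructor <;> linarith

theorem sum_measure_cell (C : CellPartition K ω h N T) [IsFiniteMeasure ω] (A : Finset T) :
    ∑ v ∈ A, ω.real (C.cell v) = ω.real (⋃ v ∈ A, C.cell v) :=
  (measureReal_biUnion_finset (fun _ _ _ _ huv => C.disjoint_cell huv)
    (fun v _ => C.measurableSet_cell v)).symm

theorem card_allNodes (C : CellPartition K ω h N T) [IsProbabilityMeasure ω] (hh : 0 < h)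
    (hK : ω Kᶜ = 0) : C.allNodes.card = N := by
  have h1 := C.sum_allNodes hh fun _ => 1
  simp only [Finset.sum_const, nsmul_eq_mul, mul_one] at h1
  have h2 : ∑ v, ω.real (C.cell v) = 1 := by
    rw [C.sum_measure_cell Finset.univ]
    have hU : ⋃ v ∈ Finset.univ, C.cell v = K := by simpa using C.iUnion_cell
    have hKm : MeasurableSet K := by
      rw [← hU]
      exact Finset.measurableSet_biUnion _ fun v _ => C.measurableSet_cell v
    rw [hU, measureReal_def, (prob_compl_eq_zero_iff hKm).1 hK, ENNReal.toReal_one]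
  have h3 : ∑ v, ((C.nodes v).card : ℝ) = N := by
    simp only [C.card_nodes, Finset.sum_sub_distrib, Finset.sum_add_distrib]
    rw [Finset.sum_comm (f := fun v u => C.θ u v), ← Finset.mul_sum, h2]
    ring
  exact_mod_cast h1.trans h3

theorem card_filter_le (C : CellPartition K ω h N T) [IsFiniteMeasure ω] (hh : 0 < h)
    (y : α) (ρ : ℝ) : ((C.allNodes.filter fun x => dist x y ≤ ρ).card : ℝ)
      ≤ 2 * N * ω.real (Metric.closedBall y (ρ + 4 * h)) := by
  classical
  set A : Finset T := Finset.univ.filter fun v => dist (v : α) y ≤ ρ + h / 4 with hA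
  set B : Finset T := Finset.univ.filter fun v => dist (v : α) y ≤ ρ + h / 4 + 2 * h with hB
  have h1 := C.card_le A B (fun v hv => by
      simp only [hA, hB, Finset.mem_filter, Finset.mem_univ, true_and] at hv ⊢
      linarith) (fun v hv u hu => by
      simp only [hA, hB, Finset.mem_filter, Finset.mem_univ, true_and] at hv ⊢
      linarith [dist_triangle (u : α) v y])
  rw [← Finset.mul_sum, C.sum_measure_cell B] at h1
  have h2 : ω.real (⋃ v ∈ B, C.cell v) ≤ ω.real (Metric.closedBall y (ρ + 4 * h)) := by
    refine measureReal_mono (Set.iUnion₂_subset fun v hv x hx => ?_) (measure_ne_top _ _)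
    have h3 := C.dist_le_of_mem_cell v x hx
    simp only [hB, Finset.mem_filter, Finset.mem_univ, true_and] at hv
    rw [Metric.mem_closedBall]
    linarith [dist_triangle x v y]
  have h3 : (C.allNodes.filter fun x => dist x y ≤ ρ).card ≤ ∑ v ∈ A, (C.nodes v).card := by
    refine (Finset.card_le_card (t := A.biUnion C.nodes) fun x hx => ?_).trans
      Finset.card_biUnion_le
    obtain ⟨hx1, hx2⟩ := Finset.mem_filter.1 hx
    obtain ⟨v, hv⟩ := C.mem_allNodes.1 hx1
    refine Finset.mem_biUnion.2 ⟨v, ?_, hv⟩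
    simp only [hA, Finset.mem_filter, Finset.mem_univ, true_and]
    have h4 := C.dist_node_le v x hv
    linarith [dist_triangle_left (v : α) y x]
  have h4 : ((C.allNodes.filter fun x => dist x y ≤ ρ).card : ℝ)
      ≤ ∑ v ∈ A, ((C.nodes v).card : ℝ) := by exact_mod_cast h3
  have h5 : (N : ℝ) * ω.real (⋃ v ∈ B, C.cell v)
      ≤ N * ω.real (Metric.closedBall y (ρ + 4 * h)) := by gcongr
  have h6 : 0 ≤ (N : ℝ) * ω.real (Metric.closedBall y (ρ + 4 * h)) := by positivity
  linarith

theorem le_card_filter (C : CellPartition K ω h N T) [IsFiniteMeasure ω] (hh : 0 < h)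
    (hK : ω Kᶜ = 0) (y : α) (ρ : ℝ) : N * ω.real (Metric.closedBall y ρ)
      ≤ 2 * ((C.allNodes.filter fun x => dist x y ≤ ρ + 4 * h).card : ℝ) := by
  classical
  set A : Finset T := Finset.univ.filter fun v => dist (v : α) y ≤ ρ + h with hA
  have h1 : ω.real (Metric.closedBall y ρ) ≤ ω.real (⋃ v ∈ A, C.cell v) := by
    have h2 : ω (Metric.closedBall y ρ) ≤ ω ((⋃ v ∈ A, C.cell v) ∪ Kᶜ) := by
      refine measure_mono fun x hx => ?_
      by_cases hxK : x ∈ K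
      · rw [← C.iUnion_cell] at hxK
        obtain ⟨v, hv⟩ := Set.mem_iUnion.1 hxK
        refine Or.inl (Set.mem_iUnion₂.2 ⟨v, ?_, hv⟩)
        simp only [hA, Finset.mem_filter, Finset.mem_univ, true_and]
        have h3 := C.dist_le_of_mem_cell v x hv
        rw [Metric.mem_closedBall] at hx
        linarith [dist_triangle_left (v : α) y x]
      · exact Or.inr hxK
    have h3 := h2.trans (measure_union_le _ _)
    rw [hK, add_zero] at h3
    exact ENNReal.toReal_mono (measure_ne_top _ _) h3
  have h2 : ∑ v ∈ A, (C.nodes v).card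
      ≤ (C.allNodes.filter fun x => dist x y ≤ ρ + 4 * h).card := by
    rw [← Finset.card_biUnion]
    · refine Finset.card_le_card fun x hx => ?_
      obtain ⟨v, hvA, hv⟩ := Finset.mem_biUnion.1 hx
      simp only [hA, Finset.mem_filter, Finset.mem_univ, true_and] at hvA
      refine Finset.mem_filter.2 ⟨C.mem_allNodes.2 ⟨v, hv⟩, ?_⟩
      have h4 := C.dist_node_le v x hv
      linarith [dist_triangle x v y]
    · intro u _ v _ huv
      refine Finset.disjoint_left.2 fun x hx hy => ?_
      have := C.lt_dist_of_ne huv hx hy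
      rw [dist_self] at this
      linarith
  have h3 : (∑ v ∈ A, ((C.nodes v).card : ℝ))
      ≤ (C.allNodes.filter fun x => dist x y ≤ ρ + 4 * h).card := by exact_mod_cast h2
  calc N * ω.real (Metric.closedBall y ρ) ≤ N * ω.real (⋃ v ∈ A, C.cell v) := by gcongr
    _ = ∑ v ∈ A, (N * ω.real (C.cell v)) := by rw [← Finset.mul_sum, C.sum_measure_cell A]
    _ ≤ ∑ v ∈ A, 2 * ((C.nodes v).card : ℝ) := Finset.sum_le_sum fun v _ => (C.card_ge v).1
    _ ≤ _ := by rw [← Finset.mul_sum]; gcongr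

theorem abs_sub_sum_le (C : CellPartition K ω h N T) [IsFiniteMeasure ω] (hh : 0 < h)
    (hK : ω Kᶜ = 0) {f : α → ℝ} (hf : Integrable f ω) {b : α → ℝ}
    (hb : ∀ x ∈ C.allNodes, ∀ u ∈ K, ∀ v ∈ K, dist u x ≤ 3 * h → dist v x ≤ 3 * h →
      |f u - f v| ≤ b x) :
    |N * ∫ x, f x ∂ω - ∑ x ∈ C.allNodes, f x| ≤ 4 * ∑ x ∈ C.allNodes, b x := by
  rw [C.sum_allNodes hh, C.sum_allNodes hh]
  set c : T → ℝ := fun v => (C.nodes v).card with hc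
  have hc1 : ∀ v, 1 ≤ c v := fun v => (C.card_ge v).2
  set m : T → ℝ := fun v => (∑ x ∈ C.nodes v, b x) / c v with hm
  have hcm : ∀ v, c v * m v = ∑ x ∈ C.nodes v, b x := fun v =>
    mul_div_cancel₀ _ (by linarith [hc1 v])
  have hle : ∀ v : T, ∀ u ∈ K, dist u v ≤ 2 * h → |f u - f v| ≤ m v := fun v u hu huv => by
    rw [hm, le_div_iff₀ (by linarith [hc1 v]), mul_comm]
    have : ∑ _x ∈ C.nodes v, |f u - f v| ≤ ∑ x ∈ C.nodes v, b x :=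
      Finset.sum_le_sum fun x hx => by
        have h1 := C.dist_node_le v x hx
        refine hb x (C.mem_allNodes.2 ⟨v, hx⟩) u hu v (C.center_mem v.2) ?_ ?_
        · linarith [dist_triangle_right u x v]
        · rw [dist_comm]; linarith
    rwa [Finset.sum_const, nsmul_eq_mul] at this
  have hm0 : ∀ v, 0 ≤ m v := fun v => by
    have := hle v v (C.center_mem v.2) (by rw [dist_self]; linarith)
    exact (abs_nonneg _).trans this
  have hint : ∫ x, f x ∂ω = ∑ v, ∫ x in C.cell v, f x ∂ω := by
    rw [← integral_iUnion_fintype C.measurableSet_cell C.disjoint_cell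
      (fun v => hf.integrableOn), C.iUnion_cell, Measure.restrict_eq_self_of_ae_mem]
    exact hK
  have h1 : ∀ v, |∫ x in C.cell v, f x ∂ω - ω.real (C.cell v) * f v| ≤ ω.real (C.cell v) * m v := by
    intro v
    have h2 : ∫ x in C.cell v, f x ∂ω - ω.real (C.cell v) * f v
        = ∫ x in C.cell v, (f x - f v) ∂ω := by
      rw [integral_sub hf.integrableOn (integrable_const _), setIntegral_const, smul_eq_mul]
    rw [h2, mul_comm, ← Real.norm_eq_abs]
    refine norm_setIntegral_le_of_norm_le_const (measure_lt_top ω _) fun x hx => ?_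
    refine hle v x ?_ (by linarith [C.dist_le_of_mem_cell v x hx])
    rw [← C.iUnion_cell]
    exact Set.mem_iUnion.2 ⟨v, hx⟩
  have h2 : ∀ v : T, |c v * f v - ∑ x ∈ C.nodes v, f x| ≤ c v * m v := fun v => by
    have : c v * f v - ∑ x ∈ C.nodes v, f x = ∑ x ∈ C.nodes v, (f v - f x) := by
      rw [Finset.sum_sub_distrib, Finset.sum_const, nsmul_eq_mul]
    rw [this, hcm]
    refine (Finset.abs_sum_le_sum_abs _ _).trans (Finset.sum_le_sum fun x hx => ?_)
    have h1 := C.dist_node_le v x hx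
    refine hb x (C.mem_allNodes.2 ⟨v, hx⟩) v (C.center_mem v.2) x (C.node_mem v x hx) ?_ ?_
    · rw [dist_comm]; linarith
    · rw [dist_self]; linarith
  have h3 : ∀ v u, |C.θ v u * (f v - f u)| ≤ C.θ v u * m v := fun v u => by
    rw [abs_mul, abs_of_nonneg (C.θ_nonneg v u)]
    by_cases hz : C.θ v u = 0
    · simp [hz]
    · refine mul_le_mul_of_nonneg_left ?_ (C.θ_nonneg v u)
      rw [abs_sub_comm]
      exact hle v u (C.center_mem u.2) (by rw [dist_comm]; exact C.dist_le_of_θ v u hz)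
  have hsplit : N * ∫ x, f x ∂ω - ∑ v, ∑ x ∈ C.nodes v, f x
      = ∑ v, (N * (∫ x in C.cell v, f x ∂ω - ω.real (C.cell v) * f v)
        + ∑ u, C.θ v u * (f v - f u) + (c v * f v - ∑ x ∈ C.nodes v, f x)) := by
    have h4 : ∀ v, (N : ℝ) * (∫ x in C.cell v, f x ∂ω - ω.real (C.cell v) * f v)
        + ∑ u, C.θ v u * (f v - f u) + (c v * f v - ∑ x ∈ C.nodes v, f x)
        = N * (∫ x in C.cell v, f x ∂ω) - ∑ x ∈ C.nodes v, f x
          + (∑ u, C.θ u v * f v - ∑ u, C.θ v u * f u) := fun v => by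
      simp only [hc, C.card_nodes v, mul_sub, Finset.sum_sub_distrib, ← Finset.sum_mul]
      ring
    rw [Finset.sum_congr rfl fun v _ => h4 v, Finset.sum_add_distrib, Finset.sum_sub_distrib,
      Finset.sum_sub_distrib, Finset.sum_comm (f := fun v u => C.θ u v * f v), sub_self, add_zero,
      ← Finset.mul_sum, hint]
  rw [hsplit, Finset.mul_sum]
  refine (Finset.abs_sum_le_sum_abs _ _).trans (Finset.sum_le_sum fun v _ => ?_)
  have e1 : |(N : ℝ) * (∫ x in C.cell v, f x ∂ω - ω.real (C.cell v) * f v)|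
      ≤ N * ω.real (C.cell v) * m v := by
    rw [abs_mul, Nat.abs_cast, mul_assoc]
    exact mul_le_mul_of_nonneg_left (h1 v) (Nat.cast_nonneg _)
  have e2 : |∑ u, C.θ v u * (f v - f u)| ≤ 1 * m v := by
    refine (Finset.abs_sum_le_sum_abs _ _).trans ((Finset.sum_le_sum fun u _ => h3 v u).trans ?_)
    rw [← Finset.sum_mul]
    exact mul_le_mul_of_nonneg_right (C.sum_θ_le v) (hm0 v)
  have e3 : N * ω.real (C.cell v) * m v ≤ 2 * c v * m v :=
    mul_le_mul_of_nonneg_right (C.card_ge v).1 (hm0 v)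
  have e4 : 1 * m v ≤ c v * m v := mul_le_mul_of_nonneg_right (hc1 v) (hm0 v)
  rw [← hcm]
  refine (abs_add_three _ _ _).trans ?_
  linarith [h2 v]

end CellPartition

/-- Existence of a cell partition with separated nodes. -/
theorem exists_cellPartition {α : Type*} [MetricSpace α] [MeasurableSpace α] [BorelSpace α]
    {K : Set α} (hK : IsCompact K) (hKc : IsPreconnected K) {ω : Measure α}
    [IsProbabilityMeasure ω] (hω : ω Kᶜ = 0) {h s β : ℝ} (hh : 0 < h) (hs : 0 ≤ s) (hβ : 0 < β)
    {N : ℕ} (hN : ∀ y ∈ K, 2 ≤ N * ω.real (Metric.closedBall y (h / 4)))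
    (hβs : ∀ t ∈ K, ω.real (Metric.closedBall t s) ≤ β)
    (hβh : ∀ y ∈ K, 2 * N * ω.real (Metric.closedBall y (4 * h)) * β
      ≤ ω.real (Metric.closedBall y (h / 4))) :
    ∃ (T : Finset α) (C : CellPartition K ω h N T),
      ∀ x ∈ C.allNodes, ∀ y ∈ C.allNodes, x ≠ y → s ≤ dist x y := by
  classical
  have hKm : MeasurableSet K := hK.isClosed.measurableSet
  have hK1 : ω.real K = 1 := by
    rw [measureReal_def, (prob_compl_eq_zero_iff hKm).1 hω, ENNReal.toReal_one]
  have hKmem : ∀ᵐ x ∂ω, x ∈ K := hω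
  have hKne : K.Nonempty := by
    by_contra hcon
    rw [Set.not_nonempty_iff_eq_empty.1 hcon] at hK1
    simp at hK1
  have hinter : ∀ A : Set α, ω.real (K ∩ A) = ω.real A := fun A =>
    measureReal_congr (by
      filter_upwards [hKmem] with x hx
      exact propext ⟨fun h => h.2, fun h => ⟨hx, h⟩⟩)
  obtain ⟨T, hTK, hTsep, hTnet⟩ := exists_separated_net hK hh
  have hTne : T.Nonempty := by
    obtain ⟨x, hx⟩ := hKne
    obtain ⟨y, hy, -⟩ := hTnet x hx
    exact ⟨y, hy⟩
  obtain ⟨c, hcm, hcT, hc⟩ := exists_measurable_nearest hTne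
  set cell : T → Set α := fun v => K ∩ c ⁻¹' {(v : α)} with hcell
  have hcellm : ∀ v, MeasurableSet (cell v) := fun v => hKm.inter (hcm v)
  have hcelld : Pairwise fun u v => Disjoint (cell u) (cell v) := fun u v huv => by
    refine Set.disjoint_left.2 fun x hx hy => huv (Subtype.ext ?_)
    exact (show c x = u from hx.2).symm.trans (show c x = v from hy.2)
  have hcellU : ⋃ v, cell v = K := by
    refine Set.Subset.antisymm (Set.iUnion_subset fun v => Set.inter_subset_left) fun x hx => ?_
    exact Set.mem_iUnion.2 ⟨⟨c x, hcT x⟩, hx, rfl⟩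
  have hcelldist : ∀ v, ∀ x ∈ cell v, dist x v ≤ h := fun v x hx => by
    obtain ⟨y, hy, hxy⟩ := hTnet x hx.1
    have h1 := hc x y hy
    rw [show c x = v from hx.2] at h1
    exact h1.trans hxy
  have hsub : ∀ v : T, K ∩ Metric.closedBall (v : α) (h / 4) ⊆ cell v := fun v x hx => by
    refine ⟨hx.1, ?_⟩
    by_contra hne
    have h1 := hc x v v.2
    have h2 := hTsep _ (hcT x) v v.2 hne
    have h3 := Metric.mem_closedBall.1 hx.2
    linarith [dist_triangle_left (c x) v x]
  have hge : ∀ v : T, ω.real (Metric.closedBall (v : α) (h / 4)) ≤ ω.real (cell v) := fun v => by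
    rw [← hinter]
    exact measureReal_mono (hsub v) (measure_ne_top _ _)
  have htwo : ∀ v : T, 2 ≤ N * ω.real (cell v) := fun v =>
    (hN v (hTK v.2)).trans (mul_le_mul_of_nonneg_left (hge v) (Nat.cast_nonneg _))
  have : Nonempty T := hTne.to_subtype
  have hsum : ∑ v, N * ω.real (cell v) = N := by
    rw [← Finset.mul_sum, ← measureReal_biUnion_finset (fun _ _ _ _ huv => hcelld huv)
      (fun v _ => hcellm v)]
    simp [hcellU, hK1]
  obtain ⟨M, θ, hθ0, hθR, hθ1, hM⟩ := exists_rounding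
    (fun v u : T => dist (v : α) u ≤ 2 * h) (fun A hA hA' => by
      obtain ⟨v, hv, u, hu, huv⟩ := exists_adjacent_of_net hKc hTK hh.le hTnet A hA hA'
      exact ⟨v, hv, u, hu, huv⟩) (fun v => by linarith [htwo v]) hsum
  have hMle : ∀ v : T, (M v : ℝ) ≤ 2 * N * ω.real (Metric.closedBall (v : α) (4 * h)) := fun v => by
    set Bv : Finset T := Finset.univ.filter fun u => dist (u : α) v ≤ 2 * h with hBv
    have h1 : ∑ u, θ u v ≤ ∑ u ∈ Bv, (1 : ℝ) := by
      rw [← Finset.sum_subset (Finset.subset_univ Bv)]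
      · exact Finset.sum_le_sum fun u _ =>
          (Finset.single_le_sum (fun v _ => hθ0 u v) (Finset.mem_univ v)).trans (hθ1 u)
      · intro u _ hu
        by_contra hne
        exact hu (Finset.mem_filter.2 ⟨Finset.mem_univ _, hθR u v hne⟩)
    have h2 : ∑ u ∈ Bv, (1 : ℝ) ≤ 1 / 2 * ∑ u ∈ Bv, (N * ω.real (cell u)) := by
      rw [Finset.mul_sum]
      exact Finset.sum_le_sum fun u _ => by linarith [htwo u]
    have h3 : N * ω.real (cell v) ≤ ∑ u ∈ Bv, (N * ω.real (cell u)) :=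
      Finset.single_le_sum (f := fun u => N * ω.real (cell u)) (fun u _ => by positivity)
        (Finset.mem_filter.2 ⟨Finset.mem_univ _, by rw [dist_self]; linarith⟩)
    have h4 : ∑ u ∈ Bv, (N * ω.real (cell u))
        ≤ N * ω.real (Metric.closedBall (v : α) (4 * h)) := by
      rw [← Finset.mul_sum, ← measureReal_biUnion_finset (fun _ _ _ _ huv => hcelld huv)
        (fun v _ => hcellm v)]
      refine mul_le_mul_of_nonneg_left (measureReal_mono
        (Set.iUnion₂_subset fun u hu x hx => ?_) (measure_ne_top _ _)) (Nat.cast_nonneg _)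
      have h5 := hcelldist u x hx
      have h6 := (Finset.mem_filter.1 hu).2
      rw [Metric.mem_closedBall]
      linarith [dist_triangle x u v]
    have h5 : 0 ≤ ∑ u, θ v u := Finset.sum_nonneg fun u _ => hθ0 v u
    have h6 : 0 ≤ N * ω.real (Metric.closedBall (v : α) (4 * h)) := by positivity
    rw [hM v]
    linarith
  have hnodes : ∀ v : T, ∃ F : Finset α, F.card = M v ∧
      (↑F : Set α) ⊆ K ∩ Metric.closedBall (v : α) (h / 4) ∧
      ∀ x ∈ F, ∀ y ∈ F, x ≠ y → s < dist x y := fun v => by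
    refine exists_separated_finset hs hβ (fun t ht => hβs t ht.1) (M v) ?_
    rw [hinter]
    exact (mul_le_mul_of_nonneg_right (hMle v) hβ.le).trans (hβh v (hTK v.2))
  choose F hFc hFK hFsep using hnodes
  have hsh : s ≤ h / 2 := by
    by_contra! hcon
    obtain ⟨y, hy⟩ := hKne
    have h1 : ω.real (Metric.closedBall y (h / 4)) ≤ β :=
      (measureReal_mono (Metric.closedBall_subset_closedBall (by linarith))
        (measure_ne_top _ _)).trans (hβs y hy)
    have h2 : ω.real (Metric.closedBall y (h / 4)) ≤ ω.real (Metric.closedBall y (4 * h)) :=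
      measureReal_mono (Metric.closedBall_subset_closedBall (by linarith)) (measure_ne_top _ _)
    have h3 := hN y hy
    have h4 : (2 : ℝ) ≤ N * ω.real (Metric.closedBall y (4 * h)) :=
      h3.trans (mul_le_mul_of_nonneg_left h2 (Nat.cast_nonneg _))
    have h5 := hβh y hy
    nlinarith
  let C : CellPartition K ω h N T :=
    { cell := cell
      nodes := F
      θ := θ
      center_mem := hTK
      lt_dist := fun u v huv => hTsep u u.2 v v.2 fun h => huv (Subtype.ext h)
      measurableSet_cell := hcellm
      disjoint_cell := hcelld
      iUnion_cell := hcellU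
      dist_le_of_mem_cell := hcelldist
      θ_nonneg := hθ0
      dist_le_of_θ := hθR
      sum_θ_le := hθ1
      two_le := htwo
      card_nodes := fun v => by rw [hFc]; exact hM v
      node_mem := fun v x hx => (hFK v hx).1
      dist_node_le := fun v x hx => (hFK v hx).2 }
  refine ⟨T, C, fun x hx y hy hxy => ?_⟩
  obtain ⟨u, hu⟩ := C.mem_allNodes.1 hx
  obtain ⟨v, hv⟩ := C.mem_allNodes.1 hy
  by_cases huv : u = v
  · subst huv
    exact (hFsep u x hu y hv hxy).le
  · exact hsh.trans (C.lt_dist_of_ne huv hu hv).le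

/-! ### The surface measure of small caps -/

theorem norm_radialProj_sub_le {a b : EuclideanSpace ℝ (Fin d)} (ha : 1 ≤ ‖a‖) (hb : 1 ≤ ‖b‖) :
    ‖radialProj a - radialProj b‖ ≤ 2 * ‖a - b‖ := by
  have h1 : radialProj a - radialProj b
      = ‖a‖⁻¹ • (a - b) + (‖a‖⁻¹ * (‖b‖ - ‖a‖)) • radialProj b := by
    have h2 : ‖b‖⁻¹ = ‖a‖⁻¹ - ‖a‖⁻¹ * (‖b‖ - ‖a‖) * ‖b‖⁻¹ := by
      field_simp
      ring
    have h3 : radialProj b = (‖a‖⁻¹ - ‖a‖⁻¹ * (‖b‖ - ‖a‖) * ‖b‖⁻¹) • b := by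
      rw [← h2, radialProj]
    rw [h3]
    simp only [radialProj]
    have h4 : ‖a‖⁻¹ * (‖b‖ - ‖a‖) * (‖a‖⁻¹ - ‖a‖⁻¹ * (‖b‖ - ‖a‖) * ‖b‖⁻¹)
        = ‖a‖⁻¹ * (‖b‖ - ‖a‖) * ‖b‖⁻¹ := by rw [← h2]
    rw [smul_smul, h4]
    module
  have hb1 : ‖radialProj b‖ = 1 := by
    rw [radialProj, norm_smul, norm_inv, norm_norm, inv_mul_cancel₀ (by linarith)]
  have ha1 : ‖a‖⁻¹ ≤ 1 := inv_le_one_of_one_le₀ ha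
  have ha0 : 0 ≤ ‖a‖⁻¹ := by positivity
  have h5 : |‖b‖ - ‖a‖| ≤ ‖a - b‖ := by
    rw [abs_sub_comm]
    exact abs_norm_sub_norm_le a b
  rw [h1]
  refine (norm_add_le _ _).trans ?_
  rw [norm_smul, norm_smul, hb1, mul_one, norm_inv, norm_norm, norm_mul, norm_inv, norm_norm,
    Real.norm_eq_abs]
  have h6 : ‖a‖⁻¹ * |‖b‖ - ‖a‖| ≤ 1 * ‖a - b‖ := by gcongr
  have h7 : ‖a‖⁻¹ * ‖a - b‖ ≤ 1 * ‖a - b‖ := by gcongr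
  linarith

/-- The `(d-1)`-dimensional measure of the part of the sphere within distance `s ≤ 1` of one of its
points is `O(s ^ (d - 1))`. -/
theorem exists_sphMeasure_closedBall_le (hd : 2 ≤ d) : ∃ C : ℝ, 0 < C ∧
    ∀ x ∈ unitSphere d, ∀ s : ℝ, 0 ≤ s → s ≤ 1 →
      sphMeasure d (Metric.closedBall x s) ≤ ENNReal.ofReal (C * s ^ (d - 1)) := by
  obtain ⟨m, rfl⟩ : ∃ m, d = m + 1 := ⟨d - 1, by omega⟩
  have : Fact (Module.finrank ℝ (EuclideanSpace ℝ (Fin (m + 1))) = m + 1) := ⟨by simp⟩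
  set μ : Measure (EuclideanSpace ℝ (Fin m)) := Measure.hausdorffMeasure
    (Module.finrank ℝ (EuclideanSpace ℝ (Fin m))) with hμ
  have hmE : (Module.finrank ℝ (EuclideanSpace ℝ (Fin m))) = m := by simp
  set V := μ.real (Metric.ball 0 1) with hV
  have hV0 : 0 ≤ V := measureReal_nonneg
  have hVE : μ (Metric.ball 0 1) = ENNReal.ofReal V :=
    (ofReal_measureReal (Metric.isBounded_ball.measure_lt_top.ne)).symm
  refine ⟨4 ^ m * V + 1, by positivity, fun x hx s hs hs1 => ?_⟩
  rw [mem_unitSphere] at hx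
  have hx0 : x ≠ 0 := fun h => by simp [h] at hx
  set e := (OrthonormalBasis.fromOrthogonalSpanSingleton (𝕜 := ℝ) m hx0).repr with he
  set f : EuclideanSpace ℝ (Fin m) → EuclideanSpace ℝ (Fin (m + 1)) :=
    fun t => radialProj (x + (e.symm t : EuclideanSpace ℝ (Fin (m + 1)))) with hf
  have horth : ∀ t, ⟪(e.symm t : EuclideanSpace ℝ (Fin (m + 1))), x⟫_ℝ = 0 := fun t => by
    rw [real_inner_comm]
    exact Submodule.mem_orthogonal_singleton_iff_inner_right.1 (e.symm t).2
  have hlip : LipschitzWith 2 f := LipschitzWith.of_dist_le_mul fun t u => by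
    rw [dist_eq_norm, dist_eq_norm]
    refine (norm_radialProj_sub_le (one_le_norm_add_of_tangent hx (horth t))
      (one_le_norm_add_of_tangent hx (horth u))).trans (le_of_eq ?_)
    have hnorm : ‖(e.symm (t - u) : EuclideanSpace ℝ (Fin (m + 1)))‖ = ‖t - u‖ :=
      e.symm.norm_map (t - u)
    rw [add_sub_add_left_eq_sub, ← Submodule.coe_sub, ← map_sub, hnorm]
    simp
  have hsub : Metric.closedBall x s ∩ unitSphere (m + 1) ⊆ f '' Metric.closedBall 0 (2 * s) := by
    rintro y ⟨hyx, hy⟩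
    rw [mem_unitSphere] at hy
    rw [Metric.mem_closedBall, dist_eq_norm] at hyx
    set t := ⟪x, y⟫_ℝ with ht
    have ht1 : ‖y - x‖ ^ 2 = 2 - 2 * t := by
      rw [norm_sub_sq_real, hx, hy, real_inner_comm]
      ring
    have ht2 : ‖y - x‖ ^ 2 ≤ s ^ 2 := by gcongr
    have ht3 : 1 / 2 ≤ t := by nlinarith
    have ht0 : t ≠ 0 := by linarith
    set u := t⁻¹ • y - x with hu
    have hux : u ∈ (ℝ ∙ x)ᗮ := by
      rw [Submodule.mem_orthogonal_singleton_iff_inner_right, hu, inner_sub_right, inner_smul_right,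
        ← ht, real_inner_self_eq_norm_sq, hx, inv_mul_cancel₀ ht0]
      norm_num
    have hunorm : ‖u‖ ^ 2 = (t⁻¹) ^ 2 - 1 := by
      rw [hu, norm_sub_sq_real, norm_smul, hy, hx, inner_smul_left, real_inner_comm, ← ht]
      simp only [norm_inv, Real.norm_eq_abs, mul_one, one_pow, inv_pow, sq_abs, conj_trivial]
      rw [inv_mul_cancel₀ ht0]
      ring
    have hti : t⁻¹ ≤ 2 := by
      rw [inv_le_comm₀ (by linarith) (by norm_num)]
      linarith
    have hti0 : 0 < t⁻¹ := by
      have : 0 < t := by linarith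
      positivity
    have htle : t ≤ 1 := by nlinarith [sq_nonneg ‖y - x‖]
    have hun : ‖u‖ ≤ 2 * s := by
      refine le_of_sq_le_sq ?_ (by positivity)
      have h1 : (t⁻¹) ^ 2 - 1 = (t⁻¹) ^ 2 * ((1 - t) * (1 + t)) := by
        field_simp
        ring
      rw [hunorm, h1]
      have h2 : (1 - t) * (1 + t) ≤ s ^ 2 := by nlinarith
      have h3 : (t⁻¹) ^ 2 ≤ 2 ^ 2 := by gcongr
      have h4 : 0 ≤ (1 - t) * (1 + t) := mul_nonneg (by linarith) (by linarith)
      calc (t⁻¹) ^ 2 * ((1 - t) * (1 + t)) ≤ 2 ^ 2 * s ^ 2 := by gcongr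
        _ = _ := by ring
    refine ⟨e ⟨u, hux⟩, ?_, ?_⟩
    · rw [mem_closedBall_zero_iff, LinearIsometryEquiv.norm_map]
      exact hun
    · simp only [hf, LinearIsometryEquiv.symm_apply_apply]
      rw [hu, add_sub_cancel, radialProj, norm_smul, hy, mul_one, smul_smul, Real.norm_eq_abs,
        abs_of_pos hti0, inv_mul_cancel₀ hti0.ne', one_smul]
  have hdim : (((m + 1 : ℕ) : ℝ) - 1) = (Module.finrank ℝ (EuclideanSpace ℝ (Fin m)) : ℝ) := by
    rw [hmE]
    push_cast
    ring
  calc sphMeasure (m + 1) (Metric.closedBall x s)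
      = Measure.hausdorffMeasure (((m + 1 : ℕ) : ℝ) - 1)
          (Metric.closedBall x s ∩ unitSphere (m + 1)) := by
        rw [sphMeasure, Measure.restrict_apply Metric.isClosed_closedBall.measurableSet]
    _ ≤ Measure.hausdorffMeasure (((m + 1 : ℕ) : ℝ) - 1) (f '' Metric.closedBall 0 (2 * s)) :=
        measure_mono hsub
    _ ≤ (2 : ENNReal) ^ (m : ℝ) * μ (Metric.closedBall 0 (2 * s)) := by
        rw [hdim]
        refine (hlip.hausdorffMeasure_image_le (Nat.cast_nonneg _) _).trans (le_of_eq ?_)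
        rw [hμ, hmE]
        simp
    _ = ENNReal.ofReal (4 ^ m * V * s ^ m) := by
        rw [Measure.addHaar_closedBall μ _ (by positivity), hVE, hmE, ENNReal.rpow_natCast,
          show (2 : ENNReal) = ENNReal.ofReal 2 by simp, ← ENNReal.ofReal_pow (by norm_num),
          ← ENNReal.ofReal_mul (by positivity), ← ENNReal.ofReal_mul (by positivity)]
        congr 1
        rw [show (4 : ℝ) = 2 * 2 by norm_num, mul_pow, mul_pow]
        ring
    _ ≤ ENNReal.ofReal ((4 ^ m * V + 1) * s ^ (m + 1 - 1)) := by
        refine ENNReal.ofReal_le_ofReal ?_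
        rw [Nat.add_sub_cancel]
        have : 0 ≤ s ^ m := by positivity
        linarith

/-! ### Doubling measures -/

theorem measure_closedBall_two_pow_mul_le {α : Type*} [MetricSpace α] [MeasurableSpace α]
    {ω : Measure α} {Λ : ℝ} (hΛ : 0 ≤ Λ) {x : α} (hdbl : ∀ r : ℝ, 0 < r →
      ω.real (Metric.closedBall x (2 * r)) ≤ Λ * ω.real (Metric.closedBall x r))
    (k : ℕ) {r : ℝ} (hr : 0 < r) :
    ω.real (Metric.closedBall x (2 ^ k * r)) ≤ Λ ^ k * ω.real (Metric.closedBall x r) := by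
  induction k with
  | zero => simp
  | succ k ih =>
    rw [pow_succ', mul_assoc, pow_succ', mul_assoc]
    exact (hdbl _ (by positivity)).trans (mul_le_mul_of_nonneg_left ih hΛ)

theorem measure_closedBall_mul_le {α : Type*} [MetricSpace α] [MeasurableSpace α]
    {ω : Measure α} [IsFiniteMeasure ω] {Λ : ℝ} (hΛ : 0 ≤ Λ) {s : ℕ} (hs : Λ ≤ 2 ^ s) {x : α}
    (hdbl : ∀ r : ℝ, 0 < r →
      ω.real (Metric.closedBall x (2 * r)) ≤ Λ * ω.real (Metric.closedBall x r))
    {t r : ℝ} (ht : 1 ≤ t) (hr : 0 < r) :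
    ω.real (Metric.closedBall x (t * r)) ≤ Λ * t ^ s * ω.real (Metric.closedBall x r) := by
  obtain ⟨k, hk1, hk2⟩ := exists_nat_pow_near ht (one_lt_two (α := ℝ))
  calc ω.real (Metric.closedBall x (t * r)) ≤ ω.real (Metric.closedBall x (2 ^ (k + 1) * r)) :=
        measureReal_mono (Metric.closedBall_subset_closedBall (by gcongr)) (measure_ne_top _ _)
    _ ≤ Λ ^ (k + 1) * ω.real (Metric.closedBall x r) :=
        measure_closedBall_two_pow_mul_le hΛ hdbl _ hr
    _ ≤ Λ * t ^ s * ω.real (Metric.closedBall x r) := by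
        refine mul_le_mul_of_nonneg_right ?_ measureReal_nonneg
        rw [pow_succ']
        refine mul_le_mul_of_nonneg_left ?_ hΛ
        calc Λ ^ k ≤ (2 ^ s) ^ k := by gcongr
          _ = (2 ^ k) ^ s := by rw [← pow_mul, ← pow_mul, mul_comm]
          _ ≤ t ^ s := by gcongr

/-! ### Chordal and geodesic distances -/

theorem norm_sub_eq_two_mul_sin {x y : EuclideanSpace ℝ (Fin d)} (hx : ‖x‖ = 1) (hy : ‖y‖ = 1) :
    ‖x - y‖ = 2 * sin (gdist x y / 2) := by
  have hle : |⟪x, y⟫_ℝ| ≤ 1 := by simpa [hx, hy] using abs_real_inner_le_norm x y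
  have hcos : cos (gdist x y) = ⟪x, y⟫_ℝ := cos_arccos (abs_le.1 hle).1 (abs_le.1 hle).2
  have h0 : 0 ≤ gdist x y := arccos_nonneg _
  have hπ : gdist x y ≤ π := arccos_le_pi _
  have hsin : 0 ≤ sin (gdist x y / 2) := sin_nonneg_of_nonneg_of_le_pi (by linarith) (by linarith)
  have h2 : cos (gdist x y) = 1 - 2 * sin (gdist x y / 2) ^ 2 := by
    have := cos_two_mul (gdist x y / 2)
    rw [mul_div_cancel₀ _ two_ne_zero] at this
    rw [this, cos_sq']
    ring
  refine (sq_eq_sq₀ (norm_nonneg _) (by positivity)).1 ?_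
  rw [norm_sub_sq_real, hx, hy, ← hcos, h2]
  ring

theorem norm_sub_le_gdist {x y : EuclideanSpace ℝ (Fin d)} (hx : ‖x‖ = 1) (hy : ‖y‖ = 1) :
    ‖x - y‖ ≤ gdist x y := by
  have h0 : 0 ≤ gdist x y := arccos_nonneg _
  have := sin_le (x := gdist x y / 2) (by linarith)
  rw [norm_sub_eq_two_mul_sin hx hy]
  linarith

theorem gdist_le_two_mul_norm_sub {x y : EuclideanSpace ℝ (Fin d)} (hx : ‖x‖ = 1) (hy : ‖y‖ = 1) :
    gdist x y ≤ 2 * ‖x - y‖ := by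
  have h0 : 0 ≤ gdist x y := arccos_nonneg _
  have hπ : gdist x y ≤ π := arccos_le_pi _
  have h1 := mul_le_sin (x := gdist x y / 2) (by linarith) (by linarith)
  have h2 : 1 / 2 * (gdist x y / 2) ≤ 2 / π * (gdist x y / 2) := by
    refine mul_le_mul_of_nonneg_right ?_ (by linarith)
    rw [div_le_div_iff₀ two_pos pi_pos]
    linarith [pi_le_four]
  rw [norm_sub_eq_two_mul_sin hx hy]
  linarith

theorem measurableSet_cap (x : EuclideanSpace ℝ (Fin d)) (r : ℝ) : MeasurableSet (cap x r) := by
  have h1 : Continuous fun y => gdist x y :=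
    continuous_arccos.comp (continuous_const.inner continuous_id)
  exact (Metric.isClosed_sphere.inter (isClosed_le h1 continuous_const)).measurableSet

theorem cap_subset_closedBall {x : EuclideanSpace ℝ (Fin d)} (hx : x ∈ unitSphere d) (r : ℝ) :
    cap x r ⊆ Metric.closedBall x r := fun y hy => by
  rw [Metric.mem_closedBall, dist_comm, dist_eq_norm]
  exact (norm_sub_le_gdist (mem_unitSphere.1 hx) (mem_unitSphere.1 hy.1)).trans hy.2

theorem closedBall_inter_subset_cap {x : EuclideanSpace ℝ (Fin d)} (hx : x ∈ unitSphere d) (r : ℝ) :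
    unitSphere d ∩ Metric.closedBall x r ⊆ cap x (2 * r) := fun y hy => by
  refine ⟨hy.1, (gdist_le_two_mul_norm_sub (mem_unitSphere.1 hx) (mem_unitSphere.1 hy.1)).trans ?_⟩
  have := Metric.mem_closedBall.1 hy.2
  rw [dist_comm, dist_eq_norm] at this
  linarith

/-! ### The measure of a weight -/

/-- The measure with density `w` on the sphere. -/
def weightMeasure (w : EuclideanSpace ℝ (Fin d) → ℝ) : Measure (EuclideanSpace ℝ (Fin d)) :=
  (sphMeasure d).withDensity fun x => ENNReal.ofReal (w x)

theorem measurableSet_unitSphere : MeasurableSet (unitSphere d) :=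
  Metric.isClosed_sphere.measurableSet

theorem weightMeasure_compl (w : EuclideanSpace ℝ (Fin d) → ℝ) :
    weightMeasure w (unitSphere d)ᶜ = 0 := by
  refine withDensity_absolutelyContinuous _ _ ?_
  rw [sphMeasure, Measure.restrict_apply measurableSet_unitSphere.compl]
  simp

theorem weightMeasure_real {w : EuclideanSpace ℝ (Fin d) → ℝ} (hw : ∀ x, 0 ≤ w x)
    (hint : Integrable w (sphMeasure d)) {A : Set (EuclideanSpace ℝ (Fin d))}
    (hA : MeasurableSet A) : (weightMeasure w).real A = wMass w A := by
  rw [measureReal_def, weightMeasure, withDensity_apply _ hA, wMass,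
    integral_eq_lintegral_of_nonneg_ae (Filter.Eventually.of_forall hw)
      hint.aestronglyMeasurable.restrict]

theorem isProbabilityMeasure_weightMeasure {w : EuclideanSpace ℝ (Fin d) → ℝ} (hw : ∀ x, 0 ≤ w x)
    (hint : Integrable w (sphMeasure d)) (h1 : wMass w (unitSphere d) = 1) :
    IsProbabilityMeasure (weightMeasure w) := by
  have h2 : (weightMeasure w).real (unitSphere d) = 1 := by
    rw [weightMeasure_real hw hint measurableSet_unitSphere, h1]
  have h3 : weightMeasure w (unitSphere d) = 1 := by
    rw [measureReal_def] at h2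
    exact (ENNReal.toReal_eq_one_iff _).1 h2
  refine ⟨?_⟩
  rw [← measure_add_measure_compl measurableSet_unitSphere, h3, weightMeasure_compl, add_zero]

theorem integral_weightMeasure {w : EuclideanSpace ℝ (Fin d) → ℝ} (hw : ∀ x, 0 ≤ w x)
    (hint : Integrable w (sphMeasure d)) (f : EuclideanSpace ℝ (Fin d) → ℝ) :
    ∫ x, f x ∂(weightMeasure w) = ∫ x, f x * w x ∂(sphMeasure d) := by
  rw [weightMeasure, integral_withDensity_eq_integral_toReal_smul₀
    hint.aestronglyMeasurable.aemeasurable.ennreal_ofReal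
    (Filter.Eventually.of_forall fun _ => ENNReal.ofReal_lt_top)]
  refine integral_congr_ae (Filter.Eventually.of_forall fun x => ?_)
  simp only [ENNReal.toReal_ofReal (hw x), smul_eq_mul, mul_comm]

theorem weightMeasure_closedBall_le {w : EuclideanSpace ℝ (Fin d) → ℝ} (hw : ∀ x, 0 ≤ w x)
    (hint : Integrable w (sphMeasure d)) (h1 : wMass w (unitSphere d) = 1)
    {x : EuclideanSpace ℝ (Fin d)} (hx : x ∈ unitSphere d) (r : ℝ) :
    (weightMeasure w).real (Metric.closedBall x r) ≤ wMass w (cap x (2 * r)) := by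
  have := isProbabilityMeasure_weightMeasure hw hint h1
  rw [← weightMeasure_real hw hint (measurableSet_cap _ _)]
  have h2 : (weightMeasure w).real (Metric.closedBall x r)
      = (weightMeasure w).real (unitSphere d ∩ Metric.closedBall x r) := by
    have hae : ∀ᵐ y ∂(weightMeasure w), y ∈ unitSphere d := weightMeasure_compl w
    refine measureReal_congr ?_
    filter_upwards [hae] with y hy
    exact propext ⟨fun h => ⟨hy, h⟩, fun h => h.2⟩
  rw [h2]
  exact measureReal_mono (closedBall_inter_subset_cap hx r) (measure_ne_top _ _)

theorem wMass_cap_le {w : EuclideanSpace ℝ (Fin d) → ℝ} (hw : ∀ x, 0 ≤ w x)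
    (hint : Integrable w (sphMeasure d)) (h1 : wMass w (unitSphere d) = 1)
    {x : EuclideanSpace ℝ (Fin d)} (hx : x ∈ unitSphere d) (r : ℝ) :
    wMass w (cap x r) ≤ (weightMeasure w).real (Metric.closedBall x r) := by
  have := isProbabilityMeasure_weightMeasure hw hint h1
  rw [← weightMeasure_real hw hint (measurableSet_cap _ _)]
  exact measureReal_mono (cap_subset_closedBall hx r) (measure_ne_top _ _)

theorem weightMeasure_doubling {w : EuclideanSpace ℝ (Fin d) → ℝ} (hw : ∀ x, 0 ≤ w x)
    (hint : Integrable w (sphMeasure d)) (h1 : wMass w (unitSphere d) = 1) {L : ℝ}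
    {x : EuclideanSpace ℝ (Fin d)} (hx : x ∈ unitSphere d)
    (hdbl : ∀ r : ℝ, 0 < r → wMass w (cap x (2 * r)) ≤ L * wMass w (cap x r)) {r : ℝ}
    (hr : 0 < r) : (weightMeasure w).real (Metric.closedBall x (2 * r))
      ≤ max L 1 ^ 2 * (weightMeasure w).real (Metric.closedBall x r) := by
  have hpos : ∀ r, 0 ≤ wMass w (cap x r) := fun r => by
    rw [← weightMeasure_real hw hint (measurableSet_cap _ _)]
    exact measureReal_nonneg
  have hstep : ∀ r : ℝ, 0 < r → wMass w (cap x (2 * r)) ≤ max L 1 * wMass w (cap x r) :=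
    fun r hr => (hdbl r hr).trans (mul_le_mul_of_nonneg_right (le_max_left _ _) (hpos r))
  have hM : 0 ≤ max L 1 := zero_le_one.trans (le_max_right _ _)
  calc (weightMeasure w).real (Metric.closedBall x (2 * r)) ≤ wMass w (cap x (2 * (2 * r))) :=
        weightMeasure_closedBall_le hw hint h1 hx _
    _ ≤ max L 1 * wMass w (cap x (2 * r)) := hstep _ (by positivity)
    _ ≤ max L 1 * (max L 1 * wMass w (cap x r)) := by gcongr; exact hstep r hr
    _ = max L 1 ^ 2 * wMass w (cap x r) := by ring
    _ ≤ _ := by gcongr; exact wMass_cap_le hw hint h1 hx r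

theorem weightMeasure_closedBall_le_of_bound {w : EuclideanSpace ℝ (Fin d) → ℝ} {B C s : ℝ}
    (hB : 0 ≤ B) (hCs : 0 ≤ C * s ^ (d - 1)) (hwB : ∀ᵐ x ∂(sphMeasure d), w x ≤ B)
    {x : EuclideanSpace ℝ (Fin d)}
    (hσ : sphMeasure d (Metric.closedBall x s) ≤ ENNReal.ofReal (C * s ^ (d - 1))) :
    (weightMeasure w).real (Metric.closedBall x s) ≤ B * (C * s ^ (d - 1)) := by
  refine ENNReal.toReal_le_of_le_ofReal (by positivity) ?_
  rw [weightMeasure, withDensity_apply _ Metric.isClosed_closedBall.measurableSet,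
    ENNReal.ofReal_mul hB]
  calc ∫⁻ y in Metric.closedBall x s, ENNReal.ofReal (w y) ∂(sphMeasure d)
      ≤ ∫⁻ _ in Metric.closedBall x s, ENNReal.ofReal B ∂(sphMeasure d) :=
        lintegral_mono_ae (by
          filter_upwards [ae_restrict_of_ae hwB] with y hy
          exact ENNReal.ofReal_le_ofReal hy)
    _ = ENNReal.ofReal B * sphMeasure d (Metric.closedBall x s) := by
        rw [setLIntegral_const]
    _ ≤ _ := by gcongr

/-! ### The main theorem -/

/-- Transfer of the doubling property from a measure to the counting measures of perturbations of
its quantization. -/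
theorem countDoubling_of_quantization {ω : Measure (EuclideanSpace ℝ (Fin d))} [IsFiniteMeasure ω]
    {Λ : ℝ} (hΛ : 0 ≤ Λ) {s : ℕ} (hs : Λ ≤ 2 ^ s)
    (hdbl : ∀ x ∈ unitSphere d, ∀ r : ℝ, 0 < r →
      ω.real (Metric.closedBall x (2 * r)) ≤ Λ * ω.real (Metric.closedBall x r))
    {n N : ℕ} (hn : 0 < n) {X Y : Fin N → EuclideanSpace ℝ (Fin d)} {c h : ℝ} (hc0 : 0 < c)
    (hc1 : c ≤ 1 / 2) (hh : 4 * h ≤ c / 4 / n)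
    (hX1 : ∀ y ρ, (ballCount X y ρ : ℝ) ≤ 2 * N * ω.real (Metric.closedBall y (ρ + 4 * h)))
    (hX2 : ∀ y ρ, N * ω.real (Metric.closedBall y ρ) ≤ 2 * (ballCount X y (ρ + 4 * h) : ℝ))
    (hXY : ∀ i, ‖Y i - X i‖ ≤ c / 4 / n) :
    CountDoubling Y n s c (4 * (Λ * (4 / c) ^ s)) := by
  intro y hy R hR
  have hn0 : (0 : ℝ) < n := Nat.cast_pos.2 hn
  have hle : ∀ {U W : Fin N → EuclideanSpace ℝ (Fin d)} {ρ ρ' : ℝ}, (∀ i, ‖U i - W i‖ ≤ c / 4 / n) →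
      ρ + c / 4 / n ≤ ρ' → ballCount W y ρ ≤ ballCount U y ρ' := fun {U W ρ ρ'} hUW hρ =>
    Finset.card_le_card fun i hi => by
      simp only [Finset.mem_filter, Finset.mem_univ, true_and] at hi ⊢
      have := norm_sub_le_norm_sub_add_norm_sub (U i) (W i) y
      linarith [hUW i]
  have hq : c / 4 / n = c / 4 * (1 / n) := by ring
  have hn1 : (0 : ℝ) < 1 / n := by positivity
  have h1 : (ballCount Y y (R + 1 / n) : ℝ) ≤ ballCount X y (R + 1 / n + c / 4 / n) := by
    exact_mod_cast hle (fun i => by rw [norm_sub_rev]; exact hXY i) le_rfl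
  have h2 : (ballCount X y (c / (2 * n) + 4 * h) : ℝ) ≤ ballCount Y y (c / n) := by
    have h3 : c / (2 * n) + 4 * h + c / 4 / n ≤ c / n := by
      have : c / (2 * n) + c / 4 / n + c / 4 / n = c / n := by field_simp; ring
      linarith
    exact_mod_cast hle hXY h3
  have h3 : ω.real (Metric.closedBall y (R + 1 / n + c / 4 / n + 4 * h))
      ≤ Λ * (4 / c * (1 + n * R)) ^ s * ω.real (Metric.closedBall y (c / (2 * n))) := by
    have ht : 1 ≤ 4 / c * (1 + n * R) := by
      have h4 : 1 ≤ 4 / c := by rw [le_div_iff₀ hc0]; linarith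
      have h5 : 1 ≤ 1 + n * R := by nlinarith
      nlinarith
    have hr : 0 < c / (2 * n) := by positivity
    refine le_trans (measureReal_mono (Metric.closedBall_subset_closedBall ?_) (measure_ne_top _ _))
      (measure_closedBall_mul_le hΛ hs (hdbl y (mem_unitSphere.2 hy)) ht hr)
    have h4 : 4 / c * (1 + n * R) * (c / (2 * n)) = 2 * R + 2 * (1 / n) := by field_simp; ring
    rw [h4]
    rw [hq] at hh ⊢
    nlinarith
  have h4 := hX1 y (R + 1 / n + c / 4 / n)
  have h5 := hX2 y (c / (2 * n))
  have h0 : 0 ≤ Λ * (4 / c * (1 + n * R)) ^ s := by positivity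
  calc (ballCount Y y (R + 1 / n) : ℝ)
      ≤ 2 * N * (Λ * (4 / c * (1 + n * R)) ^ s * ω.real (Metric.closedBall y (c / (2 * n)))) :=
        h1.trans (h4.trans (by gcongr))
    _ = 2 * (Λ * (4 / c * (1 + n * R)) ^ s) * (N * ω.real (Metric.closedBall y (c / (2 * n)))) := by
        ring
    _ ≤ 2 * (Λ * (4 / c * (1 + n * R)) ^ s) * (2 * ballCount Y y (c / n)) := by
        exact mul_le_mul_of_nonneg_left
          (h5.trans (mul_le_mul_of_nonneg_left h2 (by norm_num))) (by positivity)
    _ = _ := by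
        rw [mul_pow]
        ring

/-- Integration of polynomials against a measure on the sphere, as a linear functional. -/
def integralFunctional (ω : Measure (EuclideanSpace ℝ (Fin d))) (a : ℝ)
    (hint : ∀ P : MvPolynomial (Fin d) ℝ, Integrable (pEval P) ω) :
    MvPolynomial (Fin d) ℝ →ₗ[ℝ] ℝ where
  toFun P := a * ∫ x, pEval P x ∂ω
  map_add' P Q := by
    have : ∀ x, pEval (P + Q) x = pEval P x + pEval Q x := fun x => by simp [pEval]
    simp only [this]
    rw [integral_add (hint P) (hint Q), mul_add]
  map_smul' t P := by
    have : ∀ x, pEval (t • P) x = t * pEval P x := fun x => by simp [pEval]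
    simp only [this, RingHom.id_apply, smul_eq_mul]
    rw [integral_const_mul]
    ring

theorem integrable_pEval {ω : Measure (EuclideanSpace ℝ (Fin d))} [IsFiniteMeasure ω]
    (hω : ω (unitSphere d)ᶜ = 0) (P : MvPolynomial (Fin d) ℝ) : Integrable (pEval P) ω := by
  have hae : ∀ᵐ x ∂ω, x ∈ unitSphere d := hω
  rw [← Measure.restrict_eq_self_of_ae_mem hae]
  exact (continuous_pEval P).continuousOn.integrableOn_compact (isCompact_sphere _ _)

/-- Well-separated cubature formulas with equal weights for doubling measures on the sphere. -/
theorem exists_separated_cubature (hd : 2 ≤ d) {Λ : ℝ} (hΛ : 1 ≤ Λ) : ∃ K : ℝ, 0 < K ∧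
    ∀ ω : Measure (EuclideanSpace ℝ (Fin d)), IsProbabilityMeasure ω → ω (unitSphere d)ᶜ = 0 →
      (∀ x ∈ unitSphere d, ∀ r : ℝ, 0 < r →
        ω.real (Metric.closedBall x (2 * r)) ≤ Λ * ω.real (Metric.closedBall x r)) →
      ∀ n N : ℕ, 0 < n →
        (∀ x ∈ unitSphere d, K ≤ N * ω.real (Metric.closedBall x (1 / n))) →
        ∀ σ β : ℝ, 0 ≤ σ → 0 < β → (∀ x ∈ unitSphere d, ω.real (Metric.closedBall x σ) ≤ β) →
          2 * N * Λ ^ 4 * β ≤ 1 →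
          ∃ Y : Fin N → EuclideanSpace ℝ (Fin d), (∀ i, ‖Y i‖ = 1) ∧
            (∀ i j, i ≠ j → σ / 2 ≤ ‖Y i - Y j‖) ∧
            ∀ P : MvPolynomial (Fin d) ℝ, P.totalDegree ≤ n →
              N * ∫ x, pEval P x ∂ω = ∑ i, pEval P (Y i) := by
  classical
  have hΛ0 : 0 ≤ Λ := zero_le_one.trans hΛ
  obtain ⟨s, hs⟩ := pow_unbounded_of_one_lt Λ (one_lt_two (α := ℝ))
  obtain ⟨C, hC0, hC⟩ := exists_abs_pEval_sub_le (3 * s + 2)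
  obtain ⟨c, hc0, hc1, hexact⟩ := exists_exact_of_small_defect s
  obtain ⟨κ, hκ0, hκ⟩ := hexact (4 * (Λ * (4 / c) ^ s)) (by positivity)
  set ε : ℝ := min (c / 32) (κ / (24 * C)) with hε
  have hε0 : 0 < ε := by positivity
  have hεc : ε ≤ c / 32 := min_le_left _ _
  have hεκ : 24 * C * ε ≤ κ := by
    have : ε ≤ κ / (24 * C) := min_le_right _ _
    rwa [le_div_iff₀ (by positivity), mul_comm] at this
  refine ⟨2 * (Λ * (4 / ε) ^ s), by positivity,
    fun ω hprob hω hdbl n N hn hK σ β hσ hβ hβσ hβN => ?_⟩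
  have hn0 : (0 : ℝ) < n := Nat.cast_pos.2 hn
  set h : ℝ := ε / n with hh
  have hh0 : 0 < h := by positivity
  have hnh : n * h = ε := by rw [hh]; field_simp
  have hpre : IsPreconnected (unitSphere d) := by
    refine isPreconnected_sphere ?_ _ _
    rw [rank_eq_card_basis (EuclideanSpace.basisFun (Fin d) ℝ).toBasis, Fintype.card_fin]
    exact_mod_cast hd
  have hN : ∀ y ∈ unitSphere d, 2 ≤ N * ω.real (Metric.closedBall y (h / 4)) := fun y hy => by
    have h1 : 1 ≤ 4 / ε := by rw [le_div_iff₀ hε0]; linarith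
    have h2 := measure_closedBall_mul_le hΛ0 hs.le (hdbl y hy) h1 (r := h / 4) (by positivity)
    have h3 : 4 / ε * (h / 4) = 1 / n := by rw [hh]; field_simp
    rw [h3] at h2
    have h4 : 0 < Λ * (4 / ε) ^ s := by positivity
    have h5 : Λ * (4 / ε) ^ s * 2 ≤ Λ * (4 / ε) ^ s * (N * ω.real (Metric.closedBall y (h / 4))) :=
      calc Λ * (4 / ε) ^ s * 2 = 2 * (Λ * (4 / ε) ^ s) := by ring
        _ ≤ N * ω.real (Metric.closedBall y (1 / n)) := hK y hy
        _ ≤ N * (Λ * (4 / ε) ^ s * ω.real (Metric.closedBall y (h / 4))) := by gcongr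
        _ = _ := by ring
    exact le_of_mul_le_mul_left h5 h4
  obtain ⟨T, P, hsep⟩ := exists_cellPartition (isCompact_sphere _ _) hpre hω hh0 hσ hβ hN hβσ
    fun y hy => by
      have h1 := measure_closedBall_two_pow_mul_le hΛ0 (hdbl y hy) 4 (r := h / 4) (by positivity)
      rw [show (2 : ℝ) ^ 4 * (h / 4) = 4 * h by ring] at h1
      have h2 : 0 ≤ ω.real (Metric.closedBall y (h / 4)) := measureReal_nonneg
      calc 2 * N * ω.real (Metric.closedBall y (4 * h)) * β
          ≤ 2 * N * (Λ ^ 4 * ω.real (Metric.closedBall y (h / 4))) * β := by gcongr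
        _ = 2 * N * Λ ^ 4 * β * ω.real (Metric.closedBall y (h / 4)) := by ring
        _ ≤ 1 * ω.real (Metric.closedBall y (h / 4)) := by gcongr
        _ = _ := one_mul _
  have hcard := P.card_allNodes hh0 hω
  set e : P.allNodes ≃ Fin N := P.allNodes.equivFinOfCardEq hcard with he
  set X : Fin N → EuclideanSpace ℝ (Fin d) := fun i => (e.symm i : EuclideanSpace ℝ (Fin d)) with hX
  have hXmem : ∀ i, X i ∈ P.allNodes := fun i => (e.symm i).2
  have hXsum : ∀ g : EuclideanSpace ℝ (Fin d) → ℝ, ∑ i, g (X i) = ∑ x ∈ P.allNodes, g x :=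
    fun g => (Equiv.sum_comp e.symm fun x : P.allNodes => g x).trans
      (Finset.sum_coe_sort P.allNodes g)
  have hX1 : ∀ i, ‖X i‖ = 1 := fun i => by
    obtain ⟨v, hv⟩ := P.mem_allNodes.1 (hXmem i)
    exact mem_unitSphere.1 (P.node_mem v _ hv)
  have hcount : ∀ y ρ, (ballCount X y ρ : ℝ)
      = ((P.allNodes.filter fun x => dist x y ≤ ρ).card : ℝ) := fun y ρ => by
    have := hXsum fun x => if dist x y ≤ ρ then 1 else 0
    rw [← Finset.sum_filter, ← Finset.sum_filter, Finset.sum_const, Finset.sum_const, nsmul_eq_mul,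
      nsmul_eq_mul, mul_one, mul_one] at this
    rw [← this, ballCount]
    simp only [dist_eq_norm]
  have hint := integrable_pEval hω
  obtain ⟨Y, hY1, hYX, hYP⟩ := hκ d n N X (24 * C * h) (integralFunctional ω N hint) hn
    (by positivity) (by rw [show n * (24 * C * h) = 24 * C * (n * h) by ring, hnh]; exact hεκ) hX1
    (fun Y _ hYX => countDoubling_of_quantization hΛ0 hs.le hdbl hn hc0 hc1 (h := h)
      (by
        rw [hh, div_div, ← mul_div_assoc, div_le_div_iff₀ hn0 (by positivity)]
        nlinarith)
      (fun y ρ => by rw [hcount]; exact P.card_filter_le hh0 y ρ)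
      (fun y ρ => by rw [hcount]; exact P.le_card_filter hh0 hω y ρ) hYX)
    (fun Q hQ => by
      rw [defect_apply, hXsum]
      have h1 := P.abs_sub_sum_le hh0 hω (hint Q)
        (b := fun x => C * (6 * h) * locMax n (3 * s + 2) (tGrad Q) x) fun x hx u hu v hv hux hvx => by
          obtain ⟨w, hw⟩ := P.mem_allNodes.1 hx
          have hx1 := P.node_mem w x hw
          rw [dist_eq_norm] at hux hvx
          have h2 : n * (3 * h) ≤ 1 / 10 := by
            rw [show n * (3 * h) = 3 * (n * h) by ring, hnh]
            linarith
          have h3 := hC d n Q x _ hn hQ (mem_unitSphere.1 hx1)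
            (growthBound_locMax (continuous_tGrad Q) (mem_unitSphere.1 hx1)) v u (mem_unitSphere.1 hv)
            (mem_unitSphere.1 hu) (le_trans (by gcongr) h2) (le_trans (by gcongr) h2)
          refine h3.trans ?_
          have h4 := locMax_nonneg (n := n) (A := 3 * s + 2) (g := tGrad Q) x
          have h5 : ‖v - u‖ ≤ 6 * h := by
            have := norm_sub_le_norm_sub_add_norm_sub v x u
            rw [norm_sub_rev x u] at this
            linarith
          gcongr
      refine h1.trans (le_of_eq ?_)
      rw [hXsum fun x => locMax n (3 * s + 2) (tGrad Q) x, ← Finset.mul_sum]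
      ring)
  refine ⟨Y, hY1, fun i j hij => ?_, fun Q hQ => ?_⟩
  · have hne : X i ≠ X j := fun h => hij (e.symm.injective (Subtype.ext h))
    have h1 := hsep _ (hXmem i) _ (hXmem j) hne
    rw [dist_eq_norm] at h1
    linarith [hYX i j]
  · have h1 := hYP Q hQ
    rw [defect_apply, sub_eq_zero] at h1
    exact h1

/-- Well-separated Chebyshev-type cubature formulas for bounded
doubling weights on the sphere. -/
theorem wellSeparated_chebyshev_cubature (d : ℕ) (hd : 2 ≤ d) (L : ℝ) :
    ∃ K : ℝ, 0 < K ∧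
      ∀ B : ℝ, ∃ cstar : ℝ, 0 < cstar ∧
        ∀ w : EuclideanSpace ℝ (Fin d) → ℝ,
          (∀ x, 0 ≤ w x) →
          Integrable w (sphMeasure d) →
          wMass w (unitSphere d) = 1 →
          (∀ x ∈ unitSphere d, ∀ r : ℝ, 0 < r →
            wMass w (cap x (2 * r)) ≤ L * wMass w (cap x r)) →
          (∀ᵐ x ∂(sphMeasure d), w x ≤ B) →
          ∀ n N : ℕ, 0 < n →
            (∀ x ∈ unitSphere d, K ≤ (N : ℝ) * wMass w (cap x (1 / (n : ℝ)))) →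
            ∃ Z : Finset (EuclideanSpace ℝ (Fin d)), Z.card = N ∧
              (↑Z : Set (EuclideanSpace ℝ (Fin d))) ⊆ unitSphere d ∧
              (∀ P : MvPolynomial (Fin d) ℝ, P.totalDegree ≤ n →
                (∫ x, pEval P x * w x ∂(sphMeasure d))
                  = (1 / (N : ℝ)) * ∑ z ∈ Z, pEval P z) ∧
              ∀ z ∈ Z, ∀ z' ∈ Z, z ≠ z' →
                cstar * (N : ℝ) ^ (-(1 : ℝ) / ((d : ℝ) - 1)) ≤ gdist z z' := by
  classical
  have hΛ : (1 : ℝ) ≤ max L 1 ^ 2 := one_le_pow₀ (le_max_right _ _)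
  obtain ⟨K, hK0, hcub⟩ := exists_separated_cubature hd hΛ
  obtain ⟨C, hC0, hC⟩ := exists_sphMeasure_closedBall_le hd
  refine ⟨K, hK0, fun B => ?_⟩
  set Λ : ℝ := max L 1 ^ 2
  set M : ℝ := max B 1 with hM
  have hM0 : 0 < M := lt_max_of_lt_right one_pos
  set c : ℝ := min 1 (1 / (2 * Λ ^ 4 * (M * C))) with hc
  have hc0 : 0 < c := by positivity
  have hc1 : c ≤ 1 := min_le_left _ _
  have hcM : c * (2 * Λ ^ 4 * (M * C)) ≤ 1 :=
    (le_div_iff₀ (by positivity)).1 (min_le_right _ _)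
  refine ⟨c / 2, by positivity, fun w hw hint h1 hdbl hwB n N hn hK => ?_⟩
  have := isProbabilityMeasure_weightMeasure hw hint h1
  have hN : 0 < N := by
    refine Nat.pos_of_ne_zero fun h0 => ?_
    have := hK (EuclideanSpace.single ⟨0, by omega⟩ 1) (mem_unitSphere.2 (by simp))
    rw [h0, Nat.cast_zero, zero_mul] at this
    linarith
  have hN0 : (0 : ℝ) < N := Nat.cast_pos.2 hN
  set ρ : ℝ := (N : ℝ) ^ (-(1 : ℝ) / ((d : ℝ) - 1)) with hρ
  have hd1 : ((d - 1 : ℕ) : ℝ) = (d : ℝ) - 1 := by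
    rw [Nat.cast_sub (by omega), Nat.cast_one]
  have hd2 : (0 : ℝ) < (d : ℝ) - 1 := by
    rw [← hd1]
    exact Nat.cast_pos.2 (by omega)
  have hρ0 : 0 < ρ := rpow_pos_of_pos hN0 _
  have hρ1 : ρ ≤ 1 := rpow_le_one_of_one_le_of_nonpos (Nat.one_le_cast.2 hN)
    (div_nonpos_of_nonpos_of_nonneg (by norm_num) hd2.le)
  have hρN : N * ρ ^ (d - 1) = 1 := by
    rw [hρ, ← rpow_natCast, ← rpow_mul hN0.le, hd1, div_mul_cancel₀ _ hd2.ne', rpow_neg_one,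
      mul_inv_cancel₀ hN0.ne']
  have hcρ1 : c * ρ ≤ 1 := mul_le_one₀ hc1 hρ0.le hρ1
  obtain ⟨Y, hY1, hYsep, hYP⟩ := hcub (weightMeasure w) this (weightMeasure_compl w)
    (fun x hx r hr => weightMeasure_doubling hw hint h1 hx (hdbl x hx) hr) n N hn
    (fun x hx => (hK x hx).trans
      (mul_le_mul_of_nonneg_left (wMass_cap_le hw hint h1 hx _) hN0.le))
    (c * ρ) (M * (C * (c * ρ) ^ (d - 1))) (by positivity) (by positivity)
    (fun x hx => weightMeasure_closedBall_le_of_bound hM0.le (by positivity)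
      (hwB.mono fun y hy => hy.trans (le_max_left _ _)) (hC x hx _ (by positivity) hcρ1))
    (calc 2 * N * Λ ^ 4 * (M * (C * (c * ρ) ^ (d - 1)))
        = c ^ (d - 1) * (2 * Λ ^ 4 * (M * C)) * (N * ρ ^ (d - 1)) := by rw [mul_pow]; ring
      _ = c ^ (d - 1) * (2 * Λ ^ 4 * (M * C)) := by rw [hρN, mul_one]
      _ ≤ c * (2 * Λ ^ 4 * (M * C)) := by
        gcongr
        exact pow_le_of_le_one hc0.le hc1 (by omega)
      _ ≤ 1 := hcM)
  have hinj : Function.Injective Y := fun i j hij => by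
    by_contra hne
    have h2 := hYsep i j hne
    rw [hij, sub_self, norm_zero] at h2
    have : 0 < c * ρ := by positivity
    linarith
  refine ⟨Finset.univ.image Y, ?_, ?_, fun P hP => ?_, ?_⟩
  · rw [Finset.card_image_of_injective _ hinj, Finset.card_univ, Fintype.card_fin]
  · simp only [Finset.coe_image, Finset.coe_univ, Set.image_univ]
    rintro _ ⟨i, rfl⟩
    exact mem_unitSphere.2 (hY1 i)
  · rw [Finset.sum_image fun i _ j _ hij => hinj hij, ← hYP P hP, integral_weightMeasure hw hint]
    field_simp
  · simp only [Finset.mem_image, Finset.mem_univ, true_and]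
    rintro _ ⟨i, rfl⟩ _ ⟨j, rfl⟩ hij
    have h2 := hYsep i j fun h => hij (congrArg Y h)
    linarith [norm_sub_le_gdist (hY1 i) (hY1 j)]
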